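/- Define, for measurable 2π-biperiodic f with ‖f‖_(Φ) < ∞, the operator ℬf(x,y) = sup_{n≥0} ‖Σ_{k=0}^{n} S_{kk}(x,y,f)·𝟙_{δ_k^n}‖_(Ψ), where the Luxemburg Ψ-norm is taken on [0,1] with Ψ(t) = eᵗ − 1. Then there is an absolute constant c > 0 such that for every such f and every λ > 0, |{(x,y) ∈ 𝕋² : ℬf(x,y) > λ}| ≤ c·‖f‖_(Φ)/λ. -/

import Mathlib

open MeasureTheory Filter Set

noncomputable section

/-- `[-π, π)`, a fundamental domain for the circle `𝕋 = ℝ/2πℤ`. -/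
def T1 : Set ℝ := Set.Ico (-Real.pi) Real.pi

/-- `[-π, π)²`, a fundamental domain for the torus `𝕋²`. -/
def T2 : Set (ℝ × ℝ) := T1 ×ˢ T1

/-- `log⁺ u = log u` for `u > 1`, and `0` otherwise. -/
def logPlus (u : ℝ) : ℝ := if 1 < u then Real.log u else 0

/-- `f` is `2π`-periodic in each variable. -/
def Biperiodic (f : ℝ × ℝ → ℝ) : Prop :=
  ∀ x y : ℝ, f (x + 2 * Real.pi, y) = f (x, y) ∧ f (x, y + 2 * Real.pi) = f (x, y)

/-- Fourier coefficients `f̂(m,n)` of a function on `𝕋²`. -/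
def fourierCoef2 (f : ℝ × ℝ → ℝ) (m n : ℤ) : ℂ :=
  (1 / (4 * (Real.pi : ℂ) ^ 2)) *
    ∫ p in T2, (f p : ℂ) * Complex.exp (-Complex.I * ((m : ℂ) * (p.1 : ℂ) + (n : ℂ) * (p.2 : ℂ)))

/-- Quadratic partial sums `S_{nn}(x, y, f)` of the double Fourier series.
(For real `f` the symmetric sum is real, so we take the real part.) -/
def Snn (f : ℝ × ℝ → ℝ) (n : ℕ) (x y : ℝ) : ℝ :=
  (∑ m ∈ Finset.Icc (-(n : ℤ)) (n : ℤ), ∑ k ∈ Finset.Icc (-(n : ℤ)) (n : ℤ),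
    fourierCoef2 f m k * Complex.exp (Complex.I * ((m : ℂ) * (x : ℂ) + (k : ℂ) * (y : ℂ)))).re

/-- The `BMO[0,1]` norm:
`‖g‖_BMO = sup_{I ⊂ [0,1]} (1/|I|) ∫_I |g - g_I| + |∫_0^1 g|`. -/
def bmoNorm (g : ℝ → ℝ) : ℝ :=
  (⨆ I : {p : ℝ × ℝ // 0 ≤ p.1 ∧ p.1 < p.2 ∧ p.2 ≤ 1},
      (I.1.2 - I.1.1)⁻¹ *
        ∫ t in Set.Icc I.1.1 I.1.2,
          |g t - (I.1.2 - I.1.1)⁻¹ * ∫ s in Set.Icc I.1.1 I.1.2, g s|) +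
    |∫ t in Set.Icc (0 : ℝ) 1, g t|

/-- The step function `Σ_{k=0}^n ξ_k 𝟙_{δ_k^n}` with `δ_k^n = [k/(n+1), (k+1)/(n+1)]`. -/
def stepFun (ξ : ℕ → ℝ) (n : ℕ) (t : ℝ) : ℝ :=
  ∑ k ∈ Finset.range (n + 1),
    Set.indicator (Set.Icc ((k : ℝ) / ((n : ℝ) + 1)) (((k : ℝ) + 1) / ((n : ℝ) + 1)))
      (fun _ => ξ k) t

/-- `bmo[ξ_n] = sup_{n ≥ 0} ‖Σ_{k=0}^n ξ_k 𝟙_{δ_k^n}‖_BMO`. -/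
def bmoSeq (ξ : ℕ → ℝ) : ℝ := ⨆ n : ℕ, bmoNorm (stepFun ξ n)

/-- `L` is the principal value `p.v. ∫_𝕋 g`, i.e. the limit as `ε → 0⁺` of the
integrals over `{ε < |t| < π}`. -/
def pvT1 (g : ℝ → ℝ) (L : ℝ) : Prop :=
  Filter.Tendsto (fun ε : ℝ => ∫ t in {t : ℝ | ε < |t| ∧ |t| < Real.pi}, g t)
    (nhdsWithin 0 (Set.Ioi 0)) (nhds L)

/-- `L` is the two-dimensional principal value `p.v. ∬_{𝕋²} g`, the limit as `ε → 0⁺`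
of the integrals over `{ε < |t| < π, ε < |s| < π}`. -/
def pvT2 (g : ℝ × ℝ → ℝ) (L : ℝ) : Prop :=
  Filter.Tendsto
    (fun ε : ℝ =>
      ∫ q in {q : ℝ × ℝ | (ε < |q.1| ∧ |q.1| < Real.pi) ∧ ε < |q.2| ∧ |q.2| < Real.pi}, g q)
    (nhdsWithin 0 (Set.Ioi 0)) (nhds L)

/-- Luxemburg norm with respect to a Young function `M`. -/
def luxNorm {α : Type*} [MeasurableSpace α] (μ : Measure α) (M : ℝ → ℝ) (g : α → ℝ) : ℝ :=
  sInf {lam : ℝ | 0 < lam ∧ ∫⁻ x, ENNReal.ofReal (M (|g x| / lam)) ∂μ ≤ 1}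

/-- The Young function `Φ(t) = t log⁺ t`. -/
def PhiY (t : ℝ) : ℝ := t * logPlus t

/-- The Young function `Ψ(t) = eᵗ - 1`. -/
def PsiY (t : ℝ) : ℝ := Real.exp t - 1

/-- The operator `ℬf(x,y) = sup_{n≥0} ‖Σ_{k=0}^n S_{kk}(x,y,f) 𝟙_{δ_k^n}‖_(Ψ)`,
with `Ψ(t) = eᵗ - 1` and the Luxemburg norm taken on `[0,1]`. -/
def Bop (f : ℝ × ℝ → ℝ) (p : ℝ × ℝ) : ℝ :=
  ⨆ n : ℕ, luxNorm (volume.restrict (Set.Icc (0 : ℝ) 1)) PsiY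
    (stepFun (fun k => Snn f k p.1 p.2) n)

/-- Vitali: weak type (1,1) for the centred maximal function, bounded radii. -/
lemma vit_bdd {X : Type*} [PseudoMetricSpace X] [SecondCountableTopology X] [MeasurableSpace X]
    [BorelSpace X] (μ : Measure X) (C : ENNReal)
    (hC : ∀ x r, 0 < r → μ (Metric.closedBall x (5 * r)) ≤ C * μ (Metric.closedBall x r))
    (G : X → ENNReal) (lam : ENNReal) (R : ℝ) :
    lam * μ {x | ∃ r, 0 < r ∧ r ≤ R ∧
      lam * μ (Metric.closedBall x r) < ∫⁻ y in Metric.closedBall x r, G y ∂μ} ≤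
      C * ∫⁻ y, G y ∂μ := by
  set E := {x | ∃ r, 0 < r ∧ r ≤ R ∧
      lam * μ (Metric.closedBall x r) < ∫⁻ y in Metric.closedBall x r, G y ∂μ} with hE
  choose! r hr0 hrR hr using (fun x (hx : x ∈ E) => hx)
  obtain ⟨u, huE, hdisj, hcov⟩ :=
    Vitali.exists_disjoint_subfamily_covering_enlargement_closedBall E id r R hrR 5 (by norm_num)
  simp only [id] at hdisj hcov
  have hcount : u.Countable := by
    refine hdisj.countable_of_nonempty_interior ?_
    intro a ha
    refine ⟨a, Metric.ball_subset_interior_closedBall ?_⟩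
    exact Metric.mem_ball_self (hr0 a (huE ha))
  have hsub : E ⊆ ⋃ b ∈ u, Metric.closedBall b (5 * r b) := by
    intro x hx
    obtain ⟨b, hb, hbx⟩ := hcov x hx
    refine mem_biUnion hb (hbx ?_)
    exact Metric.mem_closedBall_self (hr0 x hx).le
  have hc' := hcount.to_subtype
  calc lam * μ E ≤ lam * ∑' b : u, μ (Metric.closedBall (b : X) (5 * r b)) := by
        gcongr
        refine (measure_mono hsub).trans ?_
        exact measure_biUnion_le μ hcount _
    _ ≤ lam * ∑' b : u, C * μ (Metric.closedBall (b : X) (r b)) := by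
        gcongr with b
        exact hC _ _ (hr0 b (huE b.2))
    _ = ∑' b : u, C * (lam * μ (Metric.closedBall (b : X) (r b))) := by
        rw [← ENNReal.tsum_mul_left]
        congr 1; ext b; ring
    _ ≤ ∑' b : u, C * ∫⁻ y in Metric.closedBall (b : X) (r b), G y ∂μ := by
        gcongr with b
        exact (hr b (huE b.2)).le
    _ = C * ∫⁻ y in ⋃ b ∈ u, Metric.closedBall (b : X) (r b), G y ∂μ := by
        rw [ENNReal.tsum_mul_left, lintegral_biUnion hcount
          (fun b _ => Metric.isClosed_closedBall.measurableSet) hdisj]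
    _ ≤ C * ∫⁻ y, G y ∂μ := by
        gcongr
        exact Measure.restrict_le_self

lemma vit {X : Type*} [PseudoMetricSpace X] [SecondCountableTopology X] [MeasurableSpace X]
    [BorelSpace X] (μ : Measure X) (C : ENNReal)
    (hC : ∀ x r, 0 < r → μ (Metric.closedBall x (5 * r)) ≤ C * μ (Metric.closedBall x r))
    (G : X → ENNReal) (lam : ENNReal) :
    lam * μ {x | ∃ r, 0 < r ∧
      lam * μ (Metric.closedBall x r) < ∫⁻ y in Metric.closedBall x r, G y ∂μ} ≤
      C * ∫⁻ y, G y ∂μ := by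
  have h1 : {x | ∃ r, 0 < r ∧
      lam * μ (Metric.closedBall x r) < ∫⁻ y in Metric.closedBall x r, G y ∂μ} =
      ⋃ n : ℕ, {x | ∃ r, 0 < r ∧ r ≤ (n : ℝ) ∧
      lam * μ (Metric.closedBall x r) < ∫⁻ y in Metric.closedBall x r, G y ∂μ} := by
    ext x
    simp only [mem_setOf_eq, mem_iUnion]
    constructor
    · rintro ⟨r, h0, h⟩
      obtain ⟨n, hn⟩ := exists_nat_ge r
      exact ⟨n, r, h0, hn, h⟩
    · rintro ⟨n, r, h0, hn, h⟩
      exact ⟨r, h0, h⟩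
  rw [h1, Monotone.measure_iUnion, ENNReal.mul_iSup]
  · exact iSup_le fun n => vit_bdd μ C hC G lam n
  · intro n m hnm x
    rintro ⟨r, h0, hn, h⟩
    exact ⟨r, h0, hn.trans (by exact_mod_cast hnm), h⟩

lemma vit1 (G : ℝ → ENNReal) (lam : ENNReal) :
    lam * volume {x : ℝ | ∃ r, 0 < r ∧
      lam * ENNReal.ofReal (2 * r) < ∫⁻ y in Metric.closedBall x r, G y} ≤
      5 * ∫⁻ y, G y := by
  have := vit (volume : Measure ℝ) 5 ?_ G lam
  · simpa only [Real.volume_closedBall] using this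
  · intro x r hr
    rw [Real.volume_closedBall, Real.volume_closedBall]
    rw [show (5 : ENNReal) = ENNReal.ofReal 5 by simp, ← ENNReal.ofReal_mul (by norm_num)]
    apply le_of_eq; congr 1; ring

lemma vol_cb2 (x : ℝ × ℝ) (r : ℝ) (hr : 0 < r) :
    volume (Metric.closedBall x r) = ENNReal.ofReal (4 * r ^ 2) := by
  rw [← closedBall_prod_same, Measure.volume_eq_prod, Measure.prod_prod,
    Real.volume_closedBall, Real.volume_closedBall, ← ENNReal.ofReal_mul (by positivity)]
  congr 1; ring

lemma vit2 (G : ℝ × ℝ → ENNReal) (lam : ENNReal) :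
    lam * volume {x : ℝ × ℝ | ∃ r, 0 < r ∧
      lam * ENNReal.ofReal (4 * r ^ 2) < ∫⁻ y in Metric.closedBall x r, G y} ≤
      25 * ∫⁻ y, G y := by
  have := vit (volume : Measure (ℝ × ℝ)) 25 ?_ G lam
  · convert this using 6 with x
    ext r
    constructor
    · rintro ⟨h, h2⟩; refine ⟨h, ?_⟩; rwa [vol_cb2 _ _ h]
    · rintro ⟨h, h2⟩; refine ⟨h, ?_⟩; rwa [vol_cb2 _ _ h] at h2
  · intro x r hr
    rw [vol_cb2 _ _ (by positivity), vol_cb2 _ _ hr]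
    rw [show (25 : ENNReal) = ENNReal.ofReal 25 by simp, ← ENNReal.ofReal_mul (by norm_num)]
    apply le_of_eq; congr 1; ring

/-- dyadic block average -/
def dAvg (F : ℕ → ℝ) (s m : ℕ) : ℝ := (∑ k ∈ Finset.range (2 ^ m), F (s + k)) / 2 ^ m

lemma dAvg_succ (F : ℕ → ℝ) (s m : ℕ) :
    dAvg F s (m + 1) = (dAvg F s m + dAvg F (s + 2 ^ m) m) / 2 := by
  unfold dAvg
  rw [pow_succ, mul_two, Finset.sum_range_add, pow_succ]
  simp only [add_assoc]
  field_simp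

set_option maxHeartbeats 1000000 in
lemma bellman (v1 v2 d : ℝ) (h1 : 0 ≤ v1) (h2 : 0 ≤ v2) 
    (hv : (v1 + v2) / 2 + d ^ 2 ≤ 1) :
    (Real.exp (d / 4) * (1 + 3 * v1 - v1 ^ 2) + Real.exp (-(d / 4)) * (1 + 3 * v2 - v2 ^ 2)) / 2 ≤
      1 + 3 * ((v1 + v2) / 2 + d ^ 2) - ((v1 + v2) / 2 + d ^ 2) ^ 2 := by
  have hd : d ^ 2 ≤ 1 := by linarith
  have hd1 : |d| ≤ 1 := by rwa [← sq_le_one_iff_abs_le_one]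
  have hx : |d / 4| ≤ 1 := by rw [abs_div]; norm_num; linarith
  have hx' : |-(d / 4)| ≤ 1 := by rwa [abs_neg]
  have e1 := (abs_le.1 (Real.abs_exp_sub_one_sub_id_le hx)).2
  have e2 := (abs_le.1 (Real.abs_exp_sub_one_sub_id_le hx')).2
  have e1' : Real.exp (d / 4) ≤ 1 + d / 4 + (d / 4) ^ 2 := by linarith
  have e2' : Real.exp (-(d / 4)) ≤ 1 - d / 4 + (d / 4) ^ 2 := by nlinarith
  have p1 : 0 ≤ 1 + 3 * v1 - v1 ^ 2 := by nlinarith [sq_nonneg d]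
  have p2 : 0 ≤ 1 + 3 * v2 - v2 ^ 2 := by nlinarith [sq_nonneg d]
  have q1 := mul_le_mul_of_nonneg_right e1' p1
  have q2 := mul_le_mul_of_nonneg_right e2' p2
  obtain ⟨M, hM⟩ : ∃ M, M = (v1 + v2) / 2 := ⟨_, rfl⟩
  obtain ⟨w, hw⟩ : ∃ w, w = (v1 - v2) / 2 := ⟨_, rfl⟩
  have hv1 : v1 = M + w := by rw [hM, hw]; ring
  have hv2 : v2 = M - w := by rw [hM, hw]; ring
  rw [← hM] at hv ⊢
  have hM0 : 0 ≤ M := by rw [hM]; positivity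
  rw [hv1] at q1
  rw [hv2] at q2
  rw [hv1, hv2]
  have key : (d/4)^2 * (1 + 3 * M - M^2 - w^2) + (d/4) * w * (3 - 2 * M) - w ^ 2 ≤ d ^ 2 := by
    have k1 : (d/4)^2 * (1 + 3 * M - M^2 - w^2) ≤ (d/4)^2 * 4 := by
      apply mul_le_mul_of_nonneg_left _ (sq_nonneg _)
      nlinarith [sq_nonneg d, sq_nonneg w, sq_nonneg M]
    have k2 : (d/4) * w * (3 - 2 * M) - w ^ 2 ≤ (9/4) * (d/4)^2 := by
      have : (3 - 2 * M)^2 ≤ 9 := by nlinarith [sq_nonneg d]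
      nlinarith [sq_nonneg ((d/4) * (3 - 2 * M) / 2 - w), mul_le_mul_of_nonneg_left this (sq_nonneg (d/4))]
    nlinarith [sq_nonneg d]
  have k3 : d ^ 2 ≤ d ^ 2 * (3 - 2 * M - d ^ 2) := by
    nlinarith [sq_nonneg d]
  have id1 : ((1 + d / 4 + (d / 4) ^ 2) * (1 + 3 * (M + w) - (M + w) ^ 2) +
      (1 - d / 4 + (d / 4) ^ 2) * (1 + 3 * (M - w) - (M - w) ^ 2)) / 2 =
      1 + 3 * M - M ^ 2 + ((d/4)^2 * (1 + 3 * M - M^2 - w^2) + (d/4) * w * (3 - 2 * M) - w ^ 2) := by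
    ring
  have id2 : 1 + 3 * (M + d ^ 2) - (M + d ^ 2) ^ 2 =
    1 + 3 * M - M ^ 2 + d ^ 2 * (3 - 2 * M - d ^ 2) := by ring
  rw [id2]
  linarith

lemma dAvg_var_nonneg (a : ℕ → ℝ) (s m : ℕ) :
    0 ≤ dAvg (fun k => a k ^ 2) s m - dAvg a s m ^ 2 := by
  unfold dAvg
  have h := sq_sum_le_card_mul_sum_sq (s := Finset.range (2 ^ m)) (f := fun k => a (s + k))
  rw [Finset.card_range] at h
  push_cast at h
  rw [div_pow, sub_nonneg, div_le_div_iff₀ (by positivity) (by positivity)]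
  have h2 : (0:ℝ) < 2 ^ m := by positivity
  nlinarith

lemma jn_ind (a : ℕ → ℝ)
    (h : ∀ s m, dAvg (fun k => a k ^ 2) s m - dAvg a s m ^ 2 ≤ 1) (m : ℕ) : ∀ s,
    dAvg (fun k => Real.exp (a k / 4)) s m ≤ Real.exp (dAvg a s m / 4) *
      (1 + 3 * (dAvg (fun k => a k ^ 2) s m - dAvg a s m ^ 2)
        - (dAvg (fun k => a k ^ 2) s m - dAvg a s m ^ 2) ^ 2) := by
  induction m with
  | zero => intro s; simp [dAvg]
  | succ m ih =>
    intro s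
    have hvar := h s (m + 1)
    have i1 := ih s
    have i2 := ih (s + 2 ^ m)
    have n1 := dAvg_var_nonneg a s m
    have n2 := dAvg_var_nonneg a (s + 2 ^ m) m
    rw [dAvg_succ, dAvg_succ] at hvar
    rw [dAvg_succ, dAvg_succ, dAvg_succ]
    set A1 := dAvg a s m
    set A2 := dAvg a (s + 2 ^ m) m
    set W1 := dAvg (fun k => a k ^ 2) s m
    set W2 := dAvg (fun k => a k ^ 2) (s + 2 ^ m) m
    have hb := bellman (W1 - A1 ^ 2) (W2 - A2 ^ 2) ((A1 - A2) / 2) n1 n2 (by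
      nlinarith)
    have hv : ((W1 - A1 ^ 2) + (W2 - A2 ^ 2)) / 2 + ((A1 - A2) / 2) ^ 2 =
      (W1 + W2) / 2 - ((A1 + A2) / 2) ^ 2 := by ring
    rw [hv] at hb
    refine le_trans ?_ (mul_le_mul_of_nonneg_left hb (Real.exp_pos _).le)
    have e1 : Real.exp (A1 / 4) = Real.exp ((A1 + A2) / 2 / 4) * Real.exp ((A1 - A2) / 2 / 4) := by
      rw [← Real.exp_add]; congr 1; ring
    have e2 : Real.exp (A2 / 4) = Real.exp ((A1 + A2) / 2 / 4) * Real.exp (-((A1 - A2) / 2 / 4)) := by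
      rw [← Real.exp_add]; congr 1; ring
    rw [e1] at i1
    rw [e2] at i2
    calc _ ≤ _ := div_le_div_of_nonneg_right (add_le_add i1 i2) (by norm_num)
      _ = _ := by ring

lemma jn_one (a : ℕ → ℝ)
    (h : ∀ s m, dAvg (fun k => a k ^ 2) s m - dAvg a s m ^ 2 ≤ 1) (m : ℕ)
    (hm : dAvg a 0 m ≤ 1) :
    dAvg (fun k => Real.exp (a k / 4)) 0 m ≤ 4 := by
  refine (jn_ind a h m 0).trans ?_
  have h1 := h 0 m
  have h0 := dAvg_var_nonneg a 0 m
  set v := dAvg (fun k => a k ^ 2) 0 m - dAvg a 0 m ^ 2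
  have e : Real.exp (dAvg a 0 m / 4) ≤ 4 / 3 := by
    have : Real.exp (dAvg a 0 m / 4) ≤ Real.exp (1 / 4) := Real.exp_le_exp.2 (by linarith)
    have h5 := (abs_le.1 (Real.abs_exp_sub_one_sub_id_le (x := 1/4) (by norm_num [abs_of_pos]))).2
    linarith
  have : 1 + 3 * v - v ^ 2 ≤ 3 := by nlinarith
  have : 0 ≤ 1 + 3 * v - v ^ 2 := by nlinarith
  nlinarith [Real.exp_pos (dAvg a 0 m / 4)]

lemma dAvg_neg (a : ℕ → ℝ) (s m : ℕ) : dAvg (fun k => - a k) s m = - dAvg a s m := by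
  simp [dAvg, neg_div]

lemma jn_final (a : ℕ → ℝ)
    (h : ∀ s m, dAvg (fun k => a k ^ 2) s m - dAvg a s m ^ 2 ≤ 1)
    (hm : ∀ m, |dAvg a 0 m| ≤ 1) (n : ℕ) :
    ∑ k ∈ Finset.range (n + 1), Real.exp (|a k| / 16) ≤ 2 * (n + 1) := by
  have key : ∑ k ∈ Finset.range (n + 1), Real.exp (|a k| / 4) ≤ 16 * (n + 1) := by
    obtain ⟨m, hm1, hm2⟩ : ∃ m, n + 1 ≤ 2 ^ m ∧ 2 ^ m ≤ 2 * (n + 1) := by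
      refine ⟨Nat.log 2 (n + 1) + 1, ?_, ?_⟩
      · exact (Nat.lt_pow_succ_log_self (by norm_num) _).le
      · rw [pow_succ, mul_comm]
        exact Nat.mul_le_mul_left 2 (Nat.pow_log_le_self 2 (by omega))
    have j1 := jn_one a h m (abs_le.1 (hm m)).2
    have j2 := jn_one (fun k => - a k) (by
      intro s m; simpa [dAvg_neg] using h s m) m (by rw [dAvg_neg]; linarith [(abs_le.1 (hm m)).1])
    unfold dAvg at j1 j2
    have hp : (0:ℝ) < 2 ^ m := by positivity
    rw [div_le_iff₀ hp] at j1 j2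
    simp only [zero_add] at j1 j2
    calc ∑ k ∈ Finset.range (n + 1), Real.exp (|a k| / 4) 
        ≤ ∑ k ∈ Finset.range (2 ^ m), Real.exp (|a k| / 4) := by
          apply Finset.sum_le_sum_of_subset_of_nonneg
          · intro k; simp only [Finset.mem_range]; omega
          · intros; positivity
      _ ≤ ∑ k ∈ Finset.range (2 ^ m), (Real.exp (a k / 4) + Real.exp (- a k / 4)) := by
          apply Finset.sum_le_sum
          intro k _
          rcases abs_cases (a k) with ⟨hh, _⟩ | ⟨hh, _⟩ <;> rw [hh]
          · linarith [Real.exp_pos (- a k / 4)]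
          · linarith [Real.exp_pos (a k / 4)]
      _ ≤ 8 * 2 ^ m := by rw [Finset.sum_add_distrib]; linarith
      _ ≤ 16 * (n + 1) := by
          have : (2:ℝ) ^ m ≤ 2 * (n + 1) := by exact_mod_cast hm2
          linarith
  have h4 : ((∑ k ∈ Finset.range (n + 1), Real.exp (|a k| / 16)) / (n + 1)) ^ 4 ≤ 16 := by
    have := Real.pow_arith_mean_le_arith_mean_pow (Finset.range (n + 1))
      (fun _ => 1 / ((n : ℝ) + 1)) (fun k => Real.exp (|a k| / 16)) (fun _ _ => by positivity)
      (by simp; field_simp) (fun _ _ => by positivity) 4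
    rw [← Finset.mul_sum, ← Finset.mul_sum] at this
    have hx : ∀ k, Real.exp (|a k| / 16) ^ 4 = Real.exp (|a k| / 4) := by
      intro k; rw [← Real.exp_nat_mul]; congr 1; push_cast; ring
    simp only [hx] at this
    have hn : (0:ℝ) < n + 1 := by positivity
    calc _ = (1 / ((n:ℝ) + 1) * ∑ k ∈ Finset.range (n + 1), Real.exp (|a k| / 16)) ^ 4 := by
            congr 1; ring
      _ ≤ _ := this
      _ ≤ 1 / ((n:ℝ) + 1) * (16 * (n + 1)) := by gcongr
      _ = 16 := by field_simp
  have : (∑ k ∈ Finset.range (n + 1), Real.exp (|a k| / 16)) / (n + 1) ≤ 2 := by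
    by_contra hc
    push Not at hc
    have := pow_lt_pow_left₀ hc (by norm_num) (n := 4) (by norm_num)
    linarith
  rwa [div_le_iff₀ (by positivity)] at this

lemma tail_bound (G : ℝ → ENNReal) (hG : Measurable G) (y D : ℝ) (hD : 0 < D) (A : ENNReal)
    (h : ∀ r, D ≤ r → ∫⁻ z in Metric.closedBall y r, G z ≤ A * ENNReal.ofReal r) :
    ∫⁻ z in {z | D < |y - z|}, G z * ENNReal.ofReal (1 / (y - z) ^ 2) ≤
      A * ENNReal.ofReal (4 / D) := by
  have hms : MeasurableSet {z | D < |y - z|} :=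
    measurableSet_lt measurable_const (by fun_prop)
  have h1 : ∫⁻ z in {z | D < |y - z|}, G z * ENNReal.ofReal (1 / (y - z) ^ 2) ≤
      ∫⁻ z, ∑' i : ℕ, ENNReal.ofReal ((1 / 4) ^ i / D ^ 2) *
        (Metric.closedBall y (2 ^ (i + 1) * D)).indicator G z := by
    rw [← lintegral_indicator hms]
    apply lintegral_mono
    intro z
    by_cases hz : z ∈ {z | D < |y - z|}
    · rw [indicator_of_mem hz]
      have hz' : D < |y - z| := hz
      obtain ⟨i, hi1, hi2⟩ := exists_nat_pow_near (x := |y - z| / D) (y := 2)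
        (by rw [le_div_iff₀ hD]; linarith) (by norm_num)
      rw [le_div_iff₀ hD] at hi1
      rw [div_lt_iff₀ hD] at hi2
      refine le_trans ?_ (ENNReal.le_tsum i)
      rw [indicator_of_mem (by
        rw [Metric.mem_closedBall, dist_comm, Real.dist_eq]; exact hi2.le), mul_comm]
      refine mul_le_mul' (ENNReal.ofReal_le_ofReal ?_) le_rfl
      rw [← sq_abs (y - z), one_div_pow, div_div]
      apply one_div_le_one_div_of_le (by positivity)
      calc (4:ℝ) ^ i * D ^ 2 = (2 ^ i * D) ^ 2 := by
            rw [mul_pow, ← pow_mul, mul_comm i 2, pow_mul]; norm_num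
        _ ≤ _ := by gcongr
    · rw [indicator_of_notMem hz]; exact zero_le
  refine h1.trans ?_
  rw [lintegral_tsum (fun i => ((hG.indicator Metric.isClosed_closedBall.measurableSet).const_mul _).aemeasurable)]
  have h2 : ∀ i : ℕ, ∫⁻ z, ENNReal.ofReal ((1 / 4) ^ i / D ^ 2) *
        (Metric.closedBall y (2 ^ (i + 1) * D)).indicator G z ≤
        A * ENNReal.ofReal ((2 / D) * (1 / 2) ^ i) := by
    intro i
    rw [lintegral_const_mul _ (hG.indicator Metric.isClosed_closedBall.measurableSet),
      lintegral_indicator Metric.isClosed_closedBall.measurableSet]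
    have h3 := h (2 ^ (i + 1) * D) (by
      have : (1:ℝ) ≤ 2 ^ (i + 1) := one_le_pow₀ (by norm_num)
      nlinarith)
    calc _ ≤ ENNReal.ofReal ((1 / 4) ^ i / D ^ 2) * (A * ENNReal.ofReal (2 ^ (i + 1) * D)) := by
          gcongr
      _ = A * (ENNReal.ofReal ((1 / 4) ^ i / D ^ 2) * ENNReal.ofReal (2 ^ (i + 1) * D)) := by ring
      _ = _ := by
          rw [← ENNReal.ofReal_mul (by positivity)]
          congr 2
          have : ((1:ℝ) / 4) ^ i = (1 / 2) ^ i * (1 / 2) ^ i := by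
            rw [← mul_pow]; norm_num
          rw [this, pow_succ]
          have h5 : ((1:ℝ) / 2) ^ i * 2 ^ i = 1 := by rw [← mul_pow]; norm_num
          field_simp
          rw [pow_succ, ← mul_assoc, h5, one_mul]
  refine (ENNReal.tsum_le_tsum h2).trans ?_
  rw [ENNReal.tsum_mul_left, ← ENNReal.ofReal_tsum_of_nonneg (fun i => by positivity)
    (summable_geometric_two.mul_left _), tsum_mul_left, tsum_geometric_two]
  apply le_of_eq; congr 2; ring

def badE (G : ℝ → ENNReal) (lam : ENNReal) : Set ℝ :=
  {x | ∃ r, 0 < r ∧ lam * ENNReal.ofReal (2 * r) < ∫⁻ y in Metric.closedBall x r, G y}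

def dE (G : ℝ → ENNReal) (lam : ENNReal) (y : ℝ) : ℝ := Metric.infDist y (badE G lam)ᶜ

def marI (G : ℝ → ENNReal) (lam : ENNReal) (x : ℝ) : ENNReal :=
  ∫⁻ y, G y * ENNReal.ofReal (dE G lam y / (x - y) ^ 2)

lemma dE_nonneg (G : ℝ → ENNReal) (lam : ENNReal) (y : ℝ) : 0 ≤ dE G lam y :=
  Metric.infDist_nonneg

lemma dE_meas (G : ℝ → ENNReal) (lam : ENNReal) : Measurable (dE G lam) :=
  (Metric.continuous_infDist_pt _).measurable

lemma not_badE {G : ℝ → ENNReal} {lam : ENNReal} {x : ℝ} (hx : x ∉ badE G lam) (r : ℝ)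
    (hr : 0 < r) : ∫⁻ y in Metric.closedBall x r, G y ≤ lam * ENNReal.ofReal (2 * r) := by
  by_contra hc
  push Not at hc
  exact hx ⟨r, hr, hc⟩

lemma marI_meas (G : ℝ → ENNReal) (hG : Measurable G) (lam : ENNReal) :
    Measurable (marI G lam) := by
  unfold marI
  apply Measurable.lintegral_prod_right'
    (f := fun p : ℝ × ℝ => G p.2 * ENNReal.ofReal (dE G lam p.2 / (p.1 - p.2) ^ 2))
  have := dE_meas G lam
  fun_prop

lemma marI_int (G : ℝ → ENNReal) (hG : Measurable G) (lam : ENNReal) :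
    ∫⁻ x in (badE G lam)ᶜ, marI G lam x ≤ 16 * ∫⁻ y, G y := by
  unfold marI
  rw [lintegral_lintegral_swap]
  · rw [← lintegral_const_mul _ hG]
    apply lintegral_mono
    intro y
    have hd := dE_meas G lam
    beta_reduce
    rw [lintegral_const_mul _ (by fun_prop), mul_comm]
    gcongr
    rcases (dE_nonneg G lam y).eq_or_lt with h0 | h0
    · simp [← h0]
    · calc ∫⁻ x in (badE G lam)ᶜ, ENNReal.ofReal (dE G lam y / (x - y) ^ 2) 
          ≤ ∫⁻ x in {x | dE G lam y / 2 < |y - x|}, ENNReal.ofReal (dE G lam y / (x - y) ^ 2) := by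
            apply lintegral_mono_set
            intro x hx
            have : dE G lam y ≤ |y - x| := by
              rw [← Real.dist_eq]
              exact Metric.infDist_le_dist_of_mem hx
            show dE G lam y / 2 < |y - x|
            linarith
        _ = ENNReal.ofReal (dE G lam y) * ∫⁻ x in {x | dE G lam y / 2 < |y - x|}, 
              1 * ENNReal.ofReal (1 / (y - x) ^ 2) := by
            rw [← lintegral_const_mul _ (by fun_prop)]
            congr 1; ext x
            rw [one_mul, ← ENNReal.ofReal_mul h0.le]
            congr 1
            rw [← neg_sub y x, neg_sq]; ring
        _ ≤ ENNReal.ofReal (dE G lam y) * (2 * ENNReal.ofReal (4 / (dE G lam y / 2))) := by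
            gcongr
            apply tail_bound (fun _ => 1) measurable_const y _ (by positivity) 2
            intro r hr
            rw [setLIntegral_one, Real.volume_closedBall, ENNReal.ofReal_mul (by norm_num)]
            simp
        _ = 16 := by
            rw [mul_left_comm, ← ENNReal.ofReal_mul h0.le]
            have : dE G lam y * (4 / (dE G lam y / 2)) = 8 := by field_simp; norm_num
            rw [this]
            rw [show (8:ℝ) = ((8:ℕ):ℝ) by norm_num, ENNReal.ofReal_natCast]
            norm_num
  · have := dE_meas G lam
    apply Measurable.aemeasurable
    fun_prop

lemma bad_meas (G : ℝ → ENNReal) (hG : Measurable G) (lam : ENNReal) :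
    lam * volume {x | x ∈ badE G lam ∨ lam < marI G lam x} ≤ 21 * ∫⁻ y, G y := by
  have h1 := vit1 G lam
  have h2 : lam * volume ({x | lam < marI G lam x} ∩ (badE G lam)ᶜ) ≤ 16 * ∫⁻ y, G y := by
    rw [← Measure.restrict_apply (measurableSet_lt measurable_const (marI_meas G hG lam))]
    refine le_trans ?_ (marI_int G hG lam)
    refine le_trans ?_ (mul_meas_ge_le_lintegral₀ (marI_meas G hG lam).aemeasurable lam)
    exact mul_le_mul' le_rfl (measure_mono (fun x hx => show lam ≤ marI G lam x from le_of_lt (show lam < marI G lam x from hx)))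
  have h3 : {x | x ∈ badE G lam ∨ lam < marI G lam x} ⊆
      badE G lam ∪ ({x | lam < marI G lam x} ∩ (badE G lam)ᶜ) := by
    intro x hx
    by_cases h : x ∈ badE G lam
    · exact Or.inl h
    · exact Or.inr ⟨hx.resolve_left h, h⟩
  calc _ ≤ lam * (volume (badE G lam) + volume ({x | lam < marI G lam x} ∩ (badE G lam)ᶜ)) := by
        gcongr
        exact (measure_mono h3).trans (measure_union_le _ _)
    _ ≤ 5 * (∫⁻ y, G y) + 16 * ∫⁻ y, G y := by
        rw [mul_add]; exact add_le_add h1 h2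
    _ = _ := by rw [← add_mul]; norm_num

def wN (N u : ℝ) : ℝ := if N * |u| ≤ 1 then 4 * N else 10 / (N * u ^ 2)

lemma wN_meas (N : ℝ) : Measurable (wN N) := by
  unfold wN
  apply Measurable.ite
  · exact measurableSet_le (by fun_prop) measurable_const
  · fun_prop
  · fun_prop

lemma wN_le (N u : ℝ) (hN : 0 < N) : wN N u ≤ 10 * N := by
  unfold wN
  split_ifs with h
  · linarith
  · push Not at h
    have : 1 < (N * |u|) ^ 2 := by nlinarith
    rw [mul_pow, sq_abs] at this
    have hu : 0 < u ^ 2 := by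
      rcases (sq_nonneg u).eq_or_lt with h0 | h0
      · rw [← h0] at this; norm_num at this
      · exact h0
    rw [div_le_iff₀ (by positivity)]
    nlinarith

lemma ball_bd {G : ℝ → ENNReal} {lam : ENNReal} (hne : (badE G lam)ᶜ.Nonempty) (y D : ℝ)
    (hD : dE G lam y < D) (r : ℝ) (hr : D ≤ r) :
    ∫⁻ z in Metric.closedBall y r, G z ≤ (4 * lam) * ENNReal.ofReal r := by
  obtain ⟨x', hx', hd⟩ := (Metric.infDist_lt_iff hne).1 hD
  have hr0 : 0 < r := by linarith [dE_nonneg G lam y]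
  calc _ ≤ ∫⁻ z in Metric.closedBall x' (2 * r), G z := by
        apply lintegral_mono_set
        apply Metric.closedBall_subset_closedBall'
        linarith
    _ ≤ lam * ENNReal.ofReal (2 * (2 * r)) := not_badE hx' _ (by positivity)
    _ = _ := by
        rw [← mul_assoc, ENNReal.ofReal_mul (by norm_num)]
        rw [show (2:ℝ) * 2 = ((4:ℕ):ℝ) by norm_num, ENNReal.ofReal_natCast]
        push_cast; ring

lemma inner_bd {G : ℝ → ENNReal} (hG : Measurable G) {lam : ENNReal}
    (hne : (badE G lam)ᶜ.Nonempty) (y N : ℝ) (hN : 0 < N) :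
    ∫⁻ z, G z * ENNReal.ofReal (wN N (z - y)) ≤
      (200 * lam) * ENNReal.ofReal (1 + N * dE G lam y) := by
  set D := dE G lam y + 1 / N with hD
  have hN' : 0 < 1 / N := by positivity
  have hd0 := dE_nonneg G lam y
  have hD0 : 0 < D := by linarith
  have hDN : 1 / N ≤ D := by linarith
  have hb := ball_bd hne y D (by linarith)
  have hND : N * D = 1 + N * dE G lam y := by rw [hD]; field_simp; ring
  rw [← hND]
  have hms : MeasurableSet {z | D < |y - z|} :=
    measurableSet_lt measurable_const (by fun_prop)
  rw [← lintegral_add_compl _ hms]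
  have h1 : ∫⁻ z in {z | D < |y - z|}, G z * ENNReal.ofReal (wN N (z - y)) ≤
      (160 * lam) * ENNReal.ofReal (N * D) := by
    calc _ ≤ ∫⁻ z in {z | D < |y - z|}, ENNReal.ofReal (10 / N) * (G z * ENNReal.ofReal (1 / (y - z) ^ 2)) := by
          apply setLIntegral_mono' hms
          intro z hz
          have hz' : D < |y - z| := hz
          rw [mul_left_comm, ← ENNReal.ofReal_mul (by positivity)]
          gcongr
          rw [wN, if_neg, ← neg_sub y z, neg_sq]
          · apply le_of_eq; field_simp
          · push Not
            rw [abs_sub_comm]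
            calc 1 = N * (1 / N) := by field_simp
              _ < _ := by gcongr; linarith
      _ ≤ ENNReal.ofReal (10 / N) * (4 * lam * ENNReal.ofReal (4 / D)) := by
          rw [lintegral_const_mul _ (by fun_prop)]
          gcongr
          exact tail_bound G hG y D hD0 _ hb
      _ = (16 * lam) * (ENNReal.ofReal (10 / (N * D))) := by
          have : ENNReal.ofReal (10 / N) * (4 * lam * ENNReal.ofReal (4 / D)) =
            (4 * lam) * (ENNReal.ofReal (10 / N) * ENNReal.ofReal (4 / D)) := by ring
          rw [this, ← ENNReal.ofReal_mul (by positivity)]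
          rw [show 10 / N * (4 / D) = 4 * (10 / (N * D)) by field_simp]
          rw [ENNReal.ofReal_mul (by norm_num)]
          rw [show (4:ℝ) = ((4:ℕ):ℝ) by norm_num, ENNReal.ofReal_natCast]
          rw [← mul_assoc]; congr 1; push_cast; ring
      _ ≤ (16 * lam) * (ENNReal.ofReal (10 * (N * D))) := by
          gcongr
          have : 1 ≤ N * D := by rw [hND]; nlinarith
          rw [div_le_iff₀ (by positivity)]
          nlinarith
      _ = _ := by
          rw [ENNReal.ofReal_mul (by norm_num)]
          rw [show (10:ℝ) = ((10:ℕ):ℝ) by norm_num, ENNReal.ofReal_natCast]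
          rw [← mul_assoc]; congr 1; push_cast; ring
  have h2 : ∫⁻ z in {z | D < |y - z|}ᶜ, G z * ENNReal.ofReal (wN N (z - y)) ≤
      (40 * lam) * ENNReal.ofReal (N * D) := by
    calc _ ≤ ∫⁻ z in Metric.closedBall y D, G z * ENNReal.ofReal (10 * N) := by
          have : {z | D < |y - z|}ᶜ = Metric.closedBall y D := by
            ext z
            simp only [mem_compl_iff, Metric.mem_closedBall, dist_comm z y, Real.dist_eq]
            exact not_lt (a := D) (b := |y - z|)
          rw [this]
          apply lintegral_mono
          intro z
          show G z * _ ≤ G z * _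
          gcongr
          exact wN_le _ _ hN
      _ ≤ (4 * lam) * ENNReal.ofReal D * ENNReal.ofReal (10 * N) := by
          rw [lintegral_mul_const _ hG]
          gcongr
          exact hb D le_rfl
      _ = _ := by
          rw [mul_assoc, ← ENNReal.ofReal_mul hD0.le, show D * (10 * N) = 10 * (N * D) by ring,
            ENNReal.ofReal_mul (by norm_num)]
          rw [show (10:ℝ) = ((10:ℕ):ℝ) by norm_num, ENNReal.ofReal_natCast]
          rw [← mul_assoc]; congr 1; push_cast; ring
  refine (add_le_add h1 h2).trans (le_of_eq ?_)
  rw [← add_mul, ← add_mul]; norm_num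

lemma Q_bd {G : ℝ → ENNReal} (hG : Measurable G) {lam : ENNReal}
    {x : ℝ} (hx : x ∉ badE G lam) (hI : marI G lam x ≤ lam) (N : ℝ) (hN : 0 < N) :
    ∫⁻ y in {y | 1 / N < |x - y|}, G y * ENNReal.ofReal (1 / (x - y) ^ 2) *
      ∫⁻ z, G z * ENNReal.ofReal (wN N (z - y)) ≤ 1800 * lam ^ 2 * ENNReal.ofReal N := by
  have hdm := dE_meas G lam
  have hN' : 0 < 1 / N := by positivity
  calc _ ≤ ∫⁻ y in {y | 1 / N < |x - y|}, (200 * lam) * (G y * ENNReal.ofReal (1 / (x - y) ^ 2) +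
            ENNReal.ofReal N * (G y * ENNReal.ofReal (dE G lam y / (x - y) ^ 2))) := by
        apply lintegral_mono
        intro y
        beta_reduce
        calc _ ≤ G y * ENNReal.ofReal (1 / (x - y) ^ 2) * 
              ((200 * lam) * ENNReal.ofReal (1 + N * dE G lam y)) := by
              gcongr; exact inner_bd hG ⟨x, hx⟩ y N hN
          _ = (200 * lam) * (G y * ENNReal.ofReal (1 / (x - y) ^ 2) * (1 + ENNReal.ofReal N * ENNReal.ofReal (dE G lam y))) := by
              rw [ENNReal.ofReal_add (by norm_num) (mul_nonneg hN.le (dE_nonneg _ _ _)),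
                ENNReal.ofReal_mul hN.le, ENNReal.ofReal_one]; ring
          _ = _ := by
              have : ENNReal.ofReal (dE G lam y / (x - y) ^ 2) = 
                ENNReal.ofReal (1 / (x - y) ^ 2) * ENNReal.ofReal (dE G lam y) := by
                rw [← ENNReal.ofReal_mul (by positivity)]; congr 1; ring
              rw [this]; ring
    _ ≤ (200 * lam) * ((2 * lam) * ENNReal.ofReal (4 / (1 / N)) + ENNReal.ofReal N * lam) := by
        rw [lintegral_const_mul _ (by fun_prop), lintegral_add_left (by fun_prop),
          lintegral_const_mul _ (by fun_prop)]
        gcongr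
        · apply tail_bound G hG x _ hN'
          intro r hr
          refine (not_badE hx r (by linarith)).trans (le_of_eq ?_)
          rw [ENNReal.ofReal_mul (by norm_num)]; simp; ring
        · refine le_trans ?_ hI
          exact setLIntegral_le_lintegral _ _
    _ = _ := by
        rw [show 4 / (1 / N) = 4 * N by field_simp, ENNReal.ofReal_mul (by norm_num)]
        rw [show (4:ℝ) = ((4:ℕ):ℝ) by norm_num, ENNReal.ofReal_natCast]
        push_cast; ring

/-- geometric sum of characters -/
def gsum (M : ℕ) (u : ℝ) : ℂ := ∑ j ∈ Finset.range M, Complex.exp (Complex.I * (j * u : ℝ))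

lemma norm_expI (u : ℝ) : ‖Complex.exp (Complex.I * (u : ℝ))‖ = 1 := by
  rw [mul_comm]; exact Complex.norm_exp_ofReal_mul_I u

lemma gsum_le (M : ℕ) (u : ℝ) : ‖gsum M u‖ ≤ M := by
  refine (norm_sum_le _ _).trans ?_
  rw [Finset.sum_congr rfl (fun j _ => norm_expI _)]
  simp

lemma norm_one_sub_expI (u : ℝ) : ‖1 - Complex.exp (Complex.I * u)‖ = 2 * |Real.sin (u / 2)| := by
  rw [norm_sub_rev, Complex.norm_exp_I_mul_ofReal_sub_one]
  rw [Real.norm_eq_abs, abs_mul]; norm_num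

lemma abs_sin_half_ge (u : ℝ) (hu : |u| ≤ Real.pi) : |u| / Real.pi ≤ |Real.sin (u / 2)| := by
  have h := Real.mul_abs_le_abs_sin (x := u / 2) (by
    rw [abs_div, abs_two]; linarith)
  rw [abs_div, abs_two] at h
  refine le_trans (le_of_eq ?_) h
  field_simp

lemma gsum_le' (M : ℕ) (u : ℝ) (hu : |u| ≤ Real.pi) : |u| * ‖gsum M u‖ ≤ Real.pi := by
  have hpi := Real.pi_pos
  have h1 : gsum M u * (1 - Complex.exp (Complex.I * u)) = 1 - Complex.exp (Complex.I * (M * u : ℝ)) := by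
    have : gsum M u = ∑ j ∈ Finset.range M, (Complex.exp (Complex.I * u)) ^ j := by
      unfold gsum
      apply Finset.sum_congr rfl
      intro j _
      rw [← Complex.exp_nat_mul]; congr 1; push_cast; ring
    rw [this, geom_sum_mul_neg, ← Complex.exp_nat_mul]
    congr 2; push_cast; ring
  have h2 : ‖gsum M u‖ * (2 * |Real.sin (u / 2)|) ≤ 2 := by
    rw [← norm_one_sub_expI, ← norm_mul, h1]
    refine (norm_sub_le _ _).trans ?_
    rw [norm_expI]; norm_num
  have h3 := abs_sin_half_ge u hu
  rw [div_le_iff₀ hpi] at h3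
  have := norm_nonneg (gsum M u)
  nlinarith [mul_le_mul_of_nonneg_right h3 this]

lemma gsum_wN (N : ℕ) (hN : 0 < N) (u : ℝ) (hu : |u| ≤ Real.pi) :
    ‖gsum (2 * N) u‖ * ‖gsum N u‖ ≤ N * wN N u := by
  have hN' : (0:ℝ) < N := by exact_mod_cast hN
  unfold wN
  split_ifs with h
  · calc _ ≤ ((2 * N : ℕ) : ℝ) * (N : ℝ) := by
          gcongr
          · exact gsum_le _ _
          · exact gsum_le _ _
      _ ≤ _ := by push_cast; nlinarith
  · push Not at h
    have hu0 : 0 < |u| := by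
      rcases (abs_nonneg u).eq_or_lt with h0 | h0
      · rw [← h0] at h; norm_num at h
      · exact h0
    have h1 := gsum_le' (2 * N) u hu
    have h2 := gsum_le' N u hu
    have h3 : (|u| * ‖gsum (2 * N) u‖) * (|u| * ‖gsum N u‖) ≤ Real.pi * Real.pi := by
      gcongr
    have hpi : Real.pi * Real.pi ≤ 10 := by nlinarith [Real.pi_lt_d2, Real.pi_pos]
    have : (N:ℝ) * (10 / (N * u ^ 2)) = 10 / |u| ^ 2 := by rw [sq_abs]; field_simp
    rw [this, le_div_iff₀ (by positivity)]
    nlinarith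

lemma sieve_sum (b : ℤ → ℝ) (hb : ∀ k, 0 ≤ b k) (a : ℤ) (N : ℕ) :
    N * ∑ k ∈ Finset.range N, b (a + k) ≤
      ∑ j ∈ Finset.range (2 * N), ∑ l ∈ Finset.range N, b (a + j - l) := by
  rw [Finset.sum_comm]
  have : (N:ℝ) * ∑ k ∈ Finset.range N, b (a + k) = 
    ∑ l ∈ Finset.range N, ∑ k ∈ Finset.range N, b (a + k) := by simp
  rw [this]
  apply Finset.sum_le_sum
  intro l hl
  rw [Finset.mem_range] at hl
  have h1 : ∑ k ∈ Finset.range N, b (a + k) = 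
    ∑ j ∈ (Finset.range N).map (addRightEmbedding l), b (a + j - l) := by
    rw [Finset.sum_map]
    apply Finset.sum_congr rfl
    intro k _
    congr 1
    simp
    ring
  rw [h1]
  apply Finset.sum_le_sum_of_subset_of_nonneg
  · intro j hj
    simp only [Finset.mem_map, Finset.mem_range, addRightEmbedding_apply] at hj ⊢
    obtain ⟨k, hk, rfl⟩ := hj
    omega
  · intro j _ _; exact hb _

def chr (k : ℤ) (t : ℝ) : ℂ := Complex.exp (Complex.I * (k * t : ℝ))

lemma chr_cont (k : ℤ) : Continuous (chr k) := by unfold chr; fun_prop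

lemma norm_chr (k : ℤ) (t : ℝ) : ‖chr k t‖ = 1 := norm_expI _

lemma chr_mul_conj (k : ℤ) (t s : ℝ) : chr k t * (starRingEnd ℂ) (chr k s) = chr k (t - s) := by
  unfold chr
  rw [← Complex.exp_conj, ← Complex.exp_add]
  congr 1
  simp only [map_mul, Complex.conj_I, Complex.conj_ofReal]
  push_cast; ring

lemma chr_add (k l : ℤ) (t : ℝ) : chr (k + l) t = chr k t * chr l t := by
  unfold chr; rw [← Complex.exp_add]; congr 1; push_cast; ring

lemma conj_chr (k : ℤ) (t : ℝ) : (starRingEnd ℂ) (chr k t) = chr (-k) t := by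
  unfold chr
  rw [← Complex.exp_conj]
  congr 1
  simp only [map_mul, Complex.conj_I, Complex.conj_ofReal]
  push_cast; ring

lemma chr_sum (a : ℤ) (N : ℕ) (u : ℝ) :
    ∑ j ∈ Finset.range (2 * N), ∑ l ∈ Finset.range N, chr (a + j - l) u =
      chr a u * (gsum (2 * N) u * (starRingEnd ℂ) (gsum N u)) := by
  unfold gsum
  rw [map_sum, Finset.sum_mul_sum, Finset.mul_sum]
  apply Finset.sum_congr rfl
  intro j _
  rw [Finset.mul_sum]
  apply Finset.sum_congr rfl
  intro l _
  rw [sub_eq_add_neg, chr_add, chr_add, ← conj_chr, mul_assoc]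
  unfold chr
  simp

lemma sieve (h : ℝ → ℂ) (hh : Integrable h) (hs : ∀ t s, h t ≠ 0 → h s ≠ 0 → |t - s| ≤ Real.pi)
    (a : ℤ) (N : ℕ) (hN : 0 < N) :
    ENNReal.ofReal (∑ k ∈ Finset.range N, ‖∫ t, h t * chr (a + k) t‖ ^ 2) ≤
      ∫⁻ t, ∫⁻ s, ‖h t‖ₑ * ‖h s‖ₑ * ENNReal.ofReal (wN N (t - s)) := by
  have hN' : (0:ℝ) < N := by exact_mod_cast hN
  have hi : ∀ k : ℤ, Integrable (fun t => h t * chr k t) := by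
    intro k
    apply hh.mul_bdd (c := 1) (chr_cont k).aestronglyMeasurable
    exact Eventually.of_forall (fun t => (norm_chr k t).le)
  have hiconj : ∀ k : ℤ, Integrable (fun t => (starRingEnd ℂ) (h t * chr k t)) := by
    intro k
    exact (RCLike.conjCLE (K := ℂ)).toContinuousLinearMap.integrable_comp (hi k)
  have hsq : ∀ k : ℤ, ((‖∫ t, h t * chr k t‖ ^ 2 : ℝ) : ℂ) =
      ∫ p : ℝ × ℝ, (h p.1 * (starRingEnd ℂ) (h p.2)) * chr k (p.1 - p.2) := by
    intro k
    push_cast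
    rw [← Complex.mul_conj', ← integral_conj, ← integral_prod_mul]
    congr 1; ext p
    rw [map_mul, ← chr_mul_conj]; ring
  have hpi : ∀ k : ℤ, Integrable (fun p : ℝ × ℝ => (h p.1 * (starRingEnd ℂ) (h p.2)) * chr k (p.1 - p.2)) := by
    intro k
    have := (hi k).mul_prod (hiconj k)
    refine this.congr (Eventually.of_forall ?_)
    intro p
    simp only
    rw [map_mul, ← chr_mul_conj]; ring
  have hmain : ((∑ j ∈ Finset.range (2 * N), ∑ l ∈ Finset.range N,
      ‖∫ t, h t * chr (a + j - l) t‖ ^ 2 : ℝ) : ℂ) =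
      ∫ p : ℝ × ℝ, (h p.1 * (starRingEnd ℂ) (h p.2)) * 
        (chr a (p.1 - p.2) * (gsum (2 * N) (p.1 - p.2) * (starRingEnd ℂ) (gsum N (p.1 - p.2)))) := by
    rw [Complex.ofReal_sum]
    simp_rw [Complex.ofReal_sum, hsq]
    simp_rw [← chr_sum, Finset.mul_sum]
    rw [integral_finsetSum _ (fun j _ => integrable_finset_sum _ (fun l _ => hpi _))]
    apply Finset.sum_congr rfl
    intro j _
    rw [integral_finsetSum _ (fun l _ => hpi _)]
  have h1 := sieve_sum (fun k => ‖∫ t, h t * chr k t‖ ^ 2) (fun k => by positivity) a N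
  set R := ∑ j ∈ Finset.range (2 * N), ∑ l ∈ Finset.range N, ‖∫ t, h t * chr (a + j - l) t‖ ^ 2 with hR
  have h2 : ENNReal.ofReal R ≤ ∫⁻ p : ℝ × ℝ, ‖h p.1‖ₑ * ‖h p.2‖ₑ * ENNReal.ofReal (N * wN N (p.1 - p.2)) := by
    calc ENNReal.ofReal R = ‖(R : ℂ)‖ₑ := by
          rw [← ofReal_norm, Complex.norm_real, Real.norm_of_nonneg (by positivity)]
      _ ≤ _ := by
          rw [hmain]
          refine (enorm_integral_le_lintegral_enorm _).trans ?_
          apply lintegral_mono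
          intro p
          beta_reduce
          rw [enorm_mul, enorm_mul, enorm_mul]
          by_cases h10 : h p.1 = 0
          · simp [h10]
          by_cases h20 : h p.2 = 0
          · simp [h20]
          rw [show ‖(starRingEnd ℂ) (h p.2)‖ₑ = ‖h p.2‖ₑ by
            rw [← ofReal_norm, RCLike.norm_conj, ofReal_norm]]
          refine mul_le_mul' le_rfl ?_
          rw [← enorm_mul, ← ofReal_norm]
          apply ENNReal.ofReal_le_ofReal
          rw [norm_mul, norm_mul, norm_chr, one_mul, RCLike.norm_conj]
          exact gsum_wN N hN _ (hs _ _ h10 h20)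
  have h3 : ∫⁻ p : ℝ × ℝ, ‖h p.1‖ₑ * ‖h p.2‖ₑ * ENNReal.ofReal (N * wN N (p.1 - p.2)) =
      ENNReal.ofReal N * ∫⁻ t, ∫⁻ s, ‖h t‖ₑ * ‖h s‖ₑ * ENNReal.ofReal (wN N (t - s)) := by
    have hm : AEMeasurable (fun p : ℝ × ℝ => ‖h p.1‖ₑ * ‖h p.2‖ₑ * ENNReal.ofReal (wN N (p.1 - p.2))) (volume.prod volume) := by
      refine ((hh.aestronglyMeasurable.comp_fst.enorm).mul (hh.aestronglyMeasurable.comp_snd.enorm)).mul ?_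
      exact (((wN_meas N).comp (by fun_prop : Measurable fun p : ℝ × ℝ => p.1 - p.2)).ennreal_ofReal).aemeasurable
    rw [← lintegral_prod _ hm, ← lintegral_const_mul'' _ hm]
    congr 1; ext p
    rw [ENNReal.ofReal_mul hN'.le]; ring
  rw [h3] at h2
  have h4 : ENNReal.ofReal N * ENNReal.ofReal (∑ k ∈ Finset.range N, ‖∫ t, h t * chr (a + k) t‖ ^ 2) ≤ ENNReal.ofReal R := by
    rw [← ENNReal.ofReal_mul hN'.le]
    exact ENNReal.ofReal_le_ofReal h1
  have h5 := h4.trans h2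
  rwa [ENNReal.mul_le_mul_iff_right (by simpa using hN.ne') ENNReal.ofReal_ne_top] at h5

def Dt (k : ℕ) (u : ℝ) : ℝ := ∑ j ∈ Finset.range k, 2 * Real.sin ((j + 1) * u)

lemma Dt_mul (k : ℕ) (u : ℝ) :
    Dt k u * Real.sin (u / 2) = Real.cos (u / 2) - Real.cos ((k + 1 / 2) * u) := by
  induction k with
  | zero => simp [Dt]; ring_nf
  | succ k ih =>
    have h1 : Dt (k + 1) u = Dt k u + 2 * Real.sin ((k + 1) * u) := by
      unfold Dt; rw [Finset.sum_range_succ]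
    rw [h1, add_mul, ih]
    have h2 : ((k + 1 : ℕ) + 1 / 2 : ℝ) * u = (k + 1) * u + u / 2 := by push_cast; ring
    have h3 : ((k : ℝ) + 1 / 2) * u = (k + 1) * u - u / 2 := by ring
    rw [h2, h3, Real.cos_add, Real.cos_sub]; ring

lemma Dt_diff (a k : ℕ) (u : ℝ) : |Dt (a + k) u - Dt a u| ≤ 2 * k := by
  unfold Dt
  rw [Finset.sum_range_add, add_sub_cancel_left]
  refine (Finset.abs_sum_le_sum_abs _ _).trans ?_
  calc _ ≤ ∑ j ∈ Finset.range k, (2:ℝ) := by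
        apply Finset.sum_le_sum
        intro j _
        rw [abs_mul, abs_two]
        have := Real.abs_sin_le_one ((((a + j : ℕ) : ℝ) + 1) * u)
        linarith
    _ = _ := by simp [mul_comm]

lemma Dt_cont (k : ℕ) : Continuous (Dt k) := by unfold Dt; fun_prop

lemma wN_even (N u : ℝ) : wN N (-u) = wN N u := by unfold wN; rw [abs_neg, neg_sq]

lemma sym_bd {G : ℝ → ENNReal} (hG : Measurable G) {lam : ENNReal}
    {x : ℝ} (hx : x ∉ badE G lam) (hI : marI G lam x ≤ lam) (N : ℝ) (hN : 0 < N)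
    (h : ℝ → ENNReal)
    (hh : ∀ y, h y ≤ {y | 1 / N < |x - y|}.indicator
      (fun y => G y * ENNReal.ofReal (Real.pi / |x - y|)) y) :
    ∫⁻ t, ∫⁻ s, h t * h s * ENNReal.ofReal (wN N (t - s)) ≤
      18000 * lam ^ 2 * ENNReal.ofReal N := by
  have hms : MeasurableSet {y | 1 / N < |x - y|} :=
    measurableSet_lt measurable_const (by fun_prop)
  set F := {y | 1 / N < |x - y|} with hF
  have hw := wN_meas N
  set A : ℝ → ENNReal := F.indicator (fun y => G y * ENNReal.ofReal (1 / (x - y) ^ 2)) with hA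
  have hAm : Measurable A := Measurable.indicator (by fun_prop) hms
  have hQ : ∫⁻ t, ∫⁻ s, A t * G s * ENNReal.ofReal (wN N (s - t)) ≤
      1800 * lam ^ 2 * ENNReal.ofReal N := by
    refine le_trans (le_of_eq ?_) (Q_bd hG hx hI N hN)
    rw [← lintegral_indicator hms]
    congr 1; ext t
    simp_rw [mul_assoc]
    rw [lintegral_const_mul _ (by fun_prop), hA]
    by_cases ht : t ∈ F
    · rw [indicator_of_mem ht, indicator_of_mem ht, mul_assoc]
    · rw [indicator_of_notMem ht, indicator_of_notMem ht, zero_mul]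
  have hpt : ∀ t s, h t * h s * ENNReal.ofReal (wN N (t - s)) ≤
      5 * (A t * G s * ENNReal.ofReal (wN N (s - t))) +
      5 * (A s * G t * ENNReal.ofReal (wN N (t - s))) := by
    intro t s
    have hev : wN N (s - t) = wN N (t - s) := by rw [← neg_sub, wN_even]
    rw [hev]
    by_cases ht : t ∈ F
    swap
    · have := hh t
      rw [indicator_of_notMem ht] at this
      rw [le_antisymm this zero_le]; simp
    by_cases hs : s ∈ F
    swap
    · have := hh s
      rw [indicator_of_notMem hs] at this
      rw [le_antisymm this zero_le]; simp
    have h1 := hh t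
    have h2 := hh s
    rw [indicator_of_mem ht] at h1
    rw [indicator_of_mem hs] at h2
    rw [hA, indicator_of_mem ht, indicator_of_mem hs]
    have ht0 : 0 < |x - t| := lt_trans (by positivity) (show 1 / N < |x - t| from ht)
    have hs0 : 0 < |x - s| := lt_trans (by positivity) (show 1 / N < |x - s| from hs)
    calc _ ≤ (G t * ENNReal.ofReal (Real.pi / |x - t|)) * (G s * ENNReal.ofReal (Real.pi / |x - s|)) * ENNReal.ofReal (wN N (t - s)) := by
          exact mul_le_mul' (mul_le_mul' h1 h2) le_rfl
      _ = (G t * G s * ENNReal.ofReal (wN N (t - s))) * ENNReal.ofReal ((Real.pi / |x - t|) * (Real.pi / |x - s|)) := by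
          rw [ENNReal.ofReal_mul (by positivity)]; ring
      _ ≤ (G t * G s * ENNReal.ofReal (wN N (t - s))) * ENNReal.ofReal (5 * (1 / (x - t) ^ 2) + 5 * (1 / (x - s) ^ 2)) := by
          refine mul_le_mul' le_rfl (ENNReal.ofReal_le_ofReal ?_)
          rw [← sq_abs (x - t), ← sq_abs (x - s)]
          set p := 1 / |x - t| with hp
          set q := 1 / |x - s| with hq
          have hp0 : 0 < p := by positivity
          have hq0 : 0 < q := by positivity
          have e1 : Real.pi / |x - t| = Real.pi * p := by rw [hp]; ring
          have e2 : Real.pi / |x - s| = Real.pi * q := by rw [hq]; ring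
          have e3 : 1 / |x - t| ^ 2 = p ^ 2 := by rw [hp]; ring
          have e4 : 1 / |x - s| ^ 2 = q ^ 2 := by rw [hq]; ring
          rw [e1, e2, e3, e4]
          have hpi : Real.pi * Real.pi ≤ 10 := by nlinarith [Real.pi_lt_d2, Real.pi_pos]
          have : Real.pi * Real.pi * (p * q) ≤ 10 * (p * q) := by gcongr
          nlinarith [sq_nonneg (p - q)]
      _ = _ := by
          rw [ENNReal.ofReal_add (by positivity) (by positivity), ENNReal.ofReal_mul (by norm_num),
            ENNReal.ofReal_mul (by norm_num)]
          rw [show (5:ℝ) = ((5:ℕ):ℝ) by norm_num, ENNReal.ofReal_natCast]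
          push_cast; ring
  calc _ ≤ ∫⁻ t, ∫⁻ s, (5 * (A t * G s * ENNReal.ofReal (wN N (s - t))) +
      5 * (A s * G t * ENNReal.ofReal (wN N (t - s)))) := by
        apply lintegral_mono; intro t
        apply lintegral_mono; intro s
        exact hpt t s
    _ = 5 * (∫⁻ t, ∫⁻ s, A t * G s * ENNReal.ofReal (wN N (s - t))) +
        5 * (∫⁻ t, ∫⁻ s, A s * G t * ENNReal.ofReal (wN N (t - s))) := by
        rw [← lintegral_const_mul, ← lintegral_const_mul, ← lintegral_add_left]
        · congr 1; ext t
          rw [lintegral_add_left (by fun_prop), lintegral_const_mul _ (by fun_prop), 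
            lintegral_const_mul _ (by fun_prop)]
        · apply Measurable.const_mul
          apply Measurable.lintegral_prod_right'
            (f := fun p : ℝ × ℝ => A p.1 * G p.2 * ENNReal.ofReal (wN N (p.2 - p.1)))
          fun_prop
        · apply Measurable.lintegral_prod_right'
            (f := fun p : ℝ × ℝ => A p.2 * G p.1 * ENNReal.ofReal (wN N (p.1 - p.2)))
          fun_prop
        · apply Measurable.lintegral_prod_right'
            (f := fun p : ℝ × ℝ => A p.1 * G p.2 * ENNReal.ofReal (wN N (p.2 - p.1)))
          fun_prop
    _ = 5 * (∫⁻ t, ∫⁻ s, A t * G s * ENNReal.ofReal (wN N (s - t))) +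
        5 * (∫⁻ t, ∫⁻ s, A t * G s * ENNReal.ofReal (wN N (s - t))) := by
        congr 2
        rw [lintegral_lintegral_swap]
        apply Measurable.aemeasurable
        fun_prop
    _ ≤ 5 * (1800 * lam ^ 2 * ENNReal.ofReal N) + 5 * (1800 * lam ^ 2 * ENNReal.ofReal N) := by
        gcongr
    _ = _ := by ring

/-- far part -/
lemma far_bd {G : ℝ → ENNReal} (hG : Measurable G) {lam : ℝ} (hl : 0 < lam)
    {x : ℝ} (hx : x ∉ badE G (ENNReal.ofReal lam))
    (hI : marI G (ENNReal.ofReal lam) x ≤ ENNReal.ofReal lam) (N : ℕ) (hN : 0 < N)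
    (h : ℝ → ℂ) (hi : Integrable h)
    (hs : ∀ t s, h t ≠ 0 → h s ≠ 0 → |t - s| ≤ Real.pi)
    (hh : ∀ y, ‖h y‖ₑ ≤ {y | 1 / (N:ℝ) < |x - y|}.indicator
      (fun y => G y * ENNReal.ofReal (Real.pi / |x - y|)) y) (a : ℤ) :
    ∑ k ∈ Finset.range N, ‖∫ t, h t * chr (a + k) t‖ ^ 2 ≤ 18000 * lam ^ 2 * N := by
  have hN' : (0:ℝ) < N := by exact_mod_cast hN
  have h1 := (sieve h hi hs a N hN).trans (sym_bd hG hx hI N hN' (fun y => ‖h y‖ₑ) hh)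
  have h2 : 18000 * ENNReal.ofReal lam ^ 2 * ENNReal.ofReal N = 
      ENNReal.ofReal (18000 * lam ^ 2 * N) := by
    rw [ENNReal.ofReal_mul (by positivity), ENNReal.ofReal_mul (by norm_num), 
      ENNReal.ofReal_pow hl.le]
    congr 2
    rw [show (18000:ℝ) = ((18000:ℕ):ℝ) by norm_num, ENNReal.ofReal_natCast]; norm_num
  rw [h2] at h1
  exact (ENNReal.ofReal_le_ofReal_iff (by positivity)).1 h1

lemma side_bd {G : ℝ → ENNReal} (hG : Measurable G) {lam : ℝ} (hl : 0 < lam)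
    {x : ℝ} (hx : x ∉ badE G (ENNReal.ofReal lam))
    (hI : marI G (ENNReal.ofReal lam) x ≤ ENNReal.ofReal lam) (N : ℕ) (hN : 0 < N)
    (g : ℝ → ℂ) (hg : Continuous g) (hgG : ∀ y, |x - y| ≤ Real.pi → ‖g y‖ₑ ≤ G y)
    (S : Set ℝ) (hSm : MeasurableSet S) (hS : ∀ y ∈ S, 1 / (N:ℝ) < |x - y| ∧ |x - y| ≤ Real.pi)
    (hS2 : ∀ t ∈ S, ∀ s ∈ S, |t - s| ≤ Real.pi) (a : ℕ) :
    (∀ k : ℕ, IntegrableOn (fun y => g y * ((Real.cos ((k + 1 / 2) * (x - y)) / Real.sin ((x - y) / 2) : ℝ) : ℂ)) S) ∧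
    ∑ k ∈ Finset.range N,
      ‖∫ y in S, g y * ((Real.cos (((a + k : ℕ) + 1 / 2) * (x - y)) / Real.sin ((x - y) / 2) : ℝ) : ℂ)‖ ^ 2
      ≤ 72000 * lam ^ 2 * N := by
  have hN' : (0:ℝ) < N := by exact_mod_cast hN
  have hpi := Real.pi_pos
  have hSI : S ⊆ Icc (x - Real.pi) (x + Real.pi) := by
    intro y hy
    have := (abs_le.1 (hS y hy).2)
    constructor <;> linarith
  obtain ⟨M, hM⟩ := (isCompact_Icc (a := x - Real.pi) (b := x + Real.pi)).exists_bound_of_continuousOn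
    hg.continuousOn
  have hvol : volume S ≠ ⊤ := ((measure_mono hSI).trans_lt (by simp)).ne
  have hsin : ∀ y ∈ S, 1 / |Real.sin ((x - y) / 2)| ≤ Real.pi / |x - y| := by
    intro y hy
    have h1 := abs_sin_half_ge (x - y) (hS y hy).2
    have h0 : 0 < |x - y| := lt_trans (by positivity) (hS y hy).1
    rw [← one_div_div |x - y| Real.pi]
    exact one_div_le_one_div_of_le (by positivity) h1
  have hsin2 : ∀ y ∈ S, 1 / |Real.sin ((x - y) / 2)| ≤ Real.pi * N := by
    intro y hy
    refine (hsin y hy).trans ?_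
    have h0 : 0 < |x - y| := lt_trans (by positivity) (hS y hy).1
    rw [div_le_iff₀ h0]
    have := (hS y hy).1
    rw [div_lt_iff₀ hN'] at this
    nlinarith
  have hIn : ∀ w : ℝ → ℂ, Continuous w → (∀ y, ‖w y‖ ≤ 1) → 
      IntegrableOn (fun y => g y * (w y / ((2 * Real.sin ((x - y) / 2) : ℝ) : ℂ))) S := by
    intro w hw hw1
    apply Measure.integrableOn_of_bounded (M := M * (Real.pi * N)) hvol
    · apply Measurable.aestronglyMeasurable
      have := hg.measurable
      have := hw.measurable
      fun_prop
    · rw [ae_restrict_iff' hSm]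
      refine Eventually.of_forall (fun y hy => ?_)
      rw [norm_mul]
      have h1 := hM y (hSI hy)
      have h2 : ‖w y / ((2 * Real.sin ((x - y) / 2) : ℝ) : ℂ)‖ ≤ Real.pi * N := by
        rw [norm_div, Complex.norm_real, Real.norm_eq_abs, abs_mul, abs_two]
        have h3 := hsin2 y hy
        calc _ ≤ 1 / (2 * |Real.sin ((x - y) / 2)|) := by gcongr; exact hw1 y
          _ = (1 / 2) * (1 / |Real.sin ((x - y) / 2)|) := by rw [one_div_mul_one_div]
          _ ≤ _ := by nlinarith [norm_nonneg (w y), show 0 ≤ 1 / |Real.sin ((x - y) / 2)| by positivity]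
      gcongr
      exact (norm_nonneg _).trans h1
  set w1 : ℝ → ℂ := fun y => Complex.exp (Complex.I * ((x - y) / 2 : ℝ)) with hw1
  set w2 : ℝ → ℂ := fun y => Complex.exp (Complex.I * (-((x - y) / 2) : ℝ)) with hw2
  have hcos : ∀ (k : ℕ) (y : ℝ), g y * ((Real.cos ((k + 1 / 2) * (x - y)) / Real.sin ((x - y) / 2) : ℝ) : ℂ) =
      chr k x * ((g y * (w1 y / ((2 * Real.sin ((x - y) / 2) : ℝ) : ℂ))) * chr (-k) y) + 
      chr (-k) x * ((g y * (w2 y / ((2 * Real.sin ((x - y) / 2) : ℝ) : ℂ))) * chr k y) := by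
    intro k y
    have h1 : Complex.cos ((k + 1 / 2) * (x - y)) = (chr k x * w1 y * chr (-k) y + chr (-k) x * w2 y * chr k y) / 2 := by
      rw [Complex.cos, hw1, hw2]
      unfold chr
      simp only
      rw [← Complex.exp_add, ← Complex.exp_add, ← Complex.exp_add, ← Complex.exp_add]
      congr 3 <;> (push_cast; ring_nf)
    push_cast
    rw [h1]
    ring
  have hi1 := hIn w1 (by fun_prop) (fun y => (norm_expI _).le)
  have hi2 := hIn w2 (by fun_prop) (fun y => (norm_expI _).le)
  have hmulc : ∀ (h : ℝ → ℂ) (k : ℤ), IntegrableOn h S → IntegrableOn (fun y => h y * chr k y) S := by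
    intro h k hh
    apply Integrable.mul_bdd (c := 1) hh (chr_cont k).aestronglyMeasurable
    exact Eventually.of_forall (fun t => (norm_chr k t).le)
  constructor
  · intro k
    simp_rw [hcos k]
    exact ((hmulc _ _ hi1).const_mul _).add ((hmulc _ _ hi2).const_mul _)
  -- bounds for h's
  have hkey : ∀ w : ℝ → ℂ, Continuous w → (∀ y, ‖w y‖ ≤ 1) → 
    ∀ y, ‖S.indicator (fun y => g y * (w y / ((2 * Real.sin ((x - y) / 2) : ℝ) : ℂ))) y‖ₑ ≤
      {y | 1 / (N:ℝ) < |x - y|}.indicator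
      (fun y => G y * ENNReal.ofReal (Real.pi / |x - y|)) y := by
    intro w hw hwb y
    by_cases hy : y ∈ S
    · rw [indicator_of_mem hy, indicator_of_mem (show y ∈ {y | 1 / (N:ℝ) < |x - y|} from (hS y hy).1)]
      rw [enorm_mul]
      refine mul_le_mul' (hgG y (hS y hy).2) ?_
      rw [← ofReal_norm]
      apply ENNReal.ofReal_le_ofReal
      refine le_trans ?_ (hsin y hy)
      rw [norm_div, Complex.norm_real, Real.norm_eq_abs, abs_mul, abs_two]
      calc _ ≤ 1 / (2 * |Real.sin ((x - y) / 2)|) := by gcongr; exact hwb y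
          _ = (1 / 2) * (1 / |Real.sin ((x - y) / 2)|) := by rw [one_div_mul_one_div]
          _ ≤ _ := by nlinarith [show 0 ≤ 1 / |Real.sin ((x - y) / 2)| by positivity]
    · rw [indicator_of_notMem hy]; simp
  have hsupp : ∀ f : ℝ → ℂ, ∀ t s, S.indicator f t ≠ 0 → S.indicator f s ≠ 0 → |t - s| ≤ Real.pi := by
    intro f t s ht hs
    exact hS2 t (by by_contra h; exact ht (indicator_of_notMem h _)) s
      (by by_contra h; exact hs (indicator_of_notMem h _))
  have hb1 := far_bd hG hl hx hI N hN
    (fun y => (starRingEnd ℂ) (S.indicator (fun y => g y * (w1 y / ((2 * Real.sin ((x - y) / 2) : ℝ) : ℂ))) y))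
    ((RCLike.conjCLE (K := ℂ)).toContinuousLinearMap.integrable_comp ((integrable_indicator_iff hSm).2 hi1))
    (by
      intro t s ht hs
      exact hsupp (fun y => g y * (w1 y / ((2 * Real.sin ((x - y) / 2) : ℝ) : ℂ))) t s (fun h => ht (by simp only [h, map_zero])) (fun h => hs (by simp only [h, map_zero])))
    (by
      intro y
      rw [← ofReal_norm, RCLike.norm_conj, ofReal_norm]
      exact hkey w1 (by fun_prop) (fun y => (norm_expI _).le) y) a
  have hb2 := far_bd hG hl hx hI N hN
    (S.indicator (fun y => g y * (w2 y / ((2 * Real.sin ((x - y) / 2) : ℝ) : ℂ))))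
    ((integrable_indicator_iff hSm).2 hi2) (hsupp _)
    (hkey w2 (by fun_prop) (fun y => (norm_expI _).le)) a
  calc _ ≤ ∑ k ∈ Finset.range N, (2 * ‖∫ t, (starRingEnd ℂ) (S.indicator (fun y => g y * (w1 y / ((2 * Real.sin ((x - y) / 2) : ℝ) : ℂ))) t) * chr (a + k) t‖ ^ 2 +
        2 * ‖∫ t, (S.indicator (fun y => g y * (w2 y / ((2 * Real.sin ((x - y) / 2) : ℝ) : ℂ)))) t * chr (a + k) t‖ ^ 2) := by
        apply Finset.sum_le_sum
        intro k _
        simp_rw [hcos]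
        rw [integral_add ((hmulc _ _ hi1).const_mul _) ((hmulc _ _ hi2).const_mul _),
          integral_const_mul, integral_const_mul]
        have e1 : ‖∫ t, (starRingEnd ℂ) (S.indicator (fun y => g y * (w1 y / ((2 * Real.sin ((x - y) / 2) : ℝ) : ℂ))) t) * chr (a + k) t‖ = 
          ‖∫ y in S, g y * (w1 y / ((2 * Real.sin ((x - y) / 2) : ℝ) : ℂ)) * chr (-(a + k : ℕ)) y‖ := by
          rw [← RCLike.norm_conj, ← integral_conj, ← integral_indicator hSm]
          congr 2; ext y
          rw [map_mul, Complex.conj_conj, conj_chr]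
          by_cases hy : y ∈ S
          · rw [indicator_of_mem hy, indicator_of_mem hy]; push_cast; rfl
          · rw [indicator_of_notMem hy, indicator_of_notMem hy]; simp
        have e2 : ∫ t, (S.indicator (fun y => g y * (w2 y / ((2 * Real.sin ((x - y) / 2) : ℝ) : ℂ)))) t * chr (a + k) t = 
          ∫ y in S, g y * (w2 y / ((2 * Real.sin ((x - y) / 2) : ℝ) : ℂ)) * chr ((a + k : ℕ)) y := by
          rw [← integral_indicator hSm]
          congr 1; ext y
          by_cases hy : y ∈ S
          · rw [indicator_of_mem hy, indicator_of_mem hy]; push_cast; rfl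
          · rw [indicator_of_notMem hy, indicator_of_notMem hy]; simp
        rw [e1, e2]
        set P := ∫ y in S, g y * (w1 y / ((2 * Real.sin ((x - y) / 2) : ℝ) : ℂ)) * chr (-(a + k : ℕ)) y
        set Q := ∫ y in S, g y * (w2 y / ((2 * Real.sin ((x - y) / 2) : ℝ) : ℂ)) * chr ((a + k : ℕ)) y
        have := norm_add_le (chr ((a + k : ℕ)) x * P) (chr (-(a + k : ℕ)) x * Q)
        rw [norm_mul, norm_mul, norm_chr, norm_chr, one_mul, one_mul] at this
        have h3 := norm_nonneg (chr ((a + k : ℕ)) x * P + chr (-(a + k : ℕ)) x * Q)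
        nlinarith [sq_nonneg (‖P‖ - ‖Q‖)]
    _ ≤ _ := by
        rw [Finset.sum_add_distrib, ← Finset.mul_sum, ← Finset.mul_sum]
        push_cast at hb1 hb2 ⊢
        linarith

lemma local1D {G : ℝ → ENNReal} (hG : Measurable G) {lam : ℝ} (hl : 0 < lam)
    {x : ℝ} (hx : x ∉ badE G (ENNReal.ofReal lam))
    (hI : marI G (ENNReal.ofReal lam) x ≤ ENNReal.ofReal lam) (N : ℕ) (hN : 0 < N)
    (g : ℝ → ℂ) (hg : Continuous g) (hgG : ∀ y, |x - y| ≤ Real.pi → ‖g y‖ₑ ≤ G y) (a : ℕ) :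
    ∃ c : ℂ, ∑ k ∈ Finset.range N,
      ‖(∫ y in Ioc (x - Real.pi) (x + Real.pi), g y * (Dt (a + k) (x - y) : ℂ)) - c‖ ^ 2 
      ≤ 1000000 * lam ^ 2 * N := by
  have hN' : (0:ℝ) < N := by exact_mod_cast hN
  have hN1 : (1:ℝ) ≤ N := by exact_mod_cast hN
  have hpi := Real.pi_gt_three
  have hpN : 1 / (N:ℝ) ≤ 1 := by rw [div_le_one hN']; exact hN1
  have hpN0 : 0 < 1 / (N:ℝ) := by positivity
  set S1 := Ioo (x - Real.pi) (x - 1 / N) with hS1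
  set S2 := Ioc (x + 1 / N) (x + Real.pi) with hS2
  set L := Icc (x - 1 / N) (x + 1 / N) with hL
  have b1 := side_bd hG hl hx hI N hN g hg hgG S1 measurableSet_Ioo (by
    intro y hy
    have h1 := hy.1
    have h2 := hy.2
    rw [abs_of_pos (by linarith)]
    constructor <;> linarith) (by
    intro t ht s hs
    have h1 := ht.1
    have h2 := ht.2
    have h3 := hs.1
    have h4 := hs.2
    rw [abs_le]; constructor <;> linarith) a
  have b2 := side_bd hG hl hx hI N hN g hg hgG S2 measurableSet_Ioc (by
    intro y hy
    have h1 := hy.1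
    have h2 := hy.2
    rw [abs_of_neg (by linarith)]
    constructor <;> linarith) (by
    intro t ht s hs
    have h1 := ht.1
    have h2 := ht.2
    have h3 := hs.1
    have h4 := hs.2
    rw [abs_le]; constructor <;> linarith) a
  have hgD : ∀ k, Continuous (fun y => g y * (Dt k (x - y) : ℂ)) := by
    intro k
    have := Dt_cont k
    fun_prop
  have hLi : ∀ k, IntegrableOn (fun y => g y * (Dt k (x - y) : ℂ)) L := by
    intro k; exact (hgD k).continuousOn.integrableOn_Icc
  have hS1i : ∀ k, IntegrableOn (fun y => g y * (Dt k (x - y) : ℂ)) S1 := by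
    intro k; exact ((hgD k).continuousOn.integrableOn_Icc (a := x - Real.pi) (b := x - 1 / N)).mono_set Ioo_subset_Icc_self
  have hS2i : ∀ k, IntegrableOn (fun y => g y * (Dt k (x - y) : ℂ)) S2 := by
    intro k; exact ((hgD k).continuousOn.integrableOn_Icc (a := x + 1 / N) (b := x + Real.pi)).mono_set Ioc_subset_Icc_self
  have hsplit : ∀ k, ∫ y in Ioc (x - Real.pi) (x + Real.pi), g y * (Dt k (x - y) : ℂ) =
      (∫ y in L, g y * (Dt k (x - y) : ℂ)) + (∫ y in S1, g y * (Dt k (x - y) : ℂ)) + 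
      (∫ y in S2, g y * (Dt k (x - y) : ℂ)) := by
    intro k
    have hu : Ioc (x - Real.pi) (x + Real.pi) = (L ∪ S1) ∪ S2 := by
      ext y
      simp only [hL, hS1, hS2, mem_union, mem_Ioc, mem_Icc, mem_Ioo]
      constructor
      · rintro ⟨h1, h2⟩
        by_cases h3 : y < x - 1 / N
        · exact Or.inl (Or.inr ⟨h1, h3⟩)
        · by_cases h4 : y ≤ x + 1 / N
          · exact Or.inl (Or.inl ⟨not_lt.1 h3, h4⟩)
          · exact Or.inr ⟨not_le.1 h4, h2⟩
      · rintro ((⟨h1, h2⟩ | ⟨h1, h2⟩) | ⟨h1, h2⟩) <;> constructor <;> linarith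
    have hd1 : Disjoint L S1 := by
      rw [Set.disjoint_left]
      intro y h1 h2
      have := h1.1
      have := h2.2
      linarith
    have hd2 : Disjoint (L ∪ S1) S2 := by
      rw [Set.disjoint_left]
      rintro y (h1 | h1) h2
      · have := h1.2
        have := h2.1
        linarith
      · have := h1.2
        have := h2.1
        linarith
    rw [hu, setIntegral_union hd2 measurableSet_Ioc ((hLi k).union (hS1i k)) (hS2i k),
      setIntegral_union hd1 measurableSet_Ioo (hLi k) (hS1i k)]
  -- cot parts
  have hcot : ∀ (S : Set ℝ), MeasurableSet S → (∀ y ∈ S, Real.sin ((x - y) / 2) ≠ 0) → 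
      (∀ k, IntegrableOn (fun y => g y * (Dt k (x - y) : ℂ)) S) →
      (∀ k : ℕ, IntegrableOn (fun y => g y * ((Real.cos ((k + 1 / 2) * (x - y)) / Real.sin ((x - y) / 2) : ℝ) : ℂ)) S) →
      ∃ c : ℂ, ∀ k : ℕ, ∫ y in S, g y * (Dt k (x - y) : ℂ) = c - ∫ y in S, g y * ((Real.cos ((k + 1 / 2) * (x - y)) / Real.sin ((x - y) / 2) : ℝ) : ℂ) := by
    intro S hSm hS0 hi1 hi2
    refine ⟨∫ y in S, g y * ((Real.cos ((x - y) / 2) / Real.sin ((x - y) / 2) : ℝ) : ℂ), ?_⟩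
    intro k
    rw [eq_sub_iff_add_eq, ← integral_add (hi1 k) (hi2 k)]
    apply setIntegral_congr_fun hSm
    intro y hy
    simp only
    rw [← mul_add, ← Complex.ofReal_add]
    congr 2
    have h1 := Dt_mul k (x - y)
    have h0 := hS0 y hy
    rw [eq_div_iff h0, add_mul, h1, div_mul_cancel₀ _ h0]
    ring
  have hsne : ∀ y, 1 / (N:ℝ) < |x - y| → |x - y| ≤ Real.pi → Real.sin ((x - y) / 2) ≠ 0 := by
    intro y h1 h2
    have h3 := abs_sin_half_ge (x - y) h2
    have h0 : 0 < |x - y| := hpN0.trans h1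
    have : 0 < |Real.sin ((x - y) / 2)| := lt_of_lt_of_le (by positivity) h3
    exact abs_pos.1 this
  obtain ⟨c1, hc1⟩ := hcot S1 measurableSet_Ioo (by
    intro y hy
    have h1 := hy.1
    have h2 := hy.2
    apply hsne <;> rw [abs_of_pos (by linarith)] <;> linarith) hS1i b1.1
  obtain ⟨c2, hc2⟩ := hcot S2 measurableSet_Ioc (by
    intro y hy
    have h1 := hy.1
    have h2 := hy.2
    apply hsne <;> rw [abs_of_neg (by linarith)] <;> linarith) hS2i b2.1
  refine ⟨(∫ y in L, g y * (Dt a (x - y) : ℂ)) + c1 + c2, ?_⟩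
  have hloc : ∀ k ∈ Finset.range N, ‖(∫ y in L, g y * (Dt (a + k) (x - y) : ℂ)) - (∫ y in L, g y * (Dt a (x - y) : ℂ))‖ ≤ 4 * lam := by
    intro k hk
    rw [Finset.mem_range] at hk
    have hk' : (k:ℝ) ≤ N := by exact_mod_cast hk.le
    rw [← integral_sub (hLi _) (hLi _)]
    have h1 : ‖∫ y in L, (g y * (Dt (a + k) (x - y) : ℂ) - g y * (Dt a (x - y) : ℂ))‖ₑ ≤ ENNReal.ofReal (4 * lam) := by
      refine (enorm_integral_le_lintegral_enorm _).trans ?_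
      calc _ ≤ ∫⁻ y in L, ENNReal.ofReal (2 * N) * G y := by
            apply setLIntegral_mono' measurableSet_Icc
            intro y hy
            have h2 : |x - y| ≤ Real.pi := by
              rw [abs_le]; constructor <;> linarith [hy.1, hy.2]
            rw [← mul_sub, enorm_mul, mul_comm]
            refine mul_le_mul' ?_ (hgG y h2)
            rw [← Complex.ofReal_sub, ← ofReal_norm, Complex.norm_real, Real.norm_eq_abs]
            apply ENNReal.ofReal_le_ofReal
            refine (Dt_diff a k _).trans ?_
            linarith
        _ ≤ ENNReal.ofReal (2 * N) * (ENNReal.ofReal lam * ENNReal.ofReal (2 * (1 / N))) := by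
            rw [lintegral_const_mul _ hG]
            gcongr
            rw [hL, ← Real.closedBall_eq_Icc]
            exact not_badE hx _ hpN0
        _ = _ := by
            rw [← ENNReal.ofReal_mul hl.le, ← ENNReal.ofReal_mul (by positivity)]
            congr 1; field_simp; norm_num
    rw [← ofReal_norm] at h1
    exact (ENNReal.ofReal_le_ofReal_iff (by positivity)).1 h1
  calc _ ≤ ∑ k ∈ Finset.range N, (3 * (4 * lam) ^ 2 + 3 * ‖∫ y in S1, g y * ((Real.cos (((a + k : ℕ) + 1 / 2) * (x - y)) / Real.sin ((x - y) / 2) : ℝ) : ℂ)‖ ^ 2 + 3 * ‖∫ y in S2, g y * ((Real.cos (((a + k : ℕ) + 1 / 2) * (x - y)) / Real.sin ((x - y) / 2) : ℝ) : ℂ)‖ ^ 2) := by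
        apply Finset.sum_le_sum
        intro k hk
        have h1 := hloc k hk
        rw [hsplit, hc1, hc2]
        set P := ∫ y in S1, g y * ((Real.cos (((a + k : ℕ) + 1 / 2) * (x - y)) / Real.sin ((x - y) / 2) : ℝ) : ℂ)
        set Q := ∫ y in S2, g y * ((Real.cos (((a + k : ℕ) + 1 / 2) * (x - y)) / Real.sin ((x - y) / 2) : ℝ) : ℂ)
        set A := ∫ y in L, g y * (Dt (a + k) (x - y) : ℂ)
        set B := ∫ y in L, g y * (Dt a (x - y) : ℂ)
        have e : A + (c1 - P) + (c2 - Q) - (B + c1 + c2) = (A - B) - P - Q := by ring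
        rw [e]
        have h2 : ‖(A - B) - P - Q‖ ≤ 4 * lam + ‖P‖ + ‖Q‖ := by
          refine (norm_sub_le _ _).trans ?_
          gcongr
          refine (norm_sub_le _ _).trans ?_
          gcongr
        have h3 : ‖(A - B) - P - Q‖ ^ 2 ≤ (4 * lam + ‖P‖ + ‖Q‖) ^ 2 := by gcongr
        nlinarith [sq_nonneg (‖P‖ - ‖Q‖), sq_nonneg (4 * lam - ‖P‖), sq_nonneg (4 * lam - ‖Q‖)]
    _ ≤ _ := by
        rw [Finset.sum_add_distrib, Finset.sum_add_distrib, ← Finset.mul_sum, ← Finset.mul_sum, ← Finset.mul_sum,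
          Finset.sum_const, Finset.card_range, nsmul_eq_mul]
        have h1 := b1.2
        have h2 := b2.2
        have h3 := mul_pos (pow_pos hl 2) hN'
        have h4 : 3 * ((N:ℝ) * (4 * lam) ^ 2) = 48 * (lam ^ 2 * N) := by ring
        rw [h4]
        refine (add_le_add (add_le_add le_rfl (mul_le_mul_of_nonneg_left h1 (by norm_num)))
          (mul_le_mul_of_nonneg_left h2 (by norm_num))).trans ?_
        linarith

def Dk (k : ℕ) (t : ℝ) : ℝ := 1 + ∑ j ∈ Finset.range k, 2 * Real.cos ((j + 1) * t)

lemma Dk_succ (k : ℕ) (t : ℝ) : Dk (k + 1) t = Dk k t + 2 * Real.cos ((k + 1) * t) := by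
  unfold Dk; rw [Finset.sum_range_succ]; ring

lemma Dk_cont (k : ℕ) : Continuous (Dk k) := by unfold Dk; fun_prop

lemma Dk_mul (k : ℕ) (t : ℝ) : Dk k t * Real.sin (t / 2) = Real.sin ((k + 1 / 2) * t) := by
  induction k with
  | zero => simp [Dk]; ring_nf
  | succ k ih =>
    rw [Dk_succ, add_mul, ih]
    have h2 : ((k + 1 : ℕ) + 1 / 2 : ℝ) * t = (k + 1) * t + t / 2 := by push_cast; ring
    have h3 : ((k : ℝ) + 1 / 2) * t = (k + 1) * t - t / 2 := by ring
    rw [h2, h3, Real.sin_add, Real.sin_sub]; ring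

lemma Dk_le (k : ℕ) (t : ℝ) : |Dk k t| ≤ 2 * k + 1 := by
  induction k with
  | zero => simp [Dk]
  | succ k ih =>
    rw [Dk_succ]
    have h1 := abs_add_le (Dk k t) (2 * Real.cos ((k + 1) * t))
    have h2 : |2 * Real.cos ((k + 1) * t)| ≤ 2 := by
      rw [abs_mul, abs_two]; linarith [Real.abs_cos_le_one ((k + 1) * t)]
    push_cast; linarith

lemma Phi_mul (k : ℕ) (s : ℝ) :
    (∑ j ∈ Finset.range k, Dk j s) * Real.sin (s / 2) ^ 2 = Real.sin (k * s / 2) ^ 2 := by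
  induction k with
  | zero => simp
  | succ k ih =>
    rw [Finset.sum_range_succ, add_mul, ih, sq (Real.sin (s / 2)), ← mul_assoc, Dk_mul]
    have h2 : ((k + 1 : ℕ) : ℝ) * s / 2 = k * s / 2 + s / 2 := by push_cast; ring
    have h3 : ((k : ℝ) + 1 / 2) * s = k * s / 2 + (k * s / 2 + s / 2) := by ring
    rw [h2, h3, Real.sin_add (k * s / 2) (k * s / 2 + s / 2), Real.sin_add, Real.cos_add]
    have := Real.sin_sq_add_cos_sq (k * s / 2)
    have := Real.sin_sq_add_cos_sq (s / 2)
    set a := Real.sin (k * s / 2)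
    set b := Real.cos (k * s / 2)
    set c := Real.sin (s / 2)
    set d := Real.cos (s / 2)
    have hb : b ^ 2 = 1 - a ^ 2 := by linarith
    have hd : d ^ 2 = 1 - c ^ 2 := by linarith
    ring_nf
    rw [hb, hd]; ring

lemma abs_sin_half_ge10 (u : ℝ) (hu : |u| ≤ 3 * Real.pi / 2) : |u| / 10 ≤ |Real.sin (u / 2)| := by
  have hpi := Real.pi_pos
  have h4 := Real.pi_le_four
  have h3 := Real.pi_gt_three
  have h32 := Real.pi_lt_d2
  by_cases h : |u| ≤ Real.pi
  · refine le_trans ?_ (abs_sin_half_ge u h)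
    exact div_le_div_of_nonneg_left (abs_nonneg u) hpi (by linarith)
  · push Not at h
    have e : |Real.sin (u / 2)| = |Real.sin ((2 * Real.pi - |u|) / 2)| := by
      have : (2 * Real.pi - |u|) / 2 = Real.pi - |u| / 2 := by ring
      rw [this, Real.sin_pi_sub]
      rcases abs_cases u with ⟨h1, _⟩ | ⟨h1, _⟩
      · rw [h1]
      · rw [h1, neg_div, Real.sin_neg, abs_neg]
    rw [e]
    have h5 := abs_sin_half_ge (2 * Real.pi - |u|) (by
      rw [abs_of_nonneg (by linarith)]; linarith)
    rw [abs_of_nonneg (by linarith)] at h5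
    refine le_trans ?_ h5
    rw [le_div_iff₀ hpi]
    nlinarith

def cN (N : ℕ) (v : ℝ) : ℝ := ∑ k ∈ Finset.range N, Real.cos ((k + 1 / 2) * v)

lemma cN_mul (N : ℕ) (v : ℝ) : cN N v * (2 * Real.sin (v / 2)) = Real.sin (N * v) := by
  induction N with
  | zero => simp [cN]
  | succ k ih =>
    have : cN (k + 1) v = cN k v + Real.cos ((k + 1 / 2) * v) := by
      unfold cN; rw [Finset.sum_range_succ]
    rw [this, add_mul, ih]
    have h2 : ((k + 1 : ℕ) : ℝ) * v = (k + 1 / 2) * v + v / 2 := by push_cast; ring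
    have h3 : (k : ℝ) * v = (k + 1 / 2) * v - v / 2 := by ring
    rw [h2, h3, Real.sin_add, Real.sin_sub]; ring

lemma cN_le (N : ℕ) (v : ℝ) (hv : |v| ≤ 3 * Real.pi / 2) : |cN N v| * max 1 (N * |v|) ≤ 5 * N := by
  rcases le_total 1 (N * |v|) with h | h
  · rw [max_eq_right h]
    have h1 := cN_mul N v
    have h2 : |cN N v| * (2 * |Real.sin (v / 2)|) ≤ 1 := by
      have : |cN N v| * (2 * |Real.sin (v / 2)|) = |cN N v * (2 * Real.sin (v / 2))| := by
        rw [abs_mul, abs_mul, abs_two]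
      rw [this, h1]; exact Real.abs_sin_le_one _
    have h3 := abs_sin_half_ge10 v hv
    have h4 : |cN N v| * |v| ≤ 5 := by nlinarith [abs_nonneg (cN N v)]
    calc |cN N v| * (N * |v|) = (|cN N v| * |v|) * N := by ring
      _ ≤ _ := by gcongr
  · rw [max_eq_left h, mul_one]
    have : |cN N v| ≤ N := by
      unfold cN
      refine (Finset.abs_sum_le_sum_abs _ _).trans ?_
      refine (Finset.sum_le_sum (fun k _ => Real.abs_cos_le_one _)).trans ?_
      simp
    have : (0:ℝ) ≤ N := by positivity
    linarith

def KN (N : ℕ) (t s : ℝ) : ℝ := ∑ k ∈ Finset.range N, Dk k t * Dk k s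

lemma KN_comm (N : ℕ) (t s : ℝ) : KN N t s = KN N s t := by
  unfold KN; exact Finset.sum_congr rfl (fun k _ => mul_comm _ _)

lemma KN_triv (N : ℕ) (t s : ℝ) : |KN N t s| ≤ N * (4 * N ^ 2) := by
  unfold KN
  refine (Finset.abs_sum_le_sum_abs _ _).trans ?_
  calc _ ≤ ∑ k ∈ Finset.range N, ((4:ℝ) * N ^ 2) := by
        apply Finset.sum_le_sum
        intro k hk
        rw [Finset.mem_range] at hk
        have hk' : (k:ℝ) + 1 ≤ N := by exact_mod_cast hk
        rw [abs_mul]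
        calc _ ≤ (2 * (N:ℝ)) * (2 * N) := by
              gcongr
              · exact (Dk_le k t).trans (by linarith)
              · exact (Dk_le k s).trans (by linarith)
          _ = _ := by ring
    _ = _ := by simp

lemma KN_abel (N : ℕ) (t s : ℝ) : KN (N + 1) t s = Dk N t * (∑ j ∈ Finset.range (N + 1), Dk j s) -
    ∑ k ∈ Finset.range N, (2 * Real.cos ((k + 1) * t)) * (∑ j ∈ Finset.range (k + 1), Dk j s) := by
  induction N with
  | zero => simp [KN]
  | succ N ih =>
    have : KN (N + 1 + 1) t s = KN (N + 1) t s + Dk (N + 1) t * Dk (N + 1) s := by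
      unfold KN; rw [Finset.sum_range_succ]
    rw [this, ih, Finset.sum_range_succ (fun k : ℕ => (2 * Real.cos ((k + 1) * t)) * (∑ j ∈ Finset.range (k + 1), Dk j s)) N,
      Finset.sum_range_succ (fun j => Dk j s) (N + 1), Dk_succ]
    ring

lemma KN_sq (N : ℕ) (t s : ℝ) (hs : |s| ≤ Real.pi) : |KN N t s| * s ^ 2 ≤ N * 40 := by
  have hpi := Real.pi_pos
  have hpi2 : Real.pi ^ 2 ≤ 10 := by nlinarith [Real.pi_lt_d2]
  have hPhi : ∀ k, |∑ j ∈ Finset.range k, Dk j s| * s ^ 2 ≤ Real.pi ^ 2 := by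
    intro k
    have h1 := Phi_mul k s
    have h2 := abs_sin_half_ge s hs
    rw [div_le_iff₀ hpi] at h2
    have h3 : |∑ j ∈ Finset.range k, Dk j s| * |Real.sin (s / 2)| ^ 2 ≤ 1 := by
      have : |∑ j ∈ Finset.range k, Dk j s| * |Real.sin (s / 2)| ^ 2 = 
        |(∑ j ∈ Finset.range k, Dk j s) * Real.sin (s / 2) ^ 2| := by
        rw [abs_mul, abs_pow]
      rw [this, h1, abs_of_nonneg (by positivity)]
      exact Real.sin_sq_le_one _
    calc _ = |∑ j ∈ Finset.range k, Dk j s| * |s| ^ 2 := by rw [sq_abs]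
      _ ≤ |∑ j ∈ Finset.range k, Dk j s| * (|Real.sin (s / 2)| * Real.pi) ^ 2 := by gcongr
      _ = (|∑ j ∈ Finset.range k, Dk j s| * |Real.sin (s / 2)| ^ 2) * Real.pi ^ 2 := by ring
      _ ≤ 1 * Real.pi ^ 2 := by gcongr
      _ = _ := one_mul _
  rcases N with _ | N
  · simp [KN]
  rw [KN_abel]
  calc _ ≤ (|Dk N t| * |∑ j ∈ Finset.range (N + 1), Dk j s| +
      ∑ k ∈ Finset.range N, 2 * |∑ j ∈ Finset.range (k + 1), Dk j s|) * s ^ 2 := by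
        gcongr
        refine (abs_sub _ _).trans ?_
        rw [abs_mul]
        gcongr
        refine (Finset.abs_sum_le_sum_abs _ _).trans ?_
        apply Finset.sum_le_sum
        intro k _
        rw [abs_mul]
        gcongr
        rw [abs_mul, abs_two]; linarith [Real.abs_cos_le_one ((k + 1) * t)]
    _ = |Dk N t| * (|∑ j ∈ Finset.range (N + 1), Dk j s| * s ^ 2) +
        ∑ k ∈ Finset.range N, 2 * (|∑ j ∈ Finset.range (k + 1), Dk j s| * s ^ 2) := by
        rw [add_mul, Finset.sum_mul]
        congr 1
        · ring
        · exact Finset.sum_congr rfl (fun k _ => by ring)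
    _ ≤ (2 * N + 1) * 10 + ∑ k ∈ Finset.range N, 2 * (10:ℝ) := by
        gcongr with k _
        · exact Dk_le N t
        · exact (hPhi _).trans hpi2
        · exact (hPhi _).trans hpi2
    _ ≤ _ := by
        rw [Finset.sum_const, Finset.card_range, nsmul_eq_mul]
        push_cast
        have : (0:ℝ) ≤ N := by positivity
        linarith

lemma KN_prod_eq (N : ℕ) (t s : ℝ) : KN N t s * (2 * (Real.sin (t / 2) * Real.sin (s / 2))) =
    cN N (t - s) - cN N (t + s) := by
  unfold KN cN
  rw [Finset.sum_mul, ← Finset.sum_sub_distrib]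
  apply Finset.sum_congr rfl
  intro k _
  have h1 := Dk_mul k t
  have h2 := Dk_mul k s
  calc _ = 2 * (Dk k t * Real.sin (t / 2)) * (Dk k s * Real.sin (s / 2)) := by ring
    _ = _ := by
      rw [h1, h2, mul_sub, mul_add, Real.cos_sub, Real.cos_add]; ring

lemma KN_far (N : ℕ) (t s : ℝ) (ht : |t| ≤ Real.pi) (hs : |s| ≤ Real.pi)
    (ht' : Real.pi / 2 ≤ |t|) (hs' : Real.pi / 2 ≤ |s|) : |KN N t s| ≤ N * 4 := by
  have hpi := Real.pi_pos
  have hD : ∀ (k : ℕ) (u : ℝ), |u| ≤ Real.pi → Real.pi / 2 ≤ |u| → |Dk k u| ≤ 2 := by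
    intro k u hu hu'
    have h2 := abs_sin_half_ge u hu
    have h3 : 1 / 2 ≤ |Real.sin (u / 2)| := by
      refine le_trans ?_ h2
      rw [le_div_iff₀ hpi]; linarith
    have h4 : |Dk k u| * |Real.sin (u / 2)| ≤ 1 := by
      rw [← abs_mul, Dk_mul]; exact Real.abs_sin_le_one _
    nlinarith [abs_nonneg (Dk k u)]
  unfold KN
  refine (Finset.abs_sum_le_sum_abs _ _).trans ?_
  calc _ ≤ ∑ k ∈ Finset.range N, ((4:ℝ)) := by
        apply Finset.sum_le_sum
        intro k hk
        rw [abs_mul]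
        calc _ ≤ (2:ℝ) * 2 := by
              gcongr
              · exact hD k t ht ht'
              · exact hD k s hs hs'
          _ = _ := by norm_num
    _ = _ := by simp

/-- dyadic majorant -/
def psiD (b : ℝ) : ENNReal := ∑' i : ℕ, ENNReal.ofReal ((1 / 8) ^ i) * (if b ≤ 4 ^ i then 1 else 0)

lemma psiD_ge (b : ℝ) : ∃ n : ℕ, (4:ℝ) ^ n ≤ max 1 b ∧ ENNReal.ofReal ((1 / 8) ^ (n + 1)) ≤ psiD b := by
  obtain ⟨n, h1, h2⟩ := exists_nat_pow_near (x := max 1 b) (y := 4) (le_max_left _ _) (by norm_num)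
  refine ⟨n, h1, ?_⟩
  unfold psiD
  refine le_trans ?_ (ENNReal.le_tsum (n + 1))
  rw [if_pos ((le_max_right 1 b).trans h2.le), mul_one]

lemma psiD_pair (X b c : ℝ) (hX : 0 ≤ X) (h : X ^ 2 * (max 1 b ^ 3 * max 1 c ^ 3) ≤ 1) :
    ENNReal.ofReal X ≤ 64 * (psiD b * psiD c) := by
  obtain ⟨n, h1, h2⟩ := psiD_ge b
  obtain ⟨m, h3, h4⟩ := psiD_ge c
  calc ENNReal.ofReal X ≤ ENNReal.ofReal (64 * ((1 / 8) ^ (n + 1) * (1 / 8) ^ (m + 1))) := by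
        apply ENNReal.ofReal_le_ofReal
        have e : (64:ℝ) * ((1 / 8) ^ (n + 1) * (1 / 8) ^ (m + 1)) = 1 / (8 ^ n * 8 ^ m) := by
          rw [one_div_pow, one_div_pow, pow_succ, pow_succ]; field_simp; norm_num
        rw [e, le_div_iff₀ (by positivity)]
        have h5 : (X * (8 ^ n * 8 ^ m)) ^ 2 ≤ 1 := by
          refine le_trans ?_ h
          have e2 : (X * ((8:ℝ) ^ n * 8 ^ m)) ^ 2 = X ^ 2 * (((4:ℝ) ^ n) ^ 3 * ((4:ℝ) ^ m) ^ 3) := by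
            rw [mul_pow, mul_pow]
            congr 2
            · rw [← pow_mul, ← pow_mul, mul_comm n 2, mul_comm n 3, pow_mul, pow_mul]; norm_num
            · rw [← pow_mul, ← pow_mul, mul_comm m 2, mul_comm m 3, pow_mul, pow_mul]; norm_num
          rw [e2]
          gcongr
        nlinarith [show 0 ≤ X * (8 ^ n * 8 ^ m) by positivity]
    _ = 64 * (ENNReal.ofReal ((1 / 8) ^ (n + 1)) * ENNReal.ofReal ((1 / 8) ^ (m + 1))) := by
        rw [ENNReal.ofReal_mul (by norm_num), ENNReal.ofReal_mul (by positivity)]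
        congr 1
        rw [show (64:ℝ) = ((64:ℕ):ℝ) by norm_num, ENNReal.ofReal_natCast]; norm_num
    _ ≤ _ := by gcongr

/-- sum of the five pair majorants -/
def Maj (N : ℕ) (t s : ℝ) : ENNReal :=
  psiD (N * |t|) * psiD (N * |s|) + psiD (N * |t|) * psiD (N * |t - s|) +
  psiD (N * |t|) * psiD (N * |t + s|) + psiD (N * |s|) * psiD (N * |t - s|) +
  psiD (N * |s|) * psiD (N * |t + s|)

lemma KN_maj_aux (N : ℕ) (hN : 0 < N) (t s : ℝ) (ht : |t| ≤ Real.pi) (hs : |s| ≤ Real.pi)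
    (hst : |s| ≤ |t|) :
    ENNReal.ofReal (|KN N t s| / N) ≤ ENNReal.ofReal (12800 * N ^ 2) *
      (psiD (N * |t|) * psiD (N * |s|) + psiD (N * |t|) * psiD (N * |t - s|) +
       psiD (N * |t|) * psiD (N * |t + s|)) + 4 := by
  have hN' : (0:ℝ) < N := by exact_mod_cast hN
  have hpi := Real.pi_pos
  have hpi2 : Real.pi ^ 2 ≤ 10 := by nlinarith [Real.pi_lt_d2]
  -- generic pair tool
  have tool : ∀ (Y b c : ℝ), 0 ≤ Y → Y ^ 2 * (max 1 b ^ 3 * max 1 c ^ 3) ≤ (100 * N ^ 2) ^ 2 →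
      ENNReal.ofReal Y ≤ ENNReal.ofReal (6400 * N ^ 2) * (psiD b * psiD c) := by
    intro Y b c hY h
    have h1 := psiD_pair (Y / (100 * N ^ 2)) b c (by positivity) (by
      rw [div_pow, div_mul_eq_mul_div, div_le_one (by positivity)]; exact h)
    have e : Y = 100 * N ^ 2 * (Y / (100 * N ^ 2)) := by field_simp
    calc ENNReal.ofReal Y = ENNReal.ofReal (100 * N ^ 2) * ENNReal.ofReal (Y / (100 * N ^ 2)) := by
          rw [← ENNReal.ofReal_mul (by positivity), ← e]
      _ ≤ ENNReal.ofReal (100 * N ^ 2) * (64 * (psiD b * psiD c)) := by gcongr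
      _ = _ := by
          rw [← mul_assoc]
          congr 1
          rw [show (6400:ℝ) * N ^ 2 = (100 * N ^ 2) * 64 by ring, ENNReal.ofReal_mul (p := 100 * (N:ℝ) ^ 2) (by positivity)]
          congr 1
          rw [show (64:ℝ) = ((64:ℕ):ℝ) by norm_num, ENNReal.ofReal_natCast]; norm_num
  set T := N * |t| with hT
  set S := N * |s| with hS
  have hST : S ≤ T := by rw [hT, hS]; gcongr
  have hS0 : 0 ≤ S := by positivity
  by_cases hS1 : S ≤ 1
  · -- case S ≤ 1
    have h1 : ENNReal.ofReal (|KN N t s| / N) ≤ ENNReal.ofReal (6400 * N ^ 2) * (psiD T * psiD S) := by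
      apply tool _ _ _ (by positivity)
      rw [max_eq_left hS1, one_pow, mul_one]
      have hk : |KN N t s| / N * max 1 T ^ 2 ≤ 40 * N ^ 2 := by
        rcases le_total 1 T with h | h
        · rw [max_eq_right h]
          have := KN_sq N s t ht
          rw [KN_comm] at this
          calc _ = (|KN N t s| * t ^ 2) * N := by
                rw [hT, mul_pow, sq_abs]; field_simp
            _ ≤ (N * 40) * N := by gcongr
            _ = _ := by ring
        · rw [max_eq_left h, one_pow, mul_one, div_le_iff₀ hN']
          refine (KN_triv N t s).trans ?_
          nlinarith [pow_pos hN' 3]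
      set B := max 1 T with hB
      have hB1 : 1 ≤ B := le_max_left _ _
      set Y := |KN N t s| / N
      have hY : 0 ≤ Y := by positivity
      have h3 : Y ^ 2 * B ^ 3 ≤ Y ^ 2 * B ^ 4 := by
        gcongr
        norm_num
      have h4 : Y ^ 2 * B ^ 4 = (Y * B ^ 2) ^ 2 := by ring
      have h5 : (Y * B ^ 2) ^ 2 ≤ (40 * N ^ 2) ^ 2 := by gcongr
      nlinarith [pow_pos hN' 4]
    refine h1.trans ?_
    refine le_trans ?_ le_self_add
    refine mul_le_mul' (ENNReal.ofReal_le_ofReal (by nlinarith [pow_pos hN' 2])) ?_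
    rw [add_assoc]
    exact le_self_add
  push Not at hS1
  have hT1 : 1 < T := by linarith
  have ht0 : 0 < |t| := by
    by_contra hc
    have : |t| = 0 := le_antisymm (not_lt.1 hc) (abs_nonneg _)
    rw [hT, this] at hT1; norm_num at hT1
  have hs0 : 0 < |s| := by
    by_contra hc
    have : |s| = 0 := le_antisymm (not_lt.1 hc) (abs_nonneg _)
    rw [hS, this] at hS1; norm_num at hS1
  by_cases hfar : |t - s| ≤ 3 * Real.pi / 2 ∧ |t + s| ≤ 3 * Real.pi / 2
  swap
  · -- wrap-around
    have h2 : 3 * Real.pi / 2 < |t| + |s| := by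
      by_contra hc
      push Not at hc
      exact hfar ⟨(abs_sub t s).trans hc, (abs_add_le t s).trans hc⟩
    have h3 := KN_far N t s ht hs (by linarith) (by linarith)
    refine le_trans ?_ le_add_self
    calc _ ≤ ENNReal.ofReal 4 := by
          apply ENNReal.ofReal_le_ofReal
          rw [div_le_iff₀ hN']; linarith
      _ = _ := by norm_num
  obtain ⟨hv1, hv2⟩ := hfar
  -- each sign
  have hsign : ∀ v : ℝ, |v| ≤ 3 * Real.pi / 2 → |t| - |s| ≤ |v| → |v| ≤ |t| + |s| →
      ENNReal.ofReal (25 * N ^ 2 / (T * S * max 1 (N * |v|))) ≤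
        ENNReal.ofReal (6400 * N ^ 2) * (psiD T * psiD S + psiD T * psiD (N * |v|)) := by
    intro v hv hva hvb
    set U := N * |v| with hU
    have hU0 : 0 ≤ U := by positivity
    have hUa : T - S ≤ U := by rw [hT, hS, hU]; nlinarith
    have hUb : U ≤ T + S := by rw [hT, hS, hU]; nlinarith
    set B := max 1 U with hB
    have hB1 : 1 ≤ B := le_max_left _ _
    have hBU : U ≤ B := le_max_right _ _
    have hBT : B ≤ 2 * T := max_le (by linarith) (by linarith)
    by_cases hh : T / 2 ≤ S
    · refine le_trans (tool _ T U (by positivity) ?_) (by rw [mul_add]; exact le_add_self)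
      rw [max_eq_right hT1.le, ← hB, div_pow, div_mul_eq_mul_div, div_le_iff₀ (by positivity)]
      have h6 : T ^ 2 ≤ 4 * S ^ 2 := by nlinarith
      have h7 : T ^ 3 * B ^ 3 ≤ 8 * (T * S * B) ^ 2 := by
        calc T ^ 3 * B ^ 3 = (T * B ^ 2) * (T ^ 2 * B) := by ring
          _ ≤ (T * B ^ 2) * ((4 * S ^ 2) * (2 * T)) := by gcongr
          _ = _ := by ring
      calc (25 * (N:ℝ) ^ 2) ^ 2 * (T ^ 3 * B ^ 3) ≤ (25 * (N:ℝ) ^ 2) ^ 2 * (8 * (T * S * B) ^ 2) := by gcongr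
        _ = 5000 * ((N:ℝ) ^ 4 * (T * S * B) ^ 2) := by ring
        _ ≤ 10000 * ((N:ℝ) ^ 4 * (T * S * B) ^ 2) := by gcongr; norm_num
        _ = _ := by ring
    · push Not at hh
      refine le_trans (tool _ T S (by positivity) ?_) (by rw [mul_add]; exact le_self_add)
      rw [max_eq_right hT1.le, max_eq_right hS1.le, div_pow, div_mul_eq_mul_div, div_le_iff₀ (by positivity)]
      have h5 : T ≤ 2 * B := by linarith
      have h7 : T ^ 3 * S ^ 3 ≤ 4 * (T * S * B) ^ 2 := by
        calc T ^ 3 * S ^ 3 = (T ^ 2 * S ^ 2) * (T * S) := by ring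
          _ ≤ (T ^ 2 * S ^ 2) * (T * T) := by gcongr
          _ ≤ (T ^ 2 * S ^ 2) * ((2 * B) * (2 * B)) := by gcongr
          _ = _ := by ring
      calc (25 * (N:ℝ) ^ 2) ^ 2 * (T ^ 3 * S ^ 3) ≤ (25 * (N:ℝ) ^ 2) ^ 2 * (4 * (T * S * B) ^ 2) := by gcongr
        _ = 2500 * ((N:ℝ) ^ 4 * (T * S * B) ^ 2) := by ring
        _ ≤ 10000 * ((N:ℝ) ^ 4 * (T * S * B) ^ 2) := by gcongr; norm_num
        _ = _ := by ring
  have hb1 := hsign (t - s) hv1 (abs_sub_abs_le_abs_sub t s) (abs_sub t s)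
  have hb2 := hsign (t + s) hv2 (by
    have := abs_sub_abs_le_abs_sub t (-s)
    rwa [abs_neg, sub_neg_eq_add] at this) (abs_add_le t s)
  have hK : |KN N t s| / N ≤ 25 * N ^ 2 / (T * S * max 1 (N * |t - s|)) +
      25 * N ^ 2 / (T * S * max 1 (N * |t + s|)) := by
    have h1 := KN_prod_eq N t s
    have h2 := abs_sin_half_ge t ht
    have h3 := abs_sin_half_ge s hs
    have h4 := cN_le N (t - s) hv1
    have h5 := cN_le N (t + s) hv2
    set B1 := max 1 (N * |t - s|) with hB1
    set B2 := max 1 (N * |t + s|) with hB2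
    have hB1' : 0 < B1 := lt_of_lt_of_le one_pos (le_max_left _ _)
    have hB2' : 0 < B2 := lt_of_lt_of_le one_pos (le_max_left _ _)
    rw [← le_div_iff₀ hB1'] at h4
    rw [← le_div_iff₀ hB2'] at h5
    have h6 : |KN N t s| * (2 * (|Real.sin (t / 2)| * |Real.sin (s / 2)|)) ≤ 5 * N / B1 + 5 * N / B2 := by
      have : |KN N t s| * (2 * (|Real.sin (t / 2)| * |Real.sin (s / 2)|)) = 
        |KN N t s * (2 * (Real.sin (t / 2) * Real.sin (s / 2)))| := by
        rw [abs_mul, abs_mul, abs_mul, abs_two]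
      rw [this, h1]
      exact (abs_sub _ _).trans (add_le_add h4 h5)
    have h7 : |KN N t s| * (2 * ((|t| / Real.pi) * (|s| / Real.pi))) ≤ 5 * N / B1 + 5 * N / B2 := by
      refine le_trans ?_ h6
      gcongr
    have h8 : |KN N t s| * (|t| * |s|) ≤ (Real.pi ^ 2 / 2) * (5 * N / B1 + 5 * N / B2) := by
      calc _ = (Real.pi ^ 2 / 2) * (|KN N t s| * (2 * ((|t| / Real.pi) * (|s| / Real.pi)))) := by
            field_simp
        _ ≤ _ := by gcongr
    have h9 : |KN N t s| * (|t| * |s|) ≤ 5 * (5 * N / B1 + 5 * N / B2) := by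
      refine h8.trans ?_
      gcongr
      linarith
    have e : 25 * (N:ℝ) ^ 2 / (T * S * B1) + 25 * N ^ 2 / (T * S * B2) =
        5 * (5 * N / B1 + 5 * N / B2) / (N * (|t| * |s|)) := by
      rw [hT, hS]; field_simp; norm_num
    rw [e, div_le_div_iff₀ hN' (by positivity)]
    nlinarith
  calc _ ≤ ENNReal.ofReal (25 * N ^ 2 / (T * S * max 1 (N * |t - s|)) +
      25 * N ^ 2 / (T * S * max 1 (N * |t + s|))) := ENNReal.ofReal_le_ofReal hK
    _ = ENNReal.ofReal (25 * N ^ 2 / (T * S * max 1 (N * |t - s|))) +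
      ENNReal.ofReal (25 * N ^ 2 / (T * S * max 1 (N * |t + s|))) := by
        rw [ENNReal.ofReal_add (by positivity) (by positivity)]
    _ ≤ _ := (add_le_add hb1 hb2)
    _ ≤ ENNReal.ofReal (6400 * N ^ 2) * 2 * (psiD T * psiD S + psiD T * psiD (N * |t - s|) +
          psiD T * psiD (N * |t + s|)) := by
        rw [mul_assoc (ENNReal.ofReal (6400 * (N:ℝ) ^ 2)), ← mul_add]
        gcongr
        rw [two_mul]
        refine add_le_add le_self_add ?_
        rw [add_right_comm]; exact le_self_add
    _ ≤ _ := by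
        refine le_trans ?_ le_self_add
        gcongr
        rw [show (12800:ℝ) * N ^ 2 = (6400 * N ^ 2) * 2 by ring, ENNReal.ofReal_mul (p := 6400 * (N:ℝ) ^ 2) (by positivity)]
        gcongr
        norm_num

lemma KN_maj (N : ℕ) (hN : 0 < N) (t s : ℝ) (ht : |t| ≤ Real.pi) (hs : |s| ≤ Real.pi) :
    ENNReal.ofReal (|KN N t s| / N) ≤ ENNReal.ofReal (12800 * N ^ 2) * Maj N t s + 4 := by
  unfold Maj
  rcases le_total |s| |t| with h | h
  · refine (KN_maj_aux N hN t s ht hs h).trans ?_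
    refine add_le_add (mul_le_mul' le_rfl ?_) le_rfl
    rw [add_assoc _ (psiD (N * |s|) * psiD (N * |t - s|))]
    exact le_self_add
  · rw [KN_comm]
    refine (KN_maj_aux N hN s t hs ht h).trans ?_
    refine add_le_add (mul_le_mul' le_rfl ?_) le_rfl
    rw [abs_sub_comm s t, add_comm s t, mul_comm (psiD (N * |s|)) (psiD (N * |t|))]
    have : ∀ a b c d e : ENNReal, a + d + e ≤ a + b + c + d + e := by
      intro a b c d e
      calc a + d + e ≤ a + d + e + (b + c) := le_self_add
        _ = _ := by ring
    exact this _ _ _ _ _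

lemma maxL (a b c d : ℝ) (hdet : a * d - b * c ≠ 0) (G : ℝ × ℝ → ENNReal) (hG : Measurable G) (lam : ENNReal) :
    lam * volume {z : ℝ × ℝ | ∃ r, 0 < r ∧ lam * ENNReal.ofReal (4 * r ^ 2) <
      ENNReal.ofReal |a * d - b * c| *
        ∫⁻ w in {w : ℝ × ℝ | |a * (z.1 - w.1) + b * (z.2 - w.2)| ≤ r ∧ |c * (z.1 - w.1) + d * (z.2 - w.2)| ≤ r}, G w} ≤
      25 * ∫⁻ w, G w := by
  set D := a * d - b * c with hD
  let L : ℝ × ℝ →ₗ[ℝ] ℝ × ℝ := Matrix.toLin (Module.Basis.finTwoProd ℝ) (Module.Basis.finTwoProd ℝ) !![a, b; c, d]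
  let f : ℝ × ℝ → ℝ × ℝ := fun w => ((d * w.1 - b * w.2) / D, (a * w.2 - c * w.1) / D)
  have hf : Measurable f := by fun_prop
  have hLap : ∀ w, L w = (a * w.1 + b * w.2, c * w.1 + d * w.2) := fun w =>
    Matrix.toLin_finTwoProd_apply a b c d w
  have hdL : LinearMap.det L = D := by
    simp only [L, LinearMap.det_toLin, Matrix.det_fin_two_of, hD]
  have hfL : ∀ w, f (L w) = w := by
    intro w
    rw [hLap]
    apply Prod.ext
    · simp only [f]; rw [div_eq_iff hdet, hD]; ring
    · simp only [f]; rw [div_eq_iff hdet, hD]; ring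
  have hL : Measurable L := by
    have : (L : ℝ × ℝ → ℝ × ℝ) = fun w => (a * w.1 + b * w.2, c * w.1 + d * w.2) := funext hLap
    rw [this]; fun_prop
  have hmap : Measure.map L volume = ENNReal.ofReal |D⁻¹| • (volume : Measure (ℝ × ℝ)) := by
    have := Measure.map_linearMap_addHaar_eq_smul_addHaar (μ := (volume : Measure (ℝ × ℝ))) (f := L) (by rw [hdL]; exact hdet)
    rw [this, hdL]
  have hDp : 0 < |D| := abs_pos.2 hdet
  have hvol : (volume : Measure (ℝ × ℝ)) = ENNReal.ofReal |D| • Measure.map L volume := by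
    rw [hmap, smul_smul, ← ENNReal.ofReal_mul hDp.le, ← abs_mul, mul_inv_cancel₀ hdet]
    simp
  have hIntg : ∀ s : Set (ℝ × ℝ), MeasurableSet s → ∫⁻ u in s, G (f u) = ENNReal.ofReal |D| * ∫⁻ w in L ⁻¹' s, G w := by
    intro s hs
    conv_lhs => rw [hvol]
    rw [Measure.restrict_smul, lintegral_smul_measure, setLIntegral_map (f := fun u => G (f u)) hs (hG.comp hf) hL]
    simp only [hfL, smul_eq_mul]
  have h1 := vit2 (fun u => G (f u)) lam
  have h2 := hIntg univ MeasurableSet.univ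
  simp only [Measure.restrict_univ, preimage_univ] at h2
  rw [h2] at h1
  set B := {x : ℝ × ℝ | ∃ r, 0 < r ∧
      lam * ENNReal.ofReal (4 * r ^ 2) < ∫⁻ y in Metric.closedBall x r, G (f y)} with hB
  have h3 : {z : ℝ × ℝ | ∃ r, 0 < r ∧ lam * ENNReal.ofReal (4 * r ^ 2) <
      ENNReal.ofReal |D| *
        ∫⁻ w in {w : ℝ × ℝ | |a * (z.1 - w.1) + b * (z.2 - w.2)| ≤ r ∧ |c * (z.1 - w.1) + d * (z.2 - w.2)| ≤ r}, G w}
      = L ⁻¹' B := by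
    ext z
    simp only [hB, mem_preimage, mem_setOf_eq]
    refine exists_congr fun r => and_congr_right fun hr => ?_
    rw [hIntg _ Metric.isClosed_closedBall.measurableSet]
    have : L ⁻¹' Metric.closedBall (L z) r = {w : ℝ × ℝ | |a * (z.1 - w.1) + b * (z.2 - w.2)| ≤ r ∧ |c * (z.1 - w.1) + d * (z.2 - w.2)| ≤ r} := by
      ext w
      simp only [mem_preimage, Metric.mem_closedBall, mem_setOf_eq, hLap, Prod.dist_eq, Real.dist_eq, max_le_iff]
      rw [abs_sub_comm, abs_sub_comm (c * w.1 + d * w.2)]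
      ring_nf
    rw [this]
  rw [h3, Measure.addHaar_preimage_linearMap _ (by rw [hdL]; exact hdet), hdL, abs_inv, ENNReal.ofReal_inv_of_pos hDp]
  have hD0 : ENNReal.ofReal |D| ≠ 0 := by simpa using hdet
  calc lam * ((ENNReal.ofReal |D|)⁻¹ * volume B) = (ENNReal.ofReal |D|)⁻¹ * (lam * volume B) := by ring
    _ ≤ (ENNReal.ofReal |D|)⁻¹ * (25 * (ENNReal.ofReal |D| * ∫⁻ w, G w)) := by gcongr
    _ = ((ENNReal.ofReal |D|)⁻¹ * ENNReal.ofReal |D|) * (25 * ∫⁻ w, G w) := by ring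
    _ = _ := by rw [ENNReal.inv_mul_cancel hD0 ENNReal.ofReal_ne_top, one_mul]

lemma geo23 (q s : ℝ) (hq : 0 ≤ q) (hq1 : q < 1) (hs : (1 - q)⁻¹ = s) : ∑' i : ℕ, ENNReal.ofReal (q ^ i) = ENNReal.ofReal s := by
  rw [← ENNReal.ofReal_tsum_of_nonneg (fun i => pow_nonneg hq i) (summable_geometric_of_lt_one hq hq1),
    tsum_geometric_of_lt_one hq hq1, hs]

lemma pairmax (a b c d : ℝ) (hdet : |a * d - b * c| = 1) (G : ℝ × ℝ → ENNReal) (hG : Measurable G)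
    (lam : ℝ) (hl : 0 < lam) : ∃ E : Set (ℝ × ℝ), ENNReal.ofReal lam * volume E ≤ 225 * ∫⁻ w, G w ∧
      ∀ z ∉ E, ∀ N : ℕ, 0 < N → ENNReal.ofReal (N ^ 2) * ∫⁻ w, G w * (psiD (N * |a * (z.1 - w.1) + b * (z.2 - w.2)|) *
        psiD (N * |c * (z.1 - w.1) + d * (z.2 - w.2)|)) ≤ ENNReal.ofReal (64 * lam) := by
  let aa : ℕ → ℝ := fun i => (1/4)^i
  let E : ℕ → ℕ → Set (ℝ × ℝ) := fun i j => {z : ℝ × ℝ | ∃ r, 0 < r ∧ ENNReal.ofReal (lam * (3/2)^(i+j)) * ENNReal.ofReal (4 * r ^ 2) <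
      ENNReal.ofReal |(aa i * a) * (aa j * d) - (aa i * b) * (aa j * c)| *
        ∫⁻ w in {w : ℝ × ℝ | |(aa i * a) * (z.1 - w.1) + (aa i * b) * (z.2 - w.2)| ≤ r ∧ |(aa j * c) * (z.1 - w.1) + (aa j * d) * (z.2 - w.2)| ≤ r}, G w}
  have haa : ∀ i, 0 < aa i := fun i => by positivity
  have hde : ∀ i j, |(aa i * a) * (aa j * d) - (aa i * b) * (aa j * c)| = aa i * aa j := by
    intro i j
    rw [show (aa i * a) * (aa j * d) - (aa i * b) * (aa j * c) = (aa i * aa j) * (a * d - b * c) by ring, abs_mul, hdet,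
      mul_one, abs_of_pos (mul_pos (haa i) (haa j))]
  have hE : ∀ i j, ENNReal.ofReal lam * volume (E i j) ≤ ENNReal.ofReal ((2/3)^i) * (ENNReal.ofReal ((2/3)^j) * (25 * ∫⁻ w, G w)) := by
    intro i j
    have := maxL (aa i * a) (aa i * b) (aa j * c) (aa j * d) (by
      rw [← abs_pos, hde]; exact mul_pos (haa i) (haa j)) G hG (ENNReal.ofReal (lam * (3/2)^(i+j)))
    calc ENNReal.ofReal lam * volume (E i j) = ENNReal.ofReal ((2/3)^i) * (ENNReal.ofReal ((2/3)^j) * (ENNReal.ofReal (lam * (3/2)^(i+j)) * volume (E i j))) := by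
          rw [← mul_assoc, ← mul_assoc, ← ENNReal.ofReal_mul (by positivity), ← ENNReal.ofReal_mul (by positivity)]
          congr 2
          rw [← pow_add, mul_left_comm, ← mul_pow]; norm_num
      _ ≤ _ := by gcongr
  refine ⟨⋃ i, ⋃ j, E i j, ?_, ?_⟩
  · calc _ ≤ ENNReal.ofReal lam * ∑' i, ∑' j, volume (E i j) := by
          gcongr
          refine (measure_iUnion_le _).trans (ENNReal.tsum_le_tsum fun i => measure_iUnion_le _)
      _ = ∑' i, ∑' j, ENNReal.ofReal lam * volume (E i j) := by
          simp only [ENNReal.tsum_mul_left]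
      _ ≤ ∑' i, ∑' j, ENNReal.ofReal ((2/3)^i) * (ENNReal.ofReal ((2/3)^j) * (25 * ∫⁻ w, G w)) :=
          ENNReal.tsum_le_tsum fun i => ENNReal.tsum_le_tsum fun j => hE i j
      _ = _ := by
          simp only [ENNReal.tsum_mul_left, ENNReal.tsum_mul_right]
          rw [geo23 (2/3) 3 (by norm_num) (by norm_num) (by norm_num)]
          rw [show (3:ℝ) = ((3:ℕ):ℝ) by norm_num, ENNReal.ofReal_natCast, ← mul_assoc, ← mul_assoc]
          norm_num
  · intro z hz N hN
    have hN' : (0:ℝ) < N := by exact_mod_cast hN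
    simp only [mem_iUnion, not_exists] at hz
    let P : ℕ → ℕ → Set (ℝ × ℝ) := fun i j => {w | N * |a * (z.1 - w.1) + b * (z.2 - w.2)| ≤ 4 ^ i ∧
        N * |c * (z.1 - w.1) + d * (z.2 - w.2)| ≤ 4 ^ j}
    have hPm : ∀ i j, MeasurableSet (P i j) := by
      intro i j
      have q1 : MeasurableSet {w : ℝ × ℝ | N * |a * (z.1 - w.1) + b * (z.2 - w.2)| ≤ 4 ^ i} :=
        measurableSet_le (by fun_prop) (by fun_prop)
      have q2 : MeasurableSet {w : ℝ × ℝ | N * |c * (z.1 - w.1) + d * (z.2 - w.2)| ≤ 4 ^ j} :=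
        measurableSet_le (by fun_prop) (by fun_prop)
      exact q1.inter q2
    have hP : ∀ i j, ENNReal.ofReal (aa i * aa j) * ∫⁻ w in P i j, G w ≤ ENNReal.ofReal (lam * (3/2)^(i+j) * (4 * (1 / N)^2)) := by
      intro i j
      have h1 := hz i j
      simp only [E, mem_setOf_eq, not_exists, not_and, not_lt] at h1
      have h2 := h1 (1 / N) (by positivity)
      rw [hde, ← ENNReal.ofReal_mul (by positivity)] at h2
      refine le_trans (le_of_eq ?_) h2
      congr 3
      ext w
      simp only [P, mem_setOf_eq, mul_assoc, ← mul_add, abs_mul, abs_of_pos (haa _)]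
      have h4 : ∀ i, ∀ X : ℝ, (N * X ≤ 4 ^ i ↔ aa i * X ≤ 1 / N) := by
        intro i X
        simp only [aa, div_pow, one_pow]
        rw [le_div_iff₀ hN', div_mul_eq_mul_div, div_mul_eq_mul_div, div_le_iff₀ (by positivity), one_mul, one_mul, mul_comm X]
      rw [h4, h4]
    have hexp : ∀ w, G w * (psiD (N * |a * (z.1 - w.1) + b * (z.2 - w.2)|) *
        psiD (N * |c * (z.1 - w.1) + d * (z.2 - w.2)|)) =
        ∑' i, ∑' j, ENNReal.ofReal ((1/8)^i) * (ENNReal.ofReal ((1/8)^j) * (P i j).indicator G w) := by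
      intro w
      unfold psiD
      rw [← ENNReal.tsum_mul_right, ← ENNReal.tsum_mul_left]
      congr 1; ext i
      rw [← ENNReal.tsum_mul_left, ← ENNReal.tsum_mul_left]
      congr 1; ext j
      simp only [P, indicator, mem_setOf_eq]
      split_ifs <;> simp_all <;> ring
    simp only [hexp]
    rw [lintegral_tsum (fun i => by
      refine Measurable.aemeasurable (Measurable.ennreal_tsum fun j => ?_)
      exact ((hG.indicator (hPm i j)).const_mul _).const_mul _), ← ENNReal.tsum_mul_left]
    have hterm : ∀ i j, ENNReal.ofReal (N ^ 2) * (∫⁻ w, ENNReal.ofReal ((1/8)^i) * (ENNReal.ofReal ((1/8)^j) * (P i j).indicator G w)) ≤ 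
        ENNReal.ofReal ((3/4)^i) * (ENNReal.ofReal ((3/4)^j) * ENNReal.ofReal (4 * lam)) := by
      intro i j
      rw [lintegral_const_mul _ ((hG.indicator (hPm i j)).const_mul _), lintegral_const_mul _ (hG.indicator (hPm i j)),
        lintegral_indicator (hPm i j)]
      calc ENNReal.ofReal (N ^ 2) * (ENNReal.ofReal ((1/8)^i) * (ENNReal.ofReal ((1/8)^j) * ∫⁻ w in P i j, G w))
          = ENNReal.ofReal (N ^ 2 * ((1/2)^i * (1/2)^j)) * (ENNReal.ofReal (aa i * aa j) * ∫⁻ w in P i j, G w) := by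
            simp only [← mul_assoc]
            congr 1
            rw [← ENNReal.ofReal_mul (by positivity), ← ENNReal.ofReal_mul (by positivity), ← ENNReal.ofReal_mul (by positivity)]
            congr 1
            simp only [aa]
            rw [show (1/8:ℝ) = (1/2) * (1/4) by norm_num, mul_pow, mul_pow]; ring
        _ ≤ ENNReal.ofReal (N ^ 2 * ((1/2)^i * (1/2)^j)) * ENNReal.ofReal (lam * (3/2)^(i+j) * (4 * (1 / N)^2)) := mul_le_mul' le_rfl (hP i j)
        _ = _ := by
            rw [← ENNReal.ofReal_mul (by positivity), ← ENNReal.ofReal_mul (by positivity), ← ENNReal.ofReal_mul (by positivity)]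
            congr 1
            rw [show (3/4:ℝ) = (1/2) * (3/2) by norm_num, mul_pow, mul_pow, pow_add]
            field_simp
    calc _ ≤ ∑' i, ∑' j, ENNReal.ofReal ((3/4)^i) * (ENNReal.ofReal ((3/4)^j) * ENNReal.ofReal (4 * lam)) := by
          refine ENNReal.tsum_le_tsum fun i => ?_
          rw [lintegral_tsum (fun j => (((hG.indicator (hPm i j)).const_mul _).const_mul _).aemeasurable), ← ENNReal.tsum_mul_left]
          exact ENNReal.tsum_le_tsum fun j => hterm i j
      _ = _ := by
          simp only [ENNReal.tsum_mul_left, ENNReal.tsum_mul_right]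
          rw [geo23 (3/4) 4 (by norm_num) (by norm_num) (by norm_num), ← ENNReal.ofReal_mul (by positivity), ← ENNReal.ofReal_mul (by positivity)]
          congr 1; ring

/-- Maximal bound for the two-dimensional mean kernel. -/
lemma meanmax (G : ℝ × ℝ → ENNReal) (hG : Measurable G) (lam : ℝ) (hl : 0 < lam) :
    ∃ E : Set (ℝ × ℝ), ENNReal.ofReal lam * volume E ≤ 1150 * ∫⁻ w, G w ∧
      ∀ z ∉ E, ∀ N : ℕ, 0 < N → ∫⁻ w in Metric.closedBall z Real.pi,
        G w * ENNReal.ofReal (|KN N (z.1 - w.1) (z.2 - w.2)| / N) ≤ ENNReal.ofReal (5000000 * lam) := by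
  obtain ⟨E1, m1, h1⟩ := pairmax 1 0 0 1 (by norm_num) G hG lam hl
  obtain ⟨E2, m2, h2⟩ := pairmax 1 0 1 (-1) (by norm_num) G hG lam hl
  obtain ⟨E3, m3, h3⟩ := pairmax 1 0 1 1 (by norm_num) G hG lam hl
  obtain ⟨E4, m4, h4⟩ := pairmax 0 1 1 (-1) (by norm_num) G hG lam hl
  obtain ⟨E5, m5, h5⟩ := pairmax 0 1 1 1 (by norm_num) G hG lam hl
  have m6 := vit2 G (ENNReal.ofReal lam)
  set E6 := {x : ℝ × ℝ | ∃ r, 0 < r ∧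
      ENNReal.ofReal lam * ENNReal.ofReal (4 * r ^ 2) < ∫⁻ y in Metric.closedBall x r, G y} with hE6
  refine ⟨E1 ∪ E2 ∪ E3 ∪ E4 ∪ E5 ∪ E6, ?_, ?_⟩
  · calc _ ≤ ENNReal.ofReal lam * (volume E1 + volume E2 + volume E3 + volume E4 + volume E5 + volume E6) := by
          refine mul_le_mul' le_rfl ?_
          refine (measure_union_le _ _).trans (add_le_add ?_ le_rfl)
          refine (measure_union_le _ _).trans (add_le_add ?_ le_rfl)
          refine (measure_union_le _ _).trans (add_le_add ?_ le_rfl)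
          refine (measure_union_le _ _).trans (add_le_add ?_ le_rfl)
          exact (measure_union_le _ _)
      _ ≤ 225 * (∫⁻ w, G w) + 225 * (∫⁻ w, G w) + 225 * (∫⁻ w, G w) + 225 * (∫⁻ w, G w) + 225 * (∫⁻ w, G w) + 25 * (∫⁻ w, G w) := by
          simp only [mul_add]
          exact add_le_add (add_le_add (add_le_add (add_le_add (add_le_add m1 m2) m3) m4) m5) m6
      _ = _ := by ring
  · intro z hz N hN
    simp only [mem_union, not_or] at hz
    obtain ⟨⟨⟨⟨⟨z1, z2⟩, z3⟩, z4⟩, z5⟩, z6⟩ := hz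
    have k1 := h1 z z1 N hN
    have k2 := h2 z z2 N hN
    have k3 := h3 z z3 N hN
    have k4 := h4 z z4 N hN
    have k5 := h5 z z5 N hN
    simp only [zero_mul, one_mul, zero_add, add_zero, neg_mul, ← sub_eq_add_neg] at k1 k2 k3 k4 k5
    have k6 : ∫⁻ y in Metric.closedBall z Real.pi, G y ≤ ENNReal.ofReal (40 * lam) := by
      simp only [hE6, mem_setOf_eq, not_exists, not_and, not_lt] at z6
      refine (z6 _ Real.pi_pos).trans ?_
      rw [← ENNReal.ofReal_mul hl.le]
      apply ENNReal.ofReal_le_ofReal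
      have := Real.pi_lt_d2
      have := Real.pi_pos
      nlinarith [mul_pos hl hl, mul_le_mul_of_nonneg_left (show 4 * Real.pi ^ 2 ≤ 40 by nlinarith) hl.le]
    have mpsi : Measurable psiD := by
      unfold psiD
      refine Measurable.ennreal_tsum fun i => Measurable.const_mul ?_ _
      exact Measurable.ite (measurableSet_le measurable_id measurable_const) measurable_const measurable_const
    calc _ ≤ ∫⁻ w in Metric.closedBall z Real.pi, (ENNReal.ofReal (12800) * (
            ENNReal.ofReal (N^2) * (G w * (psiD (N * |z.1 - w.1|) * psiD (N * |z.2 - w.2|)))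
            + ENNReal.ofReal (N^2) * (G w * (psiD (N * |z.1 - w.1|) * psiD (N * |z.1 - w.1 - (z.2 - w.2)|)))
            + ENNReal.ofReal (N^2) * (G w * (psiD (N * |z.1 - w.1|) * psiD (N * |z.1 - w.1 + (z.2 - w.2)|)))
            + ENNReal.ofReal (N^2) * (G w * (psiD (N * |z.2 - w.2|) * psiD (N * |z.1 - w.1 - (z.2 - w.2)|)))
            + ENNReal.ofReal (N^2) * (G w * (psiD (N * |z.2 - w.2|) * psiD (N * |z.1 - w.1 + (z.2 - w.2)|)))) + 4 * G w) := by
          refine setLIntegral_mono' Metric.isClosed_closedBall.measurableSet fun w hw => ?_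
          rw [Metric.mem_closedBall, Prod.dist_eq, max_le_iff, dist_comm, Real.dist_eq, dist_comm, Real.dist_eq] at hw
          refine (mul_le_mul' le_rfl (KN_maj N hN _ _ hw.1 hw.2)).trans (le_of_eq ?_)
          unfold Maj
          rw [ENNReal.ofReal_mul (p := 12800) (by norm_num)]
          ring
      _ = ENNReal.ofReal (12800) * (
            ENNReal.ofReal (N^2) * (∫⁻ w in Metric.closedBall z Real.pi, G w * (psiD (N * |z.1 - w.1|) * psiD (N * |z.2 - w.2|)))
            + ENNReal.ofReal (N^2) * (∫⁻ w in Metric.closedBall z Real.pi, G w * (psiD (N * |z.1 - w.1|) * psiD (N * |z.1 - w.1 - (z.2 - w.2)|)))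
            + ENNReal.ofReal (N^2) * (∫⁻ w in Metric.closedBall z Real.pi, G w * (psiD (N * |z.1 - w.1|) * psiD (N * |z.1 - w.1 + (z.2 - w.2)|)))
            + ENNReal.ofReal (N^2) * (∫⁻ w in Metric.closedBall z Real.pi, G w * (psiD (N * |z.2 - w.2|) * psiD (N * |z.1 - w.1 - (z.2 - w.2)|)))
            + ENNReal.ofReal (N^2) * (∫⁻ w in Metric.closedBall z Real.pi, G w * (psiD (N * |z.2 - w.2|) * psiD (N * |z.1 - w.1 + (z.2 - w.2)|)))) + 4 * ∫⁻ w in Metric.closedBall z Real.pi, G w := by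
          rw [lintegral_add_right _ (by fun_prop), lintegral_const_mul _ (by fun_prop), lintegral_const_mul _ (by fun_prop),
            lintegral_add_right _ (by fun_prop), lintegral_add_right _ (by fun_prop), lintegral_add_right _ (by fun_prop), lintegral_add_right _ (by fun_prop),
            lintegral_const_mul _ (by fun_prop), lintegral_const_mul _ (by fun_prop), lintegral_const_mul _ (by fun_prop),
            lintegral_const_mul _ (by fun_prop), lintegral_const_mul _ (by fun_prop)]
      _ ≤ ENNReal.ofReal 12800 * (ENNReal.ofReal (64 * lam) + ENNReal.ofReal (64 * lam) + ENNReal.ofReal (64 * lam)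
            + ENNReal.ofReal (64 * lam) + ENNReal.ofReal (64 * lam)) + 4 * ENNReal.ofReal (40 * lam) := by
          refine add_le_add (mul_le_mul' le_rfl (add_le_add (add_le_add (add_le_add (add_le_add ?_ ?_) ?_) ?_) ?_)) (mul_le_mul' le_rfl k6)
          · exact (mul_le_mul' le_rfl (setLIntegral_le_lintegral _ _)).trans k1
          · exact (mul_le_mul' le_rfl (setLIntegral_le_lintegral _ _)).trans k2
          · exact (mul_le_mul' le_rfl (setLIntegral_le_lintegral _ _)).trans k3
          · exact (mul_le_mul' le_rfl (setLIntegral_le_lintegral _ _)).trans k4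
          · exact (mul_le_mul' le_rfl (setLIntegral_le_lintegral _ _)).trans k5
      _ ≤ _ := by
          rw [show (4:ENNReal) = ENNReal.ofReal 4 by norm_num]
          rw [← ENNReal.ofReal_add (by positivity) (by positivity), ← ENNReal.ofReal_add (by positivity) (by positivity),
            ← ENNReal.ofReal_add (by positivity) (by positivity), ← ENNReal.ofReal_add (by positivity) (by positivity),
            ← ENNReal.ofReal_mul (by positivity), ← ENNReal.ofReal_mul (by positivity), ← ENNReal.ofReal_add (by positivity) (by positivity)]
          apply ENNReal.ofReal_le_ofReal
          linarith

lemma e1_point (u v q R : ℝ) (z : ℂ) (hz : z = ⟨u, v⟩) (hu : 0 < u) (hR : R = ‖z‖) 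
    (hq : (u - 1/10) * Real.log R ≤ q + R * 0.368) :
    1/2 * |v| ≤ q + 3/2 * u - (z * Complex.log z).re := by
  have hre : z.re = u := by rw [hz]
  have him : z.im = v := by rw [hz]
  have hR0 : 0 < R := by
    rw [hR]; exact lt_of_lt_of_le (by rw [hre]; exact hu) (Complex.re_le_norm z)
  have hRu : u ≤ R := by rw [hR, ← hre]; exact Complex.re_le_norm z
  have hR2 : R ^ 2 = u ^ 2 + v ^ 2 := by
    rw [hR, ← hre, ← him, Complex.sq_norm, Complex.normSq_apply]; ring
  have hRv : |v| ≤ R := by rw [hR, ← him]; exact Complex.abs_im_le_norm z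
  have hRuv : R ≤ u + |v| := by
    rw [hR]; refine (Complex.norm_le_abs_re_add_abs_im z).trans ?_
    rw [hre, him, abs_of_pos hu]
  have harg : z.arg = Real.arcsin (v / R) := by
    rw [Complex.arg_of_re_nonneg (by rw [hre]; exact hu.le), him, hR]
  have hmul : |v| - u ≤ v * z.arg := by
    have h1 : v ^ 2 / R ≤ v * z.arg := by
      rw [harg]
      rcases le_total 0 v with h | h
      · have : v / R ≤ Real.arcsin (v / R) := by
          have h1 : v / R ≤ 1 := by rw [div_le_one hR0]; exact (le_abs_self v).trans hRv
          have h0 : 0 ≤ v / R := by positivity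
          have := Real.sin_le (Real.arcsin_nonneg.2 h0)
          rwa [Real.sin_arcsin (by linarith) h1] at this
        calc v ^ 2 / R = v * (v / R) := by ring
          _ ≤ _ := by gcongr
      · have : -v / R ≤ Real.arcsin (-v / R) := by
          have h1 : -v / R ≤ 1 := by rw [div_le_one hR0]; exact (neg_le_abs v).trans hRv
          have h0 : 0 ≤ -v / R := div_nonneg (by linarith) hR0.le
          have := Real.sin_le (Real.arcsin_nonneg.2 h0)
          rwa [Real.sin_arcsin (by linarith) h1] at this
        calc v ^ 2 / R = -v * (-v / R) := by ring
          _ ≤ -v * Real.arcsin (-v / R) := by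
            apply mul_le_mul_of_nonneg_left this; linarith
          _ = _ := by rw [neg_div, Real.arcsin_neg]; ring
    refine le_trans ?_ h1
    rw [le_div_iff₀ hR0]
    nlinarith [sq_abs v, abs_nonneg v]
  have hH : (z * Complex.log z).re = u * Real.log R - v * z.arg := by
    rw [Complex.mul_re, Complex.log_re, Complex.log_im, hre, him, hR]
  have hlog : Real.log R ≤ R := (Real.log_le_sub_one_of_pos hR0).trans (by linarith)
  rw [hH]
  nlinarith [abs_nonneg v]

lemma exp_inv_le : Real.exp (-1) ≤ 0.368 := by
  have := Real.exp_one_gt_d9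
  rw [Real.exp_neg, inv_le_comm₀ (Real.exp_pos 1) (by norm_num)]
  norm_num at this ⊢
  linarith

lemma analytic_bd (F : ℂ → ℂ) (hF : Differentiable ℂ F) (h0 : (F 0).im = 0)
    (hre : ∀ θ : ℝ, 0 ≤ (F (circleMap 0 1 θ)).re) (q : ℝ → ℝ) (hqi : IntervalIntegrable q volume 0 (2 * Real.pi))
    (hq : ∀ θ : ℝ, ∀ w : ℝ, 0 < w → (F (circleMap 0 1 θ)).re * Real.log w ≤ q θ + w * 0.368) :
    ∫ θ in (0:ℝ)..(2 * Real.pi), |(F (circleMap 0 1 θ)).im| ≤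
      3 * (∫ θ in (0:ℝ)..(2 * Real.pi), (F (circleMap 0 1 θ)).re) + 2 * (∫ θ in (0:ℝ)..(2 * Real.pi), q θ) + 15 := by
  have hdisc : ∀ z ∈ Metric.closedBall (0:ℂ) 1, 0 ≤ (F z).re := by
    intro z hz
    have h1 : ‖Complex.exp (-F z)‖ ≤ 1 := by
      refine Complex.norm_le_of_forall_mem_frontier_norm_le (U := Metric.ball (0:ℂ) 1) Metric.isBounded_ball 
        (f := fun z => Complex.exp (-F z)) (Differentiable.diffContOnCl (by fun_prop)) ?_ ?_
      · intro w hw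
        rw [frontier_ball _ (by norm_num), mem_sphere_zero_iff_norm] at hw
        obtain ⟨θ, hθ⟩ : ∃ θ : ℝ, circleMap 0 1 θ = w := by
          refine ⟨w.arg, ?_⟩
          have := Complex.norm_mul_exp_arg_mul_I w
          rw [hw] at this
          simpa [circleMap] using this
        rw [Complex.norm_exp, Real.exp_le_one_iff, Complex.neg_re, ← hθ]
        linarith [hre θ]
      · rwa [closure_ball _ (by norm_num)]
    rw [Complex.norm_exp, Real.exp_le_one_iff, Complex.neg_re] at h1
    linarith
  let Fe : ℂ → ℂ := fun z => F z + (1/10 : ℝ)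
  let H : ℂ → ℂ := fun z => Fe z * Complex.log (Fe z)
  have hFe : ∀ z, (Fe z).re = (F z).re + 1/10 := fun z => by simp [Fe]
  have hFeim : ∀ z, (Fe z).im = (F z).im := fun z => by simp only [Fe, Complex.add_im, Complex.ofReal_im, add_zero]
  have hFed : Differentiable ℂ Fe := by fun_prop
  have hHd : ∀ z ∈ Metric.closedBall (0:ℂ) 1, DifferentiableAt ℂ H z := by
    intro z hz
    refine (hFed z).mul ((hFed z).clog ?_)
    left; rw [hFe]; linarith [hdisc z hz]
  have havg : Real.circleAverage H 0 1 = H 0 := by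
    apply DiffContOnCl.circleAverage
    rw [abs_one]
    refine DifferentiableOn.diffContOnCl ?_
    rw [closure_ball _ (by norm_num)]
    exact fun z hz => (hHd z hz).differentiableWithinAt
  have hcm : ∀ θ : ℝ, circleMap (0:ℂ) 1 θ ∈ Metric.closedBall (0:ℂ) 1 := fun θ => circleMap_mem_closedBall _ zero_le_one _
  have hHc : Continuous (fun θ : ℝ => H (circleMap 0 1 θ)) := by
    rw [continuous_iff_continuousAt]
    intro θ
    exact ContinuousAt.comp (f := fun θ : ℝ => circleMap 0 1 θ) (hHd _ (hcm θ)).continuousAt (continuous_circleMap 0 1).continuousAt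
  have hIntg : ∫ θ in (0:ℝ)..(2 * Real.pi), (H (circleMap 0 1 θ)).re = 2 * Real.pi * (H 0).re := by
    have h1 : ∫ θ in (0:ℝ)..(2 * Real.pi), H (circleMap 0 1 θ) = (2 * Real.pi : ℝ) * H 0 := by
      rw [← havg, Real.circleAverage]
      rw [Complex.real_smul, ← mul_assoc, ← Complex.ofReal_mul, mul_inv_cancel₀ (by positivity)]; simp
    have h2 := congrArg Complex.re h1
    rw [Complex.re_ofReal_mul] at h2
    rw [← h2]
    have := Complex.reCLM.intervalIntegral_comp_comm (hHc.intervalIntegrable (μ := volume) 0 (2 * Real.pi))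
    simpa using this
  have hH0 : -1 ≤ (H 0).re := by
    have h1 : Fe 0 = (((F 0).re + 1/10 : ℝ) : ℂ) := by
      apply Complex.ext
      · rw [hFe, Complex.ofReal_re]
      · rw [hFeim, Complex.ofReal_im, h0]
    have hp : 0 < (F 0).re + 1/10 := by linarith [hdisc 0 (by simp)]
    simp only [H]
    rw [h1, ← Complex.ofReal_log hp.le, ← Complex.ofReal_mul, Complex.ofReal_re]
    set x := (F 0).re + 1/10
    have := Real.one_sub_inv_le_log_of_pos hp
    have h3 : x * (1 - x⁻¹) ≤ x * Real.log x := by gcongr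
    rw [mul_sub, mul_inv_cancel₀ hp.ne'] at h3
    linarith
  have hpt : ∀ θ : ℝ, |(F (circleMap 0 1 θ)).im| ≤ 2 * q θ + 3 * (F (circleMap 0 1 θ)).re + 3/10 - 2 * (H (circleMap 0 1 θ)).re := by
    intro θ
    set z := circleMap 0 1 θ
    have hp := hdisc z (hcm θ)
    have hn : 0 < ‖Fe z‖ := lt_of_lt_of_le (by rw [hFe]; linarith) (Complex.re_le_norm _)
    have := e1_point ((F z).re + 1/10) (F z).im (q θ) ‖Fe z‖ (Fe z) (by
      apply Complex.ext
      · rw [hFe]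
      · rw [hFeim]) (by linarith) rfl (by
        have := hq θ ‖Fe z‖ hn
        ring_nf at this ⊢; linarith)
    linarith
  have hFc : Continuous (fun θ : ℝ => F (circleMap 0 1 θ)) := hF.continuous.comp (continuous_circleMap 0 1)
  have i1 : IntervalIntegrable (fun θ : ℝ => (F (circleMap 0 1 θ)).re) volume 0 (2 * Real.pi) :=
    (Complex.continuous_re.comp hFc).intervalIntegrable _ _
  have i2 : IntervalIntegrable (fun θ : ℝ => (H (circleMap 0 1 θ)).re) volume 0 (2 * Real.pi) :=
    (Complex.continuous_re.comp hHc).intervalIntegrable _ _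
  have i3 : IntervalIntegrable (fun θ : ℝ => |(F (circleMap 0 1 θ)).im|) volume 0 (2 * Real.pi) :=
    ((Complex.continuous_im.comp hFc).abs).intervalIntegrable _ _
  have hm := intervalIntegral.integral_mono_on (a := 0) (b := 2 * Real.pi) (by positivity) i3
    ((((hqi.const_mul 2).add (i1.const_mul 3)).add (intervalIntegrable_const (c := 3/10))).sub (i2.const_mul 2))
    (fun θ _ => hpt θ)
  refine hm.trans ?_
  rw [intervalIntegral.integral_sub (((hqi.const_mul 2).add (i1.const_mul 3)).add (intervalIntegrable_const (c := 3/10))) (i2.const_mul 2),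
    intervalIntegral.integral_add ((hqi.const_mul 2).add (i1.const_mul 3)) (intervalIntegrable_const (c := 3/10)),
    intervalIntegral.integral_add (hqi.const_mul 2) (i1.const_mul 3), intervalIntegral.integral_const_mul,
    intervalIntegral.integral_const_mul, intervalIntegral.integral_const_mul, intervalIntegral.integral_const, hIntg]
  have hp1 := Real.pi_lt_d2
  have hp2 := Real.pi_pos
  simp only [smul_eq_mul, sub_zero]
  nlinarith

def Var (X : ℕ → ℂ) (a N : ℕ) : ℝ := ∑ k ∈ Finset.range N, ‖X (a + k) - (∑ j ∈ Finset.range N, X (a + j)) / N‖ ^ 2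

lemma Var_le (X : ℕ → ℂ) (a N : ℕ) (hN : 0 < N) (c : ℂ) :
    Var X a N ≤ 4 * ∑ k ∈ Finset.range N, ‖X (a + k) - c‖ ^ 2 := by
  have hN' : (0:ℝ) < N := by exact_mod_cast hN
  set M := (∑ j ∈ Finset.range N, X (a + j)) / N with hM
  have hNc : (N:ℂ) ≠ 0 := by exact_mod_cast hN.ne'
  have h1 : ‖M - c‖ ^ 2 * N ≤ ∑ k ∈ Finset.range N, ‖X (a + k) - c‖ ^ 2 := by
    have e : M - c = (∑ j ∈ Finset.range N, (X (a + j) - c)) / N := by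
      rw [hM, Finset.sum_sub_distrib, Finset.sum_const, Finset.card_range, sub_div, nsmul_eq_mul, mul_div_cancel_left₀ _ hNc]
    have h2 : ‖M - c‖ ≤ (∑ j ∈ Finset.range N, ‖X (a + j) - c‖) / N := by
      rw [e, norm_div, Complex.norm_natCast]
      gcongr
      exact norm_sum_le _ _
    have h3 := sq_sum_le_card_mul_sum_sq (s := Finset.range N) (f := fun j => ‖X (a + j) - c‖)
    rw [Finset.card_range] at h3
    calc ‖M - c‖ ^ 2 * N ≤ ((∑ j ∈ Finset.range N, ‖X (a + j) - c‖) / N) ^ 2 * N := by gcongr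
      _ = (∑ j ∈ Finset.range N, ‖X (a + j) - c‖) ^ 2 / N := by field_simp
      _ ≤ _ := by rw [div_le_iff₀ hN']; linarith
  have h4 : ∀ k, ‖X (a + k) - M‖ ^ 2 ≤ 2 * ‖X (a + k) - c‖ ^ 2 + 2 * ‖M - c‖ ^ 2 := by
    intro k
    have : ‖X (a + k) - M‖ ≤ ‖X (a + k) - c‖ + ‖M - c‖ := by
      have := norm_sub_le (X (a + k) - c) (M - c)
      rwa [sub_sub_sub_cancel_right] at this
    nlinarith [norm_nonneg (X (a + k) - M), sq_nonneg (‖X (a + k) - c‖ - ‖M - c‖)]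
  calc Var X a N ≤ ∑ k ∈ Finset.range N, (2 * ‖X (a + k) - c‖ ^ 2 + 2 * ‖M - c‖ ^ 2) :=
        Finset.sum_le_sum fun k _ => h4 k
    _ = 2 * ∑ k ∈ Finset.range N, ‖X (a + k) - c‖ ^ 2 + 2 * (‖M - c‖ ^ 2 * N) := by
        rw [Finset.sum_add_distrib, ← Finset.mul_sum, Finset.sum_const, Finset.card_range, nsmul_eq_mul]; ring
    _ ≤ _ := by linarith

def Box2 : Set (ℝ × ℝ) := Icc (-(2 * Real.pi)) (2 * Real.pi) ×ˢ Icc (-(2 * Real.pi)) (2 * Real.pi)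

def VBad (T : ℕ → ℝ × ℝ → ℂ) (lam : ℝ) : Set (ℝ × ℝ) :=
  {z | z ∈ Ico (-Real.pi) Real.pi ×ˢ Ico (-Real.pi) Real.pi ∧ ∃ a N : ℕ, 0 < N ∧ 4000000 * lam ^ 2 * N < Var (fun n => T n z) a N}

lemma VBad_meas (T : ℕ → ℝ × ℝ → ℂ) (hT : ∀ n, Continuous (T n)) (lam : ℝ) : MeasurableSet (VBad T lam) := by
  have : VBad T lam = (Ico (-Real.pi) Real.pi ×ˢ Ico (-Real.pi) Real.pi) ∩ 
      ⋃ a : ℕ, ⋃ N : ℕ, ⋃ _ : 0 < N, {z | 4000000 * lam ^ 2 * N < Var (fun n => T n z) a N} := by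
    ext z; simp only [VBad, mem_ofPred_eq, mem_inter_iff, mem_iUnion, exists_prop]
  rw [this]
  refine (measurableSet_Ico.prod measurableSet_Ico).inter (MeasurableSet.iUnion fun a => MeasurableSet.iUnion fun N => MeasurableSet.iUnion fun _ => ?_)
  apply IsOpen.measurableSet
  refine isOpen_lt continuous_const ?_
  unfold Var
  fun_prop

lemma dirx (g : ℝ × ℝ → ℂ) (hg : Continuous g) (T : ℕ → ℝ × ℝ → ℂ) (hT : ∀ n, Continuous (T n))
    (hTg : ∀ n z, T n z = ∫ u in Ioc (z.1 - Real.pi) (z.1 + Real.pi), g (u, z.2) * (Dt n (z.1 - u) : ℂ))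
    (lam : ℝ) (hl : 0 < lam) :
    ENNReal.ofReal lam * volume (VBad T lam) ≤ 21 * ∫⁻ z in Box2, ‖g z‖ₑ := by
  have hpi := Real.pi_pos
  have hBox : MeasurableSet Box2 := measurableSet_Icc.prod measurableSet_Icc
  let G2 : ℝ × ℝ → ENNReal := Box2.indicator (fun z => ‖g z‖ₑ)
  have hG2 : Measurable G2 := (by fun_prop : Measurable fun z => ‖g z‖ₑ).indicator hBox
  have hm := VBad_meas T hT lam
  have h1 : volume (VBad T lam) = ∫⁻ y, volume ((fun x => (x, y)) ⁻¹' VBad T lam) := by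
    rw [Measure.volume_eq_prod, Measure.prod_apply_symm hm]
  have h2 : ∀ y, ENNReal.ofReal lam * volume ((fun x => (x, y)) ⁻¹' VBad T lam) ≤ 21 * ∫⁻ x, G2 (x, y) := by
    intro y
    by_cases hy : y ∈ Ico (-Real.pi) Real.pi
    · have hGy : Measurable fun x => G2 (x, y) := hG2.comp (by fun_prop)
      refine le_trans (mul_le_mul' le_rfl (measure_mono ?_)) (bad_meas (fun x => G2 (x, y)) hGy (ENNReal.ofReal lam))
      intro x hx
      have hx' : (x, y) ∈ VBad T lam := hx
      obtain ⟨⟨hx1, hx2⟩, a, N, hN, hV⟩ := hx'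
      by_contra hcon
      have hcon' : ¬ (x ∈ badE (fun x => G2 (x, y)) (ENNReal.ofReal lam) ∨ ENNReal.ofReal lam < marI (fun x => G2 (x, y)) (ENNReal.ofReal lam) x) := hcon
      push Not at hcon'
      obtain ⟨c, hc⟩ := local1D hGy hl hcon'.1 hcon'.2 N hN (fun u => g (u, y)) (by fun_prop) (by
        intro u hu
        have : (u, y) ∈ Box2 := by
          rw [abs_le] at hu
          refine ⟨⟨?_, ?_⟩, ⟨?_, ?_⟩⟩
          · have := hx1.1; simp only at this ⊢; linarith
          · have := hx1.2; simp only at this ⊢; linarith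
          · have := hy.1; simp only at this ⊢; linarith
          · have := hy.2; simp only at this ⊢; linarith
        simp only [G2, indicator_of_mem this]; exact le_rfl) a
      have h3 := Var_le (fun n => T n (x, y)) a N hN c
      simp only [hTg] at h3
      simp only [hTg] at hV
      linarith
    · have : (fun x => (x, y)) ⁻¹' VBad T lam = ∅ := by
        ext x
        simp only [mem_preimage, mem_empty_iff_false, iff_false]
        intro h
        exact hy h.1.2
      rw [this]; simp
  rw [h1, ← lintegral_const_mul' _ _ ENNReal.ofReal_ne_top]
  refine (lintegral_mono h2).trans (le_of_eq ?_)
  rw [lintegral_const_mul' _ _ (by norm_num), ← lintegral_indicator hBox, Measure.volume_eq_prod, lintegral_prod_symm' _ hG2]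

lemma diry (g : ℝ × ℝ → ℂ) (hg : Continuous g) (T : ℕ → ℝ × ℝ → ℂ) (hT : ∀ n, Continuous (T n))
    (hTg : ∀ n z, T n z = ∫ u in Ioc (z.2 - Real.pi) (z.2 + Real.pi), g (z.1, u) * (Dt n (z.2 - u) : ℂ))
    (lam : ℝ) (hl : 0 < lam) :
    ENNReal.ofReal lam * volume (VBad T lam) ≤ 21 * ∫⁻ z in Box2, ‖g z‖ₑ := by
  have h := dirx (fun z => g z.swap) (hg.comp continuous_swap) (fun n z => T n z.swap) (fun n => (hT n).comp continuous_swap)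
    (fun n z => hTg n z.swap) lam hl
  have mp : MeasurePreserving (Prod.swap : ℝ × ℝ → ℝ × ℝ) volume volume := by
    rw [Measure.volume_eq_prod]; exact Measure.measurePreserving_swap
  have e1 : VBad (fun n z => T n z.swap) lam = Prod.swap ⁻¹' VBad T lam := by
    ext z
    simp only [VBad, mem_ofPred_eq, mem_preimage, mem_prod, Prod.fst_swap, Prod.snd_swap]
    rw [and_comm (a := z.1 ∈ _)]
  have e2 : Box2 = Prod.swap ⁻¹' Box2 := by
    unfold Box2
    rw [preimage_swap_prod]
  rw [e1, mp.measure_preimage (VBad_meas T hT lam).nullMeasurableSet] at h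
  have e3 : ∫⁻ z in Box2, ‖g z.swap‖ₑ = ∫⁻ z in Box2, ‖g z‖ₑ := by
    conv_lhs => rw [e2]
    exact mp.setLIntegral_comp_preimage (measurableSet_Icc.prod measurableSet_Icc) (by fun_prop : Measurable fun z => ‖g z‖ₑ)
  rw [e3] at h
  exact h

lemma chr_zero (t : ℝ) : chr 0 t = 1 := by simp [chr]

lemma chr_sub_arg (k : ℤ) (x u : ℝ) : chr k (x - u) = chr k x * chr (-k) u := by
  unfold chr
  rw [← Complex.exp_add]; congr 1; push_cast; ring

lemma chr_eval (k : ℤ) (t : ℝ) : chr k t = Complex.cos (k * t) + Complex.sin (k * t) * Complex.I := by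
  unfold chr
  rw [mul_comm, Complex.exp_mul_I]; push_cast; rfl

lemma chr_per (k : ℤ) (t : ℝ) : chr k (t + 2 * Real.pi) = chr k t := by
  unfold chr
  have : Complex.I * ((k * (t + 2 * Real.pi) : ℝ) : ℂ) = Complex.I * ((k * t : ℝ) : ℂ) + k * (2 * Real.pi * Complex.I) := by
    push_cast; ring
  rw [this, Complex.exp_add, Complex.exp_int_mul_two_pi_mul_I, mul_one]

lemma int_chr (m : ℤ) (x : ℝ) : ∫ u in (x - Real.pi)..(x + Real.pi), chr m u = if m = 0 then ((2 * Real.pi : ℝ) : ℂ) else 0 := by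
  split_ifs with h
  · subst h
    simp only [chr_zero]
    rw [intervalIntegral.integral_const]
    rw [show x + Real.pi - (x - Real.pi) = 2 * Real.pi by ring]
    simp
  · have h1 : ∀ u : ℝ, chr m u = Complex.exp ((Complex.I * m) * u) := by
      intro u; unfold chr; congr 1; push_cast; ring
    simp only [h1]
    have hne : Complex.I * (m:ℂ) ≠ 0 := mul_ne_zero Complex.I_ne_zero (by exact_mod_cast h)
    rw [integral_exp_mul_complex hne]
    rw [← h1, ← h1, show x + Real.pi = (x - Real.pi) + 2 * Real.pi by ring, chr_per, sub_self, zero_div]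

lemma int_chr_mul (m j : ℤ) (x : ℝ) : ∫ u in (x - Real.pi)..(x + Real.pi), chr m u * chr j (x - u) =
    if m = j then 2 * Real.pi * chr m x else 0 := by
  have : ∀ u, chr m u * chr j (x - u) = chr j x * chr (m - j) u := by
    intro u
    rw [chr_sub_arg, sub_eq_add_neg, chr_add]; ring
  simp only [this]
  rw [intervalIntegral.integral_const_mul, int_chr]
  by_cases h : m = j
  · subst h; simp; ring
  · rw [if_neg (sub_ne_zero.2 h), if_neg h, mul_zero]

def sI (n : ℕ) (m : ℤ) : ℤ := if |m| ≤ n then m.sign else 0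
def iI (n : ℕ) (m : ℤ) : ℤ := if |m| ≤ n then 1 else 0

lemma sI_sum (n : ℕ) (m : ℤ) : sI n m = ∑ j ∈ Finset.range n, ((if m = (j:ℤ) + 1 then 1 else 0) - (if m = -((j:ℤ) + 1) then 1 else 0)) := by
  induction n with
  | zero =>
    simp only [sI, Finset.range_zero, Finset.sum_empty]
    split_ifs with h
    · have : m = 0 := by simpa using h
      simp [this]
    · rfl
  | succ n ih =>
    rw [Finset.sum_range_succ, ← ih]
    unfold sI
    rcases lt_trichotomy m 0 with h | h | h
    · rw [Int.sign_eq_neg_one_of_neg h, abs_of_neg h]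
      split_ifs <;> push_cast at * <;> omega
    · subst h
      split_ifs <;> push_cast at * <;> simp at * <;> omega
    · rw [Int.sign_eq_one_of_pos h, abs_of_pos h]
      split_ifs <;> push_cast at * <;> omega

lemma iI_sum (n : ℕ) (m : ℤ) : iI n m = (if m = 0 then 1 else 0) + ∑ j ∈ Finset.range n, ((if m = (j:ℤ) + 1 then 1 else 0) + (if m = -((j:ℤ) + 1) then 1 else 0)) := by
  induction n with
  | zero =>
    simp only [iI, Finset.range_zero, Finset.sum_empty, add_zero, Nat.cast_zero]
    rcases eq_or_ne m 0 with h | h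
    · simp [h]
    · rw [if_neg h, if_neg]; simpa using h
  | succ n ih =>
    rw [Finset.sum_range_succ, ← add_assoc, ← ih]
    unfold iI
    rcases lt_trichotomy m 0 with h | h | h
    · rw [abs_of_neg h]
      split_ifs <;> push_cast at * <;> omega
    · subst h
      split_ifs <;> push_cast at * <;> simp at * <;> omega
    · rw [abs_of_pos h]
      split_ifs <;> push_cast at * <;> omega

lemma sq_ident (n : ℕ) (m k : ℤ) : 2 * (iI n m * iI n k) = 2 * (if m = 0 ∧ k = 0 then 1 else 0) +
    ((m + k).sign * (sI n m + sI n k) + (m - k).sign * (sI n m - sI n k)) := by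
  unfold iI sI
  have key : ∀ a : ℤ, (a < 0 ∧ a.sign = -1) ∨ (a = 0 ∧ a.sign = 0) ∨ (0 < a ∧ a.sign = 1) := by
    intro a
    rcases lt_trichotomy a 0 with h | h | h
    · exact Or.inl ⟨h, Int.sign_eq_neg_one_of_neg h⟩
    · exact Or.inr (Or.inl ⟨h, by simp [h]⟩)
    · exact Or.inr (Or.inr ⟨h, Int.sign_eq_one_of_pos h⟩)
  have ka : ∀ a : ℤ, (a < 0 ∧ |a| = -a) ∨ (0 ≤ a ∧ |a| = a) := by
    intro a
    rcases lt_or_ge a 0 with h | h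
    · exact Or.inl ⟨h, abs_of_neg h⟩
    · exact Or.inr ⟨h, abs_of_nonneg h⟩
  have h1 := key m
  have h2 := key k
  have h3 := key (m + k)
  have h4 := key (m - k)
  have h5 := ka m
  have h6 := ka k
  generalize m.sign = sm at *
  generalize k.sign = sk at *
  generalize (m + k).sign = sp at *
  generalize (m - k).sign = sd at *
  generalize |m| = am at *
  generalize |k| = ak at *
  rcases h3 with ⟨h3, rfl⟩ | ⟨h3, rfl⟩ | ⟨h3, rfl⟩ <;> rcases h4 with ⟨h4, rfl⟩ | ⟨h4, rfl⟩ | ⟨h4, rfl⟩ <;>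
    split_ifs <;> omega

lemma two_sin_chr (j : ℕ) (v : ℝ) : ((2 * Real.sin ((j + 1) * v) : ℝ) : ℂ) = -Complex.I * (chr ((j:ℤ) + 1) v - chr (-((j:ℤ) + 1)) v) := by
  rw [chr_eval, chr_eval]
  push_cast
  rw [show (-((j:ℂ) + 1) * v) = -(((j:ℂ) + 1) * v) by ring, Complex.cos_neg, Complex.sin_neg]
  ring_nf
  rw [Complex.I_sq]; ring

lemma two_cos_chr (j : ℕ) (v : ℝ) : ((2 * Real.cos ((j + 1) * v) : ℝ) : ℂ) = chr ((j:ℤ) + 1) v + chr (-((j:ℤ) + 1)) v := by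
  rw [chr_eval, chr_eval]
  push_cast
  rw [show (-((j:ℂ) + 1) * v) = -(((j:ℂ) + 1) * v) by ring, Complex.cos_neg, Complex.sin_neg]
  ring_nf

lemma int_chr_Dt (n : ℕ) (m : ℤ) (x : ℝ) : ∫ u in (x - Real.pi)..(x + Real.pi), chr m u * (Dt n (x - u) : ℂ) =
    (-Complex.I * (2 * Real.pi) * sI n m) * chr m x := by
  have hc := chr_cont
  have h1 : ∀ u, chr m u * (Dt n (x - u) : ℂ) = ∑ j ∈ Finset.range n, (-Complex.I * (chr m u * chr ((j:ℤ) + 1) (x - u)) -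
      (-Complex.I * (chr m u * chr (-((j:ℤ) + 1)) (x - u)))) := by
    intro u
    unfold Dt
    rw [Complex.ofReal_sum, Finset.mul_sum]
    refine Finset.sum_congr rfl fun j _ => ?_
    rw [two_sin_chr]; ring
  have hci : ∀ j : ℤ, IntervalIntegrable (fun u => -Complex.I * (chr m u * chr j (x - u))) volume (x - Real.pi) (x + Real.pi) := by
    intro j
    apply Continuous.intervalIntegrable
    exact continuous_const.mul ((hc m).mul ((hc j).comp (by fun_prop)))
  simp only [h1]
  rw [intervalIntegral.integral_finset_sum (fun j _ => (hci _).sub (hci _)), sI_sum]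
  push_cast
  rw [Finset.mul_sum, Finset.sum_mul]
  refine Finset.sum_congr rfl fun j _ => ?_
  rw [intervalIntegral.integral_sub (hci _) (hci _), intervalIntegral.integral_const_mul, intervalIntegral.integral_const_mul,
    int_chr_mul, int_chr_mul]
  split_ifs <;> ring

lemma int_chr_Dk (n : ℕ) (m : ℤ) (x : ℝ) : ∫ u in (x - Real.pi)..(x + Real.pi), chr m u * (Dk n (x - u) : ℂ) =
    (2 * Real.pi * iI n m) * chr m x := by
  have hc := chr_cont
  have h1 : ∀ u, chr m u * (Dk n (x - u) : ℂ) = chr m u * chr 0 (x - u) + ∑ j ∈ Finset.range n, ((chr m u * chr ((j:ℤ) + 1) (x - u)) +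
      ((chr m u * chr (-((j:ℤ) + 1)) (x - u)))) := by
    intro u
    unfold Dk
    rw [Complex.ofReal_add, Complex.ofReal_sum, mul_add, Finset.mul_sum, chr_zero, Complex.ofReal_one]
    congr 1
    refine Finset.sum_congr rfl fun j _ => ?_
    rw [two_cos_chr]; ring
  have hci : ∀ j : ℤ, IntervalIntegrable (fun u => (chr m u * chr j (x - u))) volume (x - Real.pi) (x + Real.pi) := by
    intro j
    apply Continuous.intervalIntegrable
    exact ((hc m).mul ((hc j).comp (by fun_prop)))
  have hcs : IntervalIntegrable (fun u => ∑ j ∈ Finset.range n, ((chr m u * chr ((j:ℤ) + 1) (x - u)) +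
      ((chr m u * chr (-((j:ℤ) + 1)) (x - u))))) volume (x - Real.pi) (x + Real.pi) := by
    apply Continuous.intervalIntegrable
    refine continuous_finset_sum _ fun j _ => ?_
    exact ((hc m).mul ((hc _).comp (by fun_prop))).add ((hc m).mul ((hc _).comp (by fun_prop)))
  simp only [h1]
  rw [intervalIntegral.integral_add (hci 0) hcs, intervalIntegral.integral_finset_sum (fun j _ => (hci _).add (hci _)), iI_sum, int_chr_mul]
  push_cast
  rw [mul_add, add_mul]
  congr 1
  · split_ifs <;> ring
  rw [Finset.mul_sum, Finset.sum_mul]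
  refine Finset.sum_congr rfl fun j _ => ?_
  rw [intervalIntegral.integral_add (hci _) (hci _), 
    int_chr_mul, int_chr_mul]
  split_ifs <;> ring

def tp (S : Finset (ℤ × ℤ)) (A : ℤ × ℤ → ℂ) (z : ℝ × ℝ) : ℂ := ∑ a ∈ S, A a * (chr a.1 z.1 * chr a.2 z.2)

lemma tp_cont (S A) : Continuous (tp S A) := by
  unfold tp
  refine continuous_finset_sum _ fun a _ => ?_
  exact continuous_const.mul (((chr_cont _).comp continuous_fst).mul ((chr_cont _).comp continuous_snd))

lemma tp_per1 (S A) (x y : ℝ) : tp S A (x + 2 * Real.pi, y) = tp S A (x, y) := by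
  unfold tp; simp only [chr_per]
lemma tp_per2 (S A) (x y : ℝ) : tp S A (x, y + 2 * Real.pi) = tp S A (x, y) := by
  unfold tp; simp only [chr_per]

lemma Tx_eq (S A) (n : ℕ) (z : ℝ × ℝ) : tp S (fun a => -Complex.I * (2 * Real.pi) * sI n a.1 * A a) z =
    ∫ u in Ioc (z.1 - Real.pi) (z.1 + Real.pi), tp S A (u, z.2) * (Dt n (z.1 - u) : ℂ) := by
  rw [← intervalIntegral.integral_of_le (by linarith [Real.pi_pos])]
  have h : ∀ u, tp S A (u, z.2) * (Dt n (z.1 - u) : ℂ) = ∑ a ∈ S, (A a * chr a.2 z.2) * (chr a.1 u * (Dt n (z.1 - u) : ℂ)) := by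
    intro u
    unfold tp
    rw [Finset.sum_mul]
    exact Finset.sum_congr rfl fun a _ => by ring
  simp only [h]
  rw [intervalIntegral.integral_finset_sum]
  · simp only [intervalIntegral.integral_const_mul, int_chr_Dt]
    unfold tp
    exact Finset.sum_congr rfl fun a _ => by ring
  · intro a _
    apply Continuous.intervalIntegrable
    have := chr_cont a.1
    have := Dt_cont n
    fun_prop

lemma Ty_eq (S A) (n : ℕ) (z : ℝ × ℝ) : tp S (fun a => -Complex.I * (2 * Real.pi) * sI n a.2 * A a) z =
    ∫ u in Ioc (z.2 - Real.pi) (z.2 + Real.pi), tp S A (z.1, u) * (Dt n (z.2 - u) : ℂ) := by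
  rw [← intervalIntegral.integral_of_le (by linarith [Real.pi_pos])]
  have h : ∀ u, tp S A (z.1, u) * (Dt n (z.2 - u) : ℂ) = ∑ a ∈ S, (A a * chr a.1 z.1) * (chr a.2 u * (Dt n (z.2 - u) : ℂ)) := by
    intro u
    unfold tp
    rw [Finset.sum_mul]
    exact Finset.sum_congr rfl fun a _ => by ring
  simp only [h]
  rw [intervalIntegral.integral_finset_sum]
  · simp only [intervalIntegral.integral_const_mul, int_chr_Dt]
    unfold tp
    exact Finset.sum_congr rfl fun a _ => by ring
  · intro a _
    apply Continuous.intervalIntegrable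
    have := chr_cont a.2
    have := Dt_cont n
    fun_prop

def pS (S : Finset (ℤ × ℤ)) (c : ℤ × ℤ → ℂ) (n : ℕ) (z : ℝ × ℝ) : ℂ := tp S (fun a => iI n a.1 * iI n a.2 * c a) z

lemma pS_ker (S c) (k : ℕ) (z : ℝ × ℝ) : (4 * (Real.pi:ℂ) ^ 2) * pS S c k z =
    ∫ w in Ioc (z.1 - Real.pi) (z.1 + Real.pi) ×ˢ Ioc (z.2 - Real.pi) (z.2 + Real.pi),
      tp S c w * ((Dk k (z.1 - w.1) * Dk k (z.2 - w.2) : ℝ) : ℂ) := by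
  have h : ∀ w : ℝ × ℝ, tp S c w * ((Dk k (z.1 - w.1) * Dk k (z.2 - w.2) : ℝ) : ℂ) =
      ∑ a ∈ S, c a * ((chr a.1 w.1 * (Dk k (z.1 - w.1) : ℂ)) * (chr a.2 w.2 * (Dk k (z.2 - w.2) : ℂ))) := by
    intro w
    unfold tp
    rw [Finset.sum_mul]
    refine Finset.sum_congr rfl fun a _ => by push_cast; ring
  simp only [h]
  rw [integral_finset_sum]
  · unfold pS tp
    rw [Finset.mul_sum]
    refine Finset.sum_congr rfl fun a _ => ?_
    rw [integral_const_mul, Measure.volume_eq_prod, 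
      setIntegral_prod_mul (fun u => chr a.1 u * (Dk k (z.1 - u) : ℂ)) (fun u => chr a.2 u * (Dk k (z.2 - u) : ℂ)),
      ← intervalIntegral.integral_of_le (by linarith [Real.pi_pos]), ← intervalIntegral.integral_of_le (by linarith [Real.pi_pos]),
      int_chr_Dk, int_chr_Dk]
    ring
  · intro a _
    have := chr_cont a.1
    have := chr_cont a.2
    have := Dk_cont k
    have hc : Continuous fun w : ℝ × ℝ => c a * ((chr a.1 w.1 * (Dk k (z.1 - w.1) : ℂ)) * (chr a.2 w.2 * (Dk k (z.2 - w.2) : ℂ))) := by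
      fun_prop
    refine (hc.continuousOn.integrableOn_compact (isCompact_Icc.prod isCompact_Icc)).mono_set (prod_mono Ioc_subset_Icc_self Ioc_subset_Icc_self)

lemma pS_mean (S c) (N : ℕ) (z : ℝ × ℝ) : (4 * (Real.pi:ℂ) ^ 2) * ∑ k ∈ Finset.range N, pS S c k z =
    ∫ w in Ioc (z.1 - Real.pi) (z.1 + Real.pi) ×ˢ Ioc (z.2 - Real.pi) (z.2 + Real.pi),
      tp S c w * (KN N (z.1 - w.1) (z.2 - w.2) : ℂ) := by
  rw [Finset.mul_sum]
  simp only [pS_ker]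
  rw [← integral_finset_sum]
  · congr 1; ext w
    unfold KN
    rw [Complex.ofReal_sum, Finset.mul_sum]
  · intro k _
    have := Dk_cont k
    have := tp_cont S c
    have hc : Continuous fun w : ℝ × ℝ => tp S c w * ((Dk k (z.1 - w.1) * Dk k (z.2 - w.2) : ℝ) : ℂ) := by
      fun_prop
    refine (hc.continuousOn.integrableOn_compact (isCompact_Icc.prod isCompact_Icc)).mono_set (prod_mono Ioc_subset_Icc_self Ioc_subset_Icc_self)

lemma pS_mean_le (S c) (N : ℕ) (hN : 0 < N) (z : ℝ × ℝ) (hz : z ∈ Ico (-Real.pi) Real.pi ×ˢ Ico (-Real.pi) Real.pi) (B : ℝ) (hB : 0 ≤ B)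
    (h : ∫⁻ w in Metric.closedBall z Real.pi, (Box2.indicator (fun w => ‖tp S c w‖ₑ) w) * ENNReal.ofReal (|KN N (z.1 - w.1) (z.2 - w.2)| / N) ≤
      ENNReal.ofReal B) : ‖∑ k ∈ Finset.range N, pS S c k z‖ ≤ B * N := by
  have hN' : (0:ℝ) < N := by exact_mod_cast hN
  set Q := Ioc (z.1 - Real.pi) (z.1 + Real.pi) ×ˢ Ioc (z.2 - Real.pi) (z.2 + Real.pi) with hQ
  have hQm : MeasurableSet Q := measurableSet_Ioc.prod measurableSet_Ioc
  have h1 : ‖∫ w in Q, tp S c w * (KN N (z.1 - w.1) (z.2 - w.2) : ℂ)‖ₑ ≤ ENNReal.ofReal (B * N) := by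
    refine (enorm_integral_le_lintegral_enorm _).trans ?_
    have h2 : ∀ w ∈ Q, ‖tp S c w * (KN N (z.1 - w.1) (z.2 - w.2) : ℂ)‖ₑ ≤ 
        ((Box2.indicator (fun w => ‖tp S c w‖ₑ) w) * ENNReal.ofReal (|KN N (z.1 - w.1) (z.2 - w.2)| / N)) * (N:ENNReal) := by
      intro w hw
      have hwB : w ∈ Box2 := by
        obtain ⟨⟨a1, a2⟩, ⟨a3, a4⟩⟩ := hz
        obtain ⟨⟨b1, b2⟩, ⟨b3, b4⟩⟩ := hw
        exact ⟨⟨by linarith, by linarith⟩, ⟨by linarith, by linarith⟩⟩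
      rw [indicator_of_mem hwB, enorm_mul, mul_assoc, ← ENNReal.ofReal_natCast N, ← ENNReal.ofReal_mul (by positivity), div_mul_cancel₀ _ hN'.ne']
      rw [← ofReal_norm_eq_enorm (KN N _ _ : ℂ), Complex.norm_real, Real.norm_eq_abs]
    calc _ ≤ ∫⁻ w in Q, ((Box2.indicator (fun w => ‖tp S c w‖ₑ) w) * ENNReal.ofReal (|KN N (z.1 - w.1) (z.2 - w.2)| / N)) * (N:ENNReal) :=
          setLIntegral_mono' hQm h2
      _ = (∫⁻ w in Q, ((Box2.indicator (fun w => ‖tp S c w‖ₑ) w) * ENNReal.ofReal (|KN N (z.1 - w.1) (z.2 - w.2)| / N))) * (N:ENNReal) :=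
          lintegral_mul_const' _ _ (by simp)
      _ ≤ ENNReal.ofReal B * N := by
          refine mul_le_mul' (le_trans (lintegral_mono_set ?_) h) le_rfl
          intro w hw
          obtain ⟨⟨b1, b2⟩, ⟨b3, b4⟩⟩ := hw
          rw [Metric.mem_closedBall, Prod.dist_eq, max_le_iff, Real.dist_eq, Real.dist_eq, abs_le, abs_le]
          exact ⟨⟨by linarith, by linarith⟩, ⟨by linarith, by linarith⟩⟩
      _ = _ := by rw [ENNReal.ofReal_mul hB, ENNReal.ofReal_natCast]
  rw [← pS_mean, ← ofReal_norm_eq_enorm, ENNReal.ofReal_le_ofReal_iff (by positivity), norm_mul] at h1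
  have h3 : (1:ℝ) ≤ ‖(4 * (Real.pi:ℂ) ^ 2)‖ := by
    rw [norm_mul, norm_pow, Complex.norm_real, Real.norm_eq_abs, abs_of_pos Real.pi_pos]
    have := Real.pi_gt_three
    norm_num; nlinarith
  nlinarith [norm_nonneg (∑ k ∈ Finset.range N, pS S c k z)]

def gS (σ : ℤ) (c : ℤ × ℤ → ℂ) : ℤ × ℤ → ℂ := fun a => (a.1 + σ * a.2).sign * c a
def TX (S) (A : ℤ × ℤ → ℂ) (n : ℕ) := tp S (fun a => -Complex.I * (2 * Real.pi) * sI n a.1 * A a)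
def TY (S) (A : ℤ × ℤ → ℂ) (n : ℕ) := tp S (fun a => -Complex.I * (2 * Real.pi) * sI n a.2 * A a)

lemma pS_decomp (S c) (n : ℕ) (z : ℝ × ℝ) : pS S c n z = tp S (fun a => if a.1 = 0 ∧ a.2 = 0 then c a else 0) z +
    (Complex.I / (4 * Real.pi)) * (TX S (gS 1 c) n z + TY S (gS 1 c) n z + TX S (gS (-1) c) n z - TY S (gS (-1) c) n z) := by
  unfold pS TX TY tp gS
  rw [← Finset.sum_add_distrib, ← Finset.sum_add_distrib, ← Finset.sum_sub_distrib, Finset.mul_sum, ← Finset.sum_add_distrib]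
  refine Finset.sum_congr rfl fun a _ => ?_
  have h := congrArg (fun t : ℤ => (t : ℂ)) (sq_ident n a.1 a.2)
  simp only [one_mul, neg_one_mul, ← sub_eq_add_neg]
  push_cast at h
  have hpi : (Real.pi : ℂ) ≠ 0 := by exact_mod_cast Real.pi_ne_zero
  have h2 : (iI n a.1 * iI n a.2 : ℂ) = (if a.1 = 0 ∧ a.2 = 0 then 1 else 0) + (1/2) * (
    ((a.1 + a.2).sign * (sI n a.1 + sI n a.2) + (a.1 - a.2).sign * (sI n a.1 - sI n a.2))) := by
    linear_combination (1/2) * h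
  rw [h2]
  have h3 : Complex.I / (4 * Real.pi) * (-Complex.I * (2 * Real.pi)) = 1/2 := by
    field_simp; rw [Complex.I_sq]; norm_num
  have h4 : (if a.1 = 0 ∧ a.2 = 0 then c a else 0) = (if a.1 = 0 ∧ a.2 = 0 then (1:ℂ) else 0) * c a := by split_ifs <;> simp
  rw [h4]
  linear_combination (-(c a) * (chr a.1 z.1 * chr a.2 z.2) * (((a.1 + a.2).sign * (sI n a.1 + sI n a.2) + (a.1 - a.2).sign * (sI n a.1 - sI n a.2)))) * h3

lemma Var_pS (S c) (z : ℝ × ℝ) (a N : ℕ) (hN : 0 < N) (B : ℝ) 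
    (h1 : Var (fun n => TX S (gS 1 c) n z) a N ≤ B) (h2 : Var (fun n => TY S (gS 1 c) n z) a N ≤ B)
    (h3 : Var (fun n => TX S (gS (-1) c) n z) a N ≤ B) (h4 : Var (fun n => TY S (gS (-1) c) n z) a N ≤ B) :
    Var (fun n => pS S c n z) a N ≤ 4 * B := by
  have hNc : (N:ℂ) ≠ 0 := by exact_mod_cast hN.ne'
  simp only [pS_decomp]
  set c0 := tp S (fun a => if a.1 = 0 ∧ a.2 = 0 then c a else 0) z
  set X1 : ℕ → ℂ := fun n => TX S (gS 1 c) n z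
  set X2 : ℕ → ℂ := fun n => TY S (gS 1 c) n z
  set X3 : ℕ → ℂ := fun n => TX S (gS (-1) c) n z
  set X4 : ℕ → ℂ := fun n => TY S (gS (-1) c) n z
  set κ := Complex.I / (4 * (Real.pi:ℂ)) with hκ
  have hκn : ‖κ‖ ≤ 1/2 := by
    rw [hκ, norm_div, Complex.norm_I, norm_mul, Complex.norm_real, Real.norm_eq_abs, abs_of_pos Real.pi_pos]
    have := Real.pi_gt_three
    norm_num
    rw [inv_mul_le_iff₀ (by positivity)]; linarith
  unfold Var at *
  have key : ∀ k, ‖(c0 + κ * (X1 (a+k) + X2 (a+k) + X3 (a+k) - X4 (a+k))) - (∑ j ∈ Finset.range N, (c0 + κ * (X1 (a+j) + X2 (a+j) + X3 (a+j) - X4 (a+j)))) / N‖ ^ 2 ≤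
      ‖X1 (a+k) - (∑ j ∈ Finset.range N, X1 (a+j)) / N‖ ^ 2 + ‖X2 (a+k) - (∑ j ∈ Finset.range N, X2 (a+j)) / N‖ ^ 2 +
      ‖X3 (a+k) - (∑ j ∈ Finset.range N, X3 (a+j)) / N‖ ^ 2 + ‖X4 (a+k) - (∑ j ∈ Finset.range N, X4 (a+j)) / N‖ ^ 2 := by
    intro k
    have e : (c0 + κ * (X1 (a+k) + X2 (a+k) + X3 (a+k) - X4 (a+k))) - (∑ j ∈ Finset.range N, (c0 + κ * (X1 (a+j) + X2 (a+j) + X3 (a+j) - X4 (a+j)))) / N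
      = κ * ((X1 (a+k) - (∑ j ∈ Finset.range N, X1 (a+j)) / N) + (X2 (a+k) - (∑ j ∈ Finset.range N, X2 (a+j)) / N)
        + (X3 (a+k) - (∑ j ∈ Finset.range N, X3 (a+j)) / N) - (X4 (a+k) - (∑ j ∈ Finset.range N, X4 (a+j)) / N)) := by
      rw [Finset.sum_add_distrib, ← Finset.mul_sum, Finset.sum_sub_distrib, Finset.sum_add_distrib, Finset.sum_add_distrib,
        Finset.sum_const, Finset.card_range, nsmul_eq_mul]
      field_simp
      ring
    rw [e]
    generalize X1 (a+k) - (∑ j ∈ Finset.range N, X1 (a+j)) / N = y1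
    generalize X2 (a+k) - (∑ j ∈ Finset.range N, X2 (a+j)) / N = y2
    generalize X3 (a+k) - (∑ j ∈ Finset.range N, X3 (a+j)) / N = y3
    generalize X4 (a+k) - (∑ j ∈ Finset.range N, X4 (a+j)) / N = y4
    have hn : ‖y1 + y2 + y3 - y4‖ ≤ ‖y1‖ + ‖y2‖ + ‖y3‖ + ‖y4‖ :=
      (norm_sub_le _ _).trans (add_le_add (norm_add₃_le) le_rfl)
    have hm : ‖κ * (y1 + y2 + y3 - y4)‖ ≤ 1/2 * (‖y1‖ + ‖y2‖ + ‖y3‖ + ‖y4‖) := by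
      rw [norm_mul]; gcongr
    calc _ ≤ (1/2 * (‖y1‖ + ‖y2‖ + ‖y3‖ + ‖y4‖)) ^ 2 := by gcongr
      _ ≤ _ := by
        nlinarith [sq_nonneg (‖y1‖ - ‖y2‖), sq_nonneg (‖y1‖ - ‖y3‖), sq_nonneg (‖y1‖ - ‖y4‖), sq_nonneg (‖y2‖ - ‖y3‖), sq_nonneg (‖y2‖ - ‖y4‖), sq_nonneg (‖y3‖ - ‖y4‖)]
  refine (Finset.sum_le_sum fun k _ => key k).trans ?_
  rw [Finset.sum_add_distrib, Finset.sum_add_distrib, Finset.sum_add_distrib]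
  linarith

def A2 (h : ℝ × ℝ → ℝ) : ℝ := ∫ x in (0:ℝ)..(2 * Real.pi), ∫ y in (0:ℝ)..(2 * Real.pi), h (x, y)

lemma par_cont {h : ℝ × ℝ → ℝ} (hc : Continuous h) (a b : ℝ) : Continuous fun x => ∫ y in a..b, h (x, y) :=
  intervalIntegral.continuous_parametric_intervalIntegral_of_continuous' (f := fun x y => h (x, y)) hc a b

lemma A2_shift (h : ℝ × ℝ → ℝ) (hc : Continuous h) (hp : ∀ x y, h (x, y + 2 * Real.pi) = h (x, y)) (σ : ℝ) :
    ∫ y in (0:ℝ)..(2 * Real.pi), ∫ x in (0:ℝ)..(2 * Real.pi), h (x, y + σ * x) = A2 h := by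
  rw [intervalIntegral_intervalIntegral_swap]
  · unfold A2
    congr 1; ext x
    have hper : Function.Periodic (fun y => h (x, y)) (2 * Real.pi) := fun y => hp x y
    rw [intervalIntegral.integral_comp_add_right (fun y => h (x, y)) (σ * x), add_comm (2 * Real.pi), zero_add,
      hper.intervalIntegral_add_eq (σ * x) 0, zero_add]
  · have : Continuous (Function.uncurry fun y x => h (x, y + σ * x)) := by
      show Continuous fun z : ℝ × ℝ => h (z.2, z.1 + σ * z.2)
      fun_prop
    refine (this.continuousOn.integrableOn_compact (isCompact_uIcc.prod isCompact_uIcc)).mono_set (prod_mono uIoc_subset_uIcc uIoc_subset_uIcc)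

lemma per2 {f : ℝ → ℝ} (hf : Continuous f) (hp : Function.Periodic f (2 * Real.pi)) :
    ∫ x in (-(2 * Real.pi))..(2 * Real.pi), f x = 2 * ∫ x in (0:ℝ)..(2 * Real.pi), f x := by
  have h := hp.intervalIntegral_add_zsmul_eq 2 (-(2 * Real.pi)) (fun a b => hf.intervalIntegrable a b)
  rw [hp.intervalIntegral_add_eq _ 0, zero_add] at h
  rw [show (2 * Real.pi) = -(2 * Real.pi) + (2:ℤ) • (2 * Real.pi) by simp; ring] 
  simp only [zsmul_eq_mul] at h ⊢
  push_cast at h ⊢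
  rw [show -(2 * Real.pi) + 2 * (2 * Real.pi) = 2 * Real.pi by ring] at h ⊢
  exact h

lemma Box_int (h : ℝ × ℝ → ℝ) (hc : Continuous h) (h0 : ∀ z, 0 ≤ h z) (hp1 : ∀ x y, h (x + 2 * Real.pi, y) = h (x, y))
    (hp : ∀ x y, h (x, y + 2 * Real.pi) = h (x, y)) : ∫⁻ z in Box2, ENNReal.ofReal (h z) = ENNReal.ofReal (4 * A2 h) := by
  have hi : IntegrableOn h Box2 volume := hc.continuousOn.integrableOn_compact (isCompact_Icc.prod isCompact_Icc)
  rw [← ofReal_integral_eq_lintegral_ofReal hi (Eventually.of_forall h0)]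
  congr 1
  unfold Box2 at *
  have h2 : -(2 * Real.pi) ≤ 2 * Real.pi := by linarith [Real.pi_pos]
  rw [Measure.volume_eq_prod] at hi ⊢
  rw [setIntegral_prod _ hi]
  simp only [integral_Icc_eq_integral_Ioc, ← intervalIntegral.integral_of_le h2]
  have e1 : ∀ x, ∫ y in (-(2 * Real.pi))..(2 * Real.pi), h (x, y) = 2 * ∫ y in (0:ℝ)..(2 * Real.pi), h (x, y) :=
    fun x => per2 (f := fun y => h (x, y)) (by fun_prop) (fun y => hp x y)
  simp only [e1]
  rw [intervalIntegral.integral_const_mul, per2 (par_cont hc _ _) (fun x => by simp only [hp1])]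
  unfold A2; ring

lemma tp_conj (S : Finset (ℤ × ℤ)) (hS : ∀ a ∈ S, -a ∈ S) (A : ℤ × ℤ → ℂ) (z : ℝ × ℝ) :
    (starRingEnd ℂ) (tp S A z) = tp S (fun a => (starRingEnd ℂ) (A (-a))) z := by
  unfold tp
  rw [map_sum]
  refine Finset.sum_nbij' (fun a => -a) (fun a => -a) hS hS (fun a _ => neg_neg a) (fun a _ => neg_neg a) ?_
  intro a _
  simp only [map_mul, conj_chr, neg_neg, Prod.fst_neg, Prod.snd_neg]

lemma circ_chr (n : ℕ) (θ : ℝ) : (circleMap 0 1 θ) ^ n = chr (n:ℤ) θ := by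
  unfold chr
  rw [circleMap, Complex.ofReal_one, one_mul, zero_add, ← Complex.exp_nat_mul]
  congr 1; push_cast; ring

lemma slice_bd (S : Finset (ℤ × ℤ)) (hS : ∀ a ∈ S, -a ∈ S) (c : ℤ × ℤ → ℂ) (hcc : ∀ a, c (-a) = (starRingEnd ℂ) (c a))
    (p q : ℝ × ℝ → ℝ) (hp : ∀ z, tp S c z = (p z : ℂ)) (hp0 : ∀ z, 0 ≤ p z) (hq : Continuous q)
    (hpq : ∀ z, ∀ w : ℝ, 0 < w → p z * Real.log w ≤ q z + w * 0.368) (σ : ℤ) (y : ℝ) :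
    ∫ x in (0:ℝ)..(2 * Real.pi), ‖tp S (gS σ c) (x, y + σ * x)‖ ≤
      3 * (∫ x in (0:ℝ)..(2 * Real.pi), p (x, y + σ * x)) + 2 * (∫ x in (0:ℝ)..(2 * Real.pi), q (x, y + σ * x)) + 15 := by
  let d : ℤ × ℤ → ℤ := fun a => a.1 + σ * a.2
  let F : ℂ → ℂ := fun ζ => ∑ a ∈ S, (c a * chr a.2 y * (1 + (d a).sign)) * ζ ^ (d a).toNat
  have hF : Differentiable ℂ F := by fun_prop
  have himg : ∀ z, (tp S (gS σ c) z).re = 0 := by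
    intro z
    have h1 := tp_conj S hS (gS σ c) z
    have h2 : tp S (fun a => (starRingEnd ℂ) (gS σ c (-a))) z = - tp S (gS σ c) z := by
      unfold tp
      rw [← Finset.sum_neg_distrib]
      refine Finset.sum_congr rfl fun a _ => ?_
      unfold gS
      beta_reduce
      rw [hcc, map_mul, Complex.conj_conj, Prod.fst_neg, Prod.snd_neg, show -a.1 + σ * -a.2 = -(a.1 + σ * a.2) by ring, Int.sign_neg]
      simp
    rw [h2] at h1
    have := congrArg Complex.re h1
    rw [Complex.conj_re, Complex.neg_re] at this
    linarith
  have hFc : ∀ θ : ℝ, F (circleMap 0 1 θ) = p (θ, y + σ * θ) + tp S (gS σ c) (θ, y + σ * θ) := by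
    intro θ
    rw [← hp]
    unfold tp
    rw [← Finset.sum_add_distrib]
    refine Finset.sum_congr rfl fun a _ => ?_
    have h1 : chr a.1 θ * chr a.2 (y + σ * θ) = chr a.2 y * chr (d a) θ := by
      unfold chr
      rw [← Complex.exp_add, ← Complex.exp_add]; congr 1; simp only [d]; push_cast; ring
    simp only [h1, gS, circ_chr]
    rcases lt_or_ge (d a) 0 with h | h
    · have : (a.1 + σ * a.2).sign = -1 := Int.sign_eq_neg_one_of_neg h
      simp only [d, this]; push_cast; ring
    · rw [Int.toNat_of_nonneg h]; ring
  have hF0 : (F 0).im = 0 := by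
    have h1 : F 0 = tp S (fun a => if d a = 0 then c a else 0) (0, y) := by
      unfold tp
      refine Finset.sum_congr rfl fun a _ => ?_
      have hch : chr a.1 0 = 1 := by simp [chr]
      simp only [hch, one_mul]
      rcases lt_trichotomy (d a) 0 with h | h | h
      · rw [Int.sign_eq_neg_one_of_neg h, if_neg h.ne]; simp
      · rw [h]; simp
      · rw [if_neg h.ne', zero_pow (by omega)]; simp
    have h2 := tp_conj S hS (fun a => if d a = 0 then c a else 0) (0, y)
    have h3 : (fun a => (starRingEnd ℂ) ((fun a => if d a = 0 then c a else 0) (-a))) = (fun a => if d a = 0 then c a else 0) := by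
      ext a
      have : d (-a) = - d a := by simp only [d, Prod.fst_neg, Prod.snd_neg]; ring
      simp only [this, neg_eq_zero]
      split_ifs
      · rw [hcc, Complex.conj_conj]
      · simp
    rw [h3, ← h1] at h2
    exact Complex.conj_eq_iff_im.1 h2
  have hre : ∀ θ : ℝ, (F (circleMap 0 1 θ)).re = p (θ, y + σ * θ) := by
    intro θ; rw [hFc, Complex.add_re, himg, Complex.ofReal_re, add_zero]
  have him : ∀ θ : ℝ, |(F (circleMap 0 1 θ)).im| = ‖tp S (gS σ c) (θ, y + σ * θ)‖ := by
    intro θ; rw [hFc, Complex.add_im, Complex.ofReal_im, zero_add]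
    exact (Complex.abs_im_eq_norm.2 (himg _))
  have := analytic_bd F hF hF0 (fun θ => by rw [hre]; exact hp0 _) (fun θ => q (θ, y + σ * θ))
    (Continuous.intervalIntegrable (by fun_prop) _ _) (fun θ w hw => by rw [hre]; exact hpq _ w hw)
  simp only [hre, him] at this
  exact this

lemma g_bd (S : Finset (ℤ × ℤ)) (hS : ∀ a ∈ S, -a ∈ S) (c : ℤ × ℤ → ℂ) (hcc : ∀ a, c (-a) = (starRingEnd ℂ) (c a))
    (p q : ℝ × ℝ → ℝ) (hp : ∀ z, tp S c z = (p z : ℂ)) (hp0 : ∀ z, 0 ≤ p z) (hq : Continuous q)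
    (hqp : ∀ x y, q (x, y + 2 * Real.pi) = q (x, y))
    (hpq : ∀ z, ∀ w : ℝ, 0 < w → p z * Real.log w ≤ q z + w * 0.368) (σ : ℤ) :
    ∫⁻ z in Box2, ‖tp S (gS σ c) z‖ₑ ≤ ENNReal.ofReal (4 * (3 * A2 p + 2 * A2 q + 100)) := by
  have hgc := tp_cont S (gS σ c)
  have hpe : p = fun z => (tp S c z).re := by ext z; rw [hp, Complex.ofReal_re]
  have hpc : Continuous p := by rw [hpe]; exact Complex.continuous_re.comp (tp_cont S c)
  have hpp : ∀ x y, p (x, y + 2 * Real.pi) = p (x, y) := by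
    intro x y; rw [hpe]; simp only [tp_per2]
  have h1 := Box_int (fun z => ‖tp S (gS σ c) z‖) hgc.norm (fun z => norm_nonneg _) (fun x y => by simp only [tp_per1]) (fun x y => by simp only [tp_per2])
  simp only [ofReal_norm_eq_enorm] at h1
  rw [h1]
  apply ENNReal.ofReal_le_ofReal
  gcongr
  rw [← A2_shift _ hgc.norm (fun x y => by simp only [tp_per2]) σ, ← A2_shift p hpc hpp σ, ← A2_shift q hq hqp σ]
  have c1 : Continuous fun y => ∫ x in (0:ℝ)..(2 * Real.pi), ‖tp S (gS σ c) (x, y + σ * x)‖ :=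
    par_cont (h := fun z => ‖tp S (gS σ c) (z.2, z.1 + σ * z.2)‖) (by fun_prop) _ _
  have c2 : Continuous fun y => ∫ x in (0:ℝ)..(2 * Real.pi), p (x, y + σ * x) :=
    par_cont (h := fun z => p (z.2, z.1 + σ * z.2)) (by fun_prop) _ _
  have c3 : Continuous fun y => ∫ x in (0:ℝ)..(2 * Real.pi), q (x, y + σ * x) :=
    par_cont (h := fun z => q (z.2, z.1 + σ * z.2)) (by fun_prop) _ _
  set I1 : ℝ → ℝ := fun y => ∫ x in (0:ℝ)..(2 * Real.pi), p (x, y + σ * x) with hI1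
  set I2 : ℝ → ℝ := fun y => ∫ x in (0:ℝ)..(2 * Real.pi), q (x, y + σ * x) with hI2
  have i1 : IntervalIntegrable (fun y => 3 * I1 y) volume 0 (2 * Real.pi) := Continuous.intervalIntegrable (by fun_prop) _ _
  have i2 : IntervalIntegrable (fun y => 2 * I2 y) volume 0 (2 * Real.pi) := Continuous.intervalIntegrable (by fun_prop) _ _
  have i12 : IntervalIntegrable (fun y => 3 * I1 y + 2 * I2 y) volume 0 (2 * Real.pi) := Continuous.intervalIntegrable (by fun_prop) _ _
  have i3 : IntervalIntegrable (fun y => 3 * I1 y + 2 * I2 y + 15) volume 0 (2 * Real.pi) := Continuous.intervalIntegrable (by fun_prop) _ _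
  have hm := intervalIntegral.integral_mono_on (μ := volume) (a := 0) (b := 2 * Real.pi) (by positivity) (c1.intervalIntegrable _ _)
    i3 (fun y _ => slice_bd S hS c hcc p q hp hp0 hq hpq σ y)
  refine hm.trans ?_
  rw [intervalIntegral.integral_add i12 (continuous_const.intervalIntegrable _ _),
    intervalIntegral.integral_add i1 i2,
    intervalIntegral.integral_const_mul, intervalIntegral.integral_const_mul, intervalIntegral.integral_const]
  have := Real.pi_lt_d2
  simp only [smul_eq_mul, sub_zero]
  linarith

lemma jn_cplx (X : ℕ → ℂ) (L : ℝ) (hL : 0 < L) (hv : ∀ a N : ℕ, 0 < N → Var X a N ≤ L ^ 2 * N)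
    (hm : ∀ N : ℕ, 0 < N → ‖∑ k ∈ Finset.range N, X k‖ ≤ L * N) (n : ℕ) :
    ∑ k ∈ Finset.range (n + 1), Real.exp (|(X k).re| / (16 * L)) ≤ 2 * (n + 1) := by
  have h := jn_final (fun k => (X k).re / L) ?_ ?_ n
  · refine le_trans (le_of_eq ?_) h
    refine Finset.sum_congr rfl fun k _ => ?_
    rw [abs_div, abs_of_pos hL, div_div, mul_comm]
  · intro s m
    have hN : 0 < 2 ^ m := by positivity
    have hNr : (0:ℝ) < 2 ^ m := by positivity
    have h1 := hv s (2 ^ m) hN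
    unfold Var at h1
    set M : ℂ := (∑ j ∈ Finset.range (2 ^ m), X (s + j)) / ((2 ^ m : ℕ) : ℂ) with hM
    have hMre : M.re = (∑ j ∈ Finset.range (2 ^ m), (X (s + j)).re) / 2 ^ m := by
      rw [hM, Complex.div_natCast_re, Complex.re_sum]; push_cast; rfl
    have h2 : ∑ k ∈ Finset.range (2 ^ m), ((X (s + k)).re - M.re) ^ 2 ≤ L ^ 2 * 2 ^ m := by
      refine le_trans (Finset.sum_le_sum fun k _ => ?_) (h1.trans (le_of_eq (by push_cast; rfl)))
      rw [← Complex.sub_re, ← sq_abs]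
      exact pow_le_pow_left₀ (abs_nonneg _) (Complex.abs_re_le_norm _) 2
    have hS : ∑ j ∈ Finset.range (2 ^ m), (X (s + j)).re = M.re * 2 ^ m := by
      rw [hMre]; field_simp
    have h3 : ∑ k ∈ Finset.range (2 ^ m), ((X (s + k)).re - M.re) ^ 2 = 
       ∑ k ∈ Finset.range (2 ^ m), ((X (s + k)).re) ^ 2 - M.re ^ 2 * 2 ^ m := by
      simp only [sub_sq, Finset.sum_add_distrib, Finset.sum_sub_distrib, ← Finset.sum_mul, ← Finset.mul_sum, hS,
        Finset.sum_const, Finset.card_range, nsmul_eq_mul]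
      push_cast; ring
    have h4 : dAvg (fun k => ((X k).re / L) ^ 2) s m = (∑ k ∈ Finset.range (2 ^ m), ((X (s + k)).re) ^ 2) / L ^ 2 / 2 ^ m := by
      unfold dAvg; simp only [div_pow, Finset.sum_div]
    have h5 : dAvg (fun k => (X k).re / L) s m = M.re / L := by
      unfold dAvg; rw [← Finset.sum_div, hS]; field_simp
    rw [h4, h5]
    rw [h3] at h2
    have : ∑ k ∈ Finset.range (2 ^ m), ((X (s + k)).re) ^ 2 ≤ L ^ 2 * 2 ^ m + M.re ^ 2 * 2 ^ m := by linarith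
    have h6 : (∑ k ∈ Finset.range (2 ^ m), ((X (s + k)).re) ^ 2) / L ^ 2 / 2 ^ m ≤ 1 + (M.re / L) ^ 2 := by
      rw [div_div, div_le_iff₀ (by positivity)]
      refine this.trans (le_of_eq ?_)
      field_simp
    linarith
  · intro m
    have h1 := hm (2 ^ m) (by positivity)
    unfold dAvg
    rw [← Finset.sum_div, abs_div, abs_div, abs_of_pos hL, abs_of_pos (by positivity : (0:ℝ) < 2 ^ m), div_div, div_le_one (by positivity)]
    simp only [zero_add]
    rw [← Complex.re_sum]
    refine (Complex.abs_re_le_norm _).trans (h1.trans (le_of_eq ?_))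
    push_cast; rfl

lemma poly_core (S : Finset (ℤ × ℤ)) (hS : ∀ a ∈ S, -a ∈ S) (c : ℤ × ℤ → ℂ) (hcc : ∀ a, c (-a) = (starRingEnd ℂ) (c a))
    (p q : ℝ × ℝ → ℝ) (hp : ∀ z, tp S c z = (p z : ℂ)) (hp0 : ∀ z, 0 ≤ p z) (hq : Continuous q)
    (hqp : ∀ x y, q (x, y + 2 * Real.pi) = q (x, y))
    (hpq : ∀ z, ∀ w : ℝ, 0 < w → p z * Real.log w ≤ q z + w * 0.368) (P Q : ℝ) (hP : A2 p ≤ P) (hQ : A2 q ≤ Q)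
    (lam : ℝ) (hl : 0 < lam) :
    ∃ E : Set (ℝ × ℝ), ENNReal.ofReal lam * volume E ≤ 1150 * ENNReal.ofReal (4 * P) + 84 * ENNReal.ofReal (4 * (3 * P + 2 * Q + 100)) ∧
      ∀ z ∈ Ico (-Real.pi) Real.pi ×ˢ Ico (-Real.pi) Real.pi, z ∉ E → ∀ n : ℕ,
        ∑ k ∈ Finset.range (n + 1), Real.exp (|(pS S c k z).re| / (16 * (5000000 * lam))) ≤ 2 * (n + 1) := by
  have hpe : p = fun z => (tp S c z).re := by ext z; rw [hp, Complex.ofReal_re]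
  have hpc : Continuous p := by rw [hpe]; exact Complex.continuous_re.comp (tp_cont S c)
  have hB : MeasurableSet Box2 := measurableSet_Icc.prod measurableSet_Icc
  obtain ⟨E0, hE0, hz0⟩ := meanmax (Box2.indicator (fun w => ‖tp S c w‖ₑ)) 
    ((by have := (tp_cont S c).measurable; fun_prop : Measurable fun w => ‖tp S c w‖ₑ).indicator hB) lam hl
  have hI : ∫⁻ w, Box2.indicator (fun w => ‖tp S c w‖ₑ) w ≤ ENNReal.ofReal (4 * P) := by
    rw [lintegral_indicator hB]
    have : ∀ w, ‖tp S c w‖ₑ = ENNReal.ofReal (p w) := by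
      intro w; rw [hp, ← ofReal_norm_eq_enorm, Complex.norm_real, Real.norm_of_nonneg (hp0 w)]
    simp only [this]
    rw [Box_int p hpc hp0 (by intro x y; simp only [hpe, tp_per1]) (by intro x y; simp only [hpe, tp_per2])]
    exact ENNReal.ofReal_le_ofReal (by linarith)
  have hg : ∀ σ, ∫⁻ z in Box2, ‖tp S (gS σ c) z‖ₑ ≤ ENNReal.ofReal (4 * (3 * P + 2 * Q + 100)) := fun σ =>
    (g_bd S hS c hcc p q hp hp0 hq hqp hpq σ).trans (ENNReal.ofReal_le_ofReal (by linarith))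
  have hx : ∀ σ, ENNReal.ofReal lam * volume (VBad (TX S (gS σ c)) lam) ≤ 21 * ENNReal.ofReal (4 * (3 * P + 2 * Q + 100)) := fun σ =>
    (dirx (tp S (gS σ c)) (tp_cont _ _) (TX S (gS σ c)) (fun n => tp_cont _ _) (fun n z => Tx_eq _ _ n z) lam hl).trans
      (mul_le_mul' le_rfl (hg σ))
  have hy : ∀ σ, ENNReal.ofReal lam * volume (VBad (TY S (gS σ c)) lam) ≤ 21 * ENNReal.ofReal (4 * (3 * P + 2 * Q + 100)) := fun σ =>
    (diry (tp S (gS σ c)) (tp_cont _ _) (TY S (gS σ c)) (fun n => tp_cont _ _) (fun n z => Ty_eq _ _ n z) lam hl).trans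
      (mul_le_mul' le_rfl (hg σ))
  refine ⟨E0 ∪ ((VBad (TX S (gS 1 c)) lam ∪ VBad (TY S (gS 1 c)) lam) ∪ (VBad (TX S (gS (-1) c)) lam ∪ VBad (TY S (gS (-1) c)) lam)), ?_, ?_⟩
  · have e : (84:ENNReal) * ENNReal.ofReal (4 * (3 * P + 2 * Q + 100)) = (21 * ENNReal.ofReal (4 * (3 * P + 2 * Q + 100)) + 21 * ENNReal.ofReal (4 * (3 * P + 2 * Q + 100)))
       + (21 * ENNReal.ofReal (4 * (3 * P + 2 * Q + 100)) + 21 * ENNReal.ofReal (4 * (3 * P + 2 * Q + 100))) := by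
      rw [← add_mul, ← add_mul]; norm_num
    rw [e]
    refine (mul_le_mul' le_rfl ((measure_union_le _ _).trans (add_le_add le_rfl ((measure_union_le _ _).trans (add_le_add (measure_union_le _ _) (measure_union_le _ _)))))).trans ?_
    rw [mul_add, mul_add, mul_add, mul_add]
    exact add_le_add (hE0.trans (mul_le_mul' le_rfl hI)) (add_le_add (add_le_add (hx _) (hy _)) (add_le_add (hx _) (hy _)))
  · intro z hz hzE n
    simp only [mem_union, not_or] at hzE
    obtain ⟨hn0, ⟨hn1, hn2⟩, hn3, hn4⟩ := hzE
    have hV : ∀ T : ℕ → ℝ × ℝ → ℂ, z ∉ VBad T lam → ∀ a N : ℕ, 0 < N → Var (fun n => T n z) a N ≤ 4000000 * lam ^ 2 * N := by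
      intro T hT a N hN
      by_contra hc
      push Not at hc
      exact hT ⟨hz, a, N, hN, hc⟩
    refine jn_cplx (fun k => pS S c k z) (5000000 * lam) (by positivity) ?_ ?_ n
    · intro a N hN
      refine (Var_pS S c z a N hN _ (hV _ hn1 a N hN) (hV _ hn2 a N hN) (hV _ hn3 a N hN) (hV _ hn4 a N hN)).trans ?_
      have : 0 ≤ lam ^ 2 * N := by positivity
      nlinarith
    · intro N hN
      exact pS_mean_le S c N hN z hz _ (by positivity) (hz0 z hn0 N hN)

def wF (N : ℕ) (m : ℤ) : ℝ := 1 - |(m:ℝ)| / (N + 1)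
def FN (N : ℕ) (u : ℝ) : ℝ := Complex.normSq (∑ j ∈ Finset.range (N + 1), chr j u) / (N + 1)

lemma Icc_int_succ (N : ℕ) : Finset.Icc (-((N + 1 : ℕ):ℤ)) ((N + 1 : ℕ):ℤ) =
    insert (-((N:ℤ) + 1)) (insert ((N:ℤ) + 1) (Finset.Icc (-(N:ℤ)) (N:ℤ))) := by
  ext m; simp only [Finset.mem_insert, Finset.mem_Icc]; push_cast; omega

lemma sum_Icc_succ (g : ℤ → ℂ) (N : ℕ) : ∑ m ∈ Finset.Icc (-((N + 1 : ℕ):ℤ)) ((N + 1 : ℕ):ℤ), g m =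
    g (-((N:ℤ) + 1)) + (g ((N:ℤ) + 1) + ∑ m ∈ Finset.Icc (-(N:ℤ)) (N:ℤ), g m) := by
  rw [Icc_int_succ, Finset.sum_insert, Finset.sum_insert]
  · simp
  · simp only [Finset.mem_insert, Finset.mem_Icc]; omega

lemma dir_chr (N : ℕ) (u : ℝ) : ∑ m ∈ Finset.Icc (-(N:ℤ)) (N:ℤ), chr m u = 
    1 + ∑ j ∈ Finset.range N, (chr ((j:ℤ) + 1) u + chr (-((j:ℤ) + 1)) u) := by
  induction N with
  | zero => simp [chr_zero]
  | succ N ih => rw [sum_Icc_succ, ih, Finset.sum_range_succ]; ring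

lemma fej_aux (N : ℕ) (u : ℝ) : ∑ m ∈ Finset.Icc (-(N:ℤ)) (N:ℤ), ((N:ℂ) + 1 - |(m:ℝ)|) * chr m u =
    (Complex.normSq (∑ j ∈ Finset.range (N + 1), chr j u) : ℂ) := by
  induction N with
  | zero => simp [chr_zero]
  | succ N ih =>
    have h1 : ∑ m ∈ Finset.Icc (-((N + 1 : ℕ):ℤ)) ((N + 1 : ℕ):ℤ), (((N + 1 : ℕ):ℂ) + 1 - |(m:ℝ)|) * chr m u =
      ∑ m ∈ Finset.Icc (-((N + 1 : ℕ):ℤ)) ((N + 1 : ℕ):ℤ), chr m u + ∑ m ∈ Finset.Icc (-(N:ℤ)) (N:ℤ), ((N:ℂ) + 1 - |(m:ℝ)|) * chr m u := by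
      have : ∀ m : ℤ, (((N + 1 : ℕ):ℂ) + 1 - |(m:ℝ)|) * chr m u = chr m u + ((N:ℂ) + 1 - |(m:ℝ)|) * chr m u := by
        intro m; push_cast; ring
      simp only [this, Finset.sum_add_distrib]
      congr 1
      rw [sum_Icc_succ]
      have e1 : |((-((N:ℤ) + 1) : ℤ) : ℝ)| = N + 1 := by push_cast; rw [abs_neg, abs_of_nonneg (by positivity)]
      have e2 : |((((N:ℤ) + 1) : ℤ) : ℝ)| = N + 1 := by push_cast; rw [abs_of_nonneg (by positivity)]
      rw [e1, e2]; push_cast; ring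
    rw [h1, ih, dir_chr]
    rw [← Complex.mul_conj, ← Complex.mul_conj, Finset.sum_range_succ _ (N + 1), map_add]
    have h2 : chr ((N + 1 : ℕ):ℤ) u * (starRingEnd ℂ) (chr ((N + 1 : ℕ):ℤ) u) = 1 := by
      rw [conj_chr, ← chr_add, add_neg_cancel, chr_zero]
    have h3 : ∑ j ∈ Finset.range (N + 1), (chr ((j:ℤ) + 1) u + chr (-((j:ℤ) + 1)) u) = 
       chr ((N + 1 : ℕ):ℤ) u * (starRingEnd ℂ) (∑ j ∈ Finset.range (N + 1), chr j u) + 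
       (∑ j ∈ Finset.range (N + 1), chr j u) * (starRingEnd ℂ) (chr ((N + 1 : ℕ):ℤ) u) := by
      rw [map_sum, Finset.mul_sum, Finset.sum_mul, Finset.sum_add_distrib,
        ← Finset.sum_range_reflect (fun j : ℕ => chr ((j:ℤ) + 1) u), ← Finset.sum_range_reflect (fun j : ℕ => chr (-((j:ℤ) + 1)) u)]
      congr 1 <;> refine Finset.sum_congr rfl fun j hj => ?_
      · rw [conj_chr, ← chr_add]; congr 1
        have := Finset.mem_range.1 hj
        omega
      · rw [conj_chr, ← chr_add]; congr 1
        have := Finset.mem_range.1 hj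
        omega
    rw [h3]
    linear_combination -h2

lemma FN_eq (N : ℕ) (u : ℝ) : (FN N u : ℂ) = ∑ m ∈ Finset.Icc (-(N:ℤ)) (N:ℤ), (wF N m : ℂ) * chr m u := by
  unfold FN wF
  push_cast
  rw [← fej_aux, Finset.sum_div]
  refine Finset.sum_congr rfl fun m _ => ?_
  have : (N:ℂ) + 1 ≠ 0 := by exact_mod_cast Nat.succ_ne_zero N
  field_simp

lemma FN_nonneg (N : ℕ) (u : ℝ) : 0 ≤ FN N u := div_nonneg (Complex.normSq_nonneg _) (by positivity)

lemma FN_cont (N : ℕ) : Continuous (FN N) := by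
  have := chr_cont
  unfold FN
  refine Continuous.div_const (Complex.continuous_normSq.comp ?_) _
  exact continuous_finset_sum _ fun j _ => chr_cont j

lemma FN_int (N : ℕ) (x : ℝ) : ∫ t in Ico (-Real.pi) Real.pi, FN N (x - t) = 2 * Real.pi := by
  rw [integral_Ico_eq_integral_Ioc, ← intervalIntegral.integral_of_le (by linarith [Real.pi_pos])]
  rw [intervalIntegral.integral_comp_sub_left (FN N) x, sub_neg_eq_add]
  have : ((∫ u in (x - Real.pi)..(x + Real.pi), FN N u : ℝ) : ℂ) = ((2 * Real.pi : ℝ) : ℂ) := by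
    rw [← intervalIntegral.integral_ofReal]
    simp only [FN_eq]
    rw [intervalIntegral.integral_finset_sum (f := fun (m:ℤ) u => (wF N m : ℂ) * chr m u)
      (fun m _ => ((continuous_const.mul (chr_cont m)).intervalIntegrable _ _))]
    simp only [intervalIntegral.integral_const_mul, int_chr]
    rw [Finset.sum_eq_single 0]
    · simp [wF]
    · intro b _ hb; simp [hb]
    · intro h; exfalso; apply h; simp
  exact_mod_cast this

lemma log_ptw (a w : ℝ) (ha : 0 ≤ a) (hw : 0 < w) : a * Real.log w ≤ PhiY a + w * 0.368 := by
  have h1 : a * Real.log a ≤ PhiY a := by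
    unfold PhiY logPlus
    split_ifs with h
    · exact le_rfl
    · rw [mul_zero]; exact mul_nonpos_of_nonneg_of_nonpos ha (Real.log_nonpos ha (not_lt.1 h))
  rcases ha.eq_or_lt with h | h
  · rw [← h] at h1 ⊢; simp only [zero_mul] at h1 ⊢; positivity
  · have h2 : Real.log (w / a * Real.exp (-1)) ≤ w / a * Real.exp (-1) - 1 := Real.log_le_sub_one_of_pos (by positivity)
    rw [Real.log_mul (by positivity) (by positivity), Real.log_exp, Real.log_div hw.ne' h.ne'] at h2
    have h3 : a * (Real.log w - Real.log a) ≤ a * (w / a * Real.exp (-1)) := mul_le_mul_of_nonneg_left (by linarith) ha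
    rw [show a * (w / a * Real.exp (-1)) = w * Real.exp (-1) by field_simp] at h3
    have h4 : w * Real.exp (-1) ≤ w * 0.368 := mul_le_mul_of_nonneg_left exp_inv_le hw.le
    nlinarith

def SN (N : ℕ) : Finset (ℤ × ℤ) := Finset.Icc (-(N:ℤ)) (N:ℤ) ×ˢ Finset.Icc (-(N:ℤ)) (N:ℤ)
def cF (f : ℝ × ℝ → ℝ) (N : ℕ) (a : ℤ × ℤ) : ℂ := (wF N a.1 : ℂ) * (wF N a.2 : ℂ) * fourierCoef2 f a.1 a.2
def Fej (f : ℝ × ℝ → ℝ) (N : ℕ) (z : ℝ × ℝ) : ℝ :=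
  (1 / (4 * Real.pi ^ 2)) * ∫ p in T2, f p * (FN N (z.1 - p.1) * FN N (z.2 - p.2))

lemma T2_meas : MeasurableSet T2 := measurableSet_Ico.prod measurableSet_Ico

lemma T2_vol : volume T2 = ENNReal.ofReal (4 * Real.pi ^ 2) := by
  unfold T2 T1
  rw [Measure.volume_eq_prod, Measure.prod_prod, Real.volume_Ico, ← ENNReal.ofReal_mul (by linarith [Real.pi_pos])]
  congr 1; ring

lemma T2_fin : volume T2 ≠ ⊤ := by rw [T2_vol]; exact ENNReal.ofReal_ne_top

lemma exp_chr (m n : ℤ) (p : ℝ × ℝ) : Complex.exp (-Complex.I * ((m : ℂ) * (p.1 : ℂ) + (n : ℂ) * (p.2 : ℂ))) = chr (-m) p.1 * chr (-n) p.2 := by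
  unfold chr
  rw [← Complex.exp_add]; congr 1; push_cast; ring

lemma exp_chr2 (m n : ℤ) (x y : ℝ) : Complex.exp (Complex.I * ((m : ℂ) * (x : ℂ) + (n : ℂ) * (y : ℂ))) = chr m x * chr n y := by
  unfold chr
  rw [← Complex.exp_add]; congr 1; push_cast; ring

lemma int_bdd_mul {f : ℝ × ℝ → ℝ} (hf : IntegrableOn f T2) (g : ℝ × ℝ → ℂ) (hg : Continuous g) :
    IntegrableOn (fun p => (f p : ℂ) * g p) T2 := by
  have hc : IsCompact (Icc (-Real.pi) Real.pi ×ˢ Icc (-Real.pi) Real.pi) := isCompact_Icc.prod isCompact_Icc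
  obtain ⟨C, hC⟩ := hc.exists_bound_of_continuousOn hg.continuousOn
  refine Integrable.mul_bdd (c := C) hf.ofReal hg.aestronglyMeasurable ?_
  rw [ae_restrict_iff' T2_meas]
  refine Eventually.of_forall fun p hp => hC p ⟨Ico_subset_Icc_self hp.1, Ico_subset_Icc_self hp.2⟩

lemma int_bdd_mulR {f : ℝ × ℝ → ℝ} (hf : IntegrableOn f T2) (g : ℝ × ℝ → ℝ) (hg : Continuous g) :
    IntegrableOn (fun p => f p * g p) T2 := by
  have := (int_bdd_mul hf (fun p => (g p : ℂ)) (Complex.continuous_ofReal.comp hg)).re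
  refine this.congr (Eventually.of_forall fun p => ?_)
  simp

lemma kerc (N : ℕ) (z : ℝ × ℝ) : Continuous fun p : ℝ × ℝ => FN N (z.1 - p.1) * FN N (z.2 - p.2) := by
  have := FN_cont N; fun_prop

lemma fej_tp {f : ℝ × ℝ → ℝ} (hf : IntegrableOn f T2) (N : ℕ) (z : ℝ × ℝ) : tp (SN N) (cF f N) z = (Fej f N z : ℂ) := by
  unfold tp cF Fej fourierCoef2
  simp only [exp_chr]
  rw [Complex.ofReal_mul, ← integral_complex_ofReal]
  have hc := chr_cont
  have h1 : ∀ p : ℝ × ℝ, ((f p * (FN N (z.1 - p.1) * FN N (z.2 - p.2)) : ℝ) : ℂ) =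
      ∑ a ∈ SN N, ((wF N a.1 : ℂ) * (wF N a.2 : ℂ) * (chr a.1 z.1 * chr a.2 z.2)) * ((f p : ℂ) * (chr (-a.1) p.1 * chr (-a.2) p.2)) := by
    intro p
    push_cast
    rw [FN_eq, FN_eq, Finset.sum_mul_sum, Finset.mul_sum, SN, Finset.sum_product]
    refine Finset.sum_congr rfl fun m _ => ?_
    rw [Finset.mul_sum]
    refine Finset.sum_congr rfl fun k _ => ?_
    rw [chr_sub_arg, chr_sub_arg]; ring
  simp only [h1]
  rw [integral_finset_sum]
  · rw [Finset.mul_sum]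
    refine Finset.sum_congr rfl fun a _ => ?_
    rw [integral_const_mul]
    push_cast
    ring
  · intro a _
    refine Integrable.const_mul (int_bdd_mul hf _ ?_) _
    fun_prop

lemma Fej_cont {f : ℝ × ℝ → ℝ} (hf : IntegrableOn f T2) (N : ℕ) : Continuous (Fej f N) := by
  have : Fej f N = fun z => (tp (SN N) (cF f N) z).re := by ext z; rw [fej_tp hf, Complex.ofReal_re]
  rw [this]; exact Complex.continuous_re.comp (tp_cont _ _)

lemma Fej_per {f : ℝ × ℝ → ℝ} (hf : IntegrableOn f T2) (N : ℕ) (x y : ℝ) : Fej f N (x, y + 2 * Real.pi) = Fej f N (x, y) := by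
  have : Fej f N = fun z => (tp (SN N) (cF f N) z).re := by ext z; rw [fej_tp hf, Complex.ofReal_re]
  rw [this]; simp only [tp_per2]

lemma FF_int (N : ℕ) (z : ℝ × ℝ) : ∫ p in T2, FN N (z.1 - p.1) * FN N (z.2 - p.2) = 4 * Real.pi ^ 2 := by
  unfold T2 T1
  rw [Measure.volume_eq_prod, setIntegral_prod_mul (fun t => FN N (z.1 - t)) (fun t => FN N (z.2 - t)), FN_int, FN_int]; ring

lemma Fej_log {f : ℝ × ℝ → ℝ} (hf : IntegrableOn f T2) (h0 : ∀ p, 0 ≤ f p) (hh : IntegrableOn (fun p => PhiY (f p)) T2) (N : ℕ) 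
    (z : ℝ × ℝ) (w : ℝ) (hw : 0 < w) : Fej f N z * Real.log w ≤ Fej (fun p => PhiY (f p)) N z + w * 0.368 := by
  have hpi := Real.pi_pos
  have hk := kerc N z
  have h1 : ∫ p in T2, (f p * (FN N (z.1 - p.1) * FN N (z.2 - p.2))) * Real.log w ≤ 
     ∫ p in T2, (PhiY (f p) * (FN N (z.1 - p.1) * FN N (z.2 - p.2)) + (w * 0.368) * (FN N (z.1 - p.1) * FN N (z.2 - p.2))) := by
    have i3 : IntegrableOn (fun p : ℝ × ℝ => (w * 0.368) * (FN N (z.1 - p.1) * FN N (z.2 - p.2))) T2 :=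
      int_bdd_mulR (f := fun _ => w * 0.368) (integrableOn_const T2_fin) _ hk
    refine integral_mono ((int_bdd_mulR hf _ hk).mul_const _) ((int_bdd_mulR hh _ hk).add i3) fun p => ?_
    have := mul_le_mul_of_nonneg_right (log_ptw (f p) w (h0 p) hw) (mul_nonneg (FN_nonneg N (z.1 - p.1)) (FN_nonneg N (z.2 - p.2)))
    beta_reduce
    linarith
  rw [integral_mul_const, integral_add (int_bdd_mulR hh _ hk) (int_bdd_mulR (f := fun _ => w * 0.368) (integrableOn_const T2_fin) _ hk), integral_const_mul, FF_int] at h1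
  unfold Fej
  have h2 := mul_le_mul_of_nonneg_left h1 (by positivity : 0 ≤ 1 / (4 * Real.pi ^ 2))
  refine le_trans (le_of_eq (by ring)) (h2.trans (le_of_eq ?_))
  field_simp

lemma Fej_nonneg {f : ℝ × ℝ → ℝ} (h0 : ∀ p, 0 ≤ f p) (N : ℕ) (z : ℝ × ℝ) : 0 ≤ Fej f N z := by
  unfold Fej
  refine mul_nonneg (by positivity) (integral_nonneg fun p => mul_nonneg (h0 p) (mul_nonneg (FN_nonneg _ _) (FN_nonneg _ _)))

lemma A2_Fej {f : ℝ × ℝ → ℝ} (hf : IntegrableOn f T2) (N : ℕ) : A2 (Fej f N) = ∫ p in T2, f p := by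
  have hpi := Real.pi_pos
  have hc := chr_cont
  have ec : ∀ m : ℤ, ∫ x in (0:ℝ)..(2 * Real.pi), chr m x = if m = 0 then ((2 * Real.pi : ℝ) : ℂ) else 0 := by
    intro m
    have := int_chr m Real.pi
    rwa [sub_self, ← two_mul] at this
  have h1 : ((A2 (Fej f N) : ℝ) : ℂ) = ((∫ p in T2, f p : ℝ) : ℂ) := by
    unfold A2
    rw [← intervalIntegral.integral_ofReal]
    simp only [← intervalIntegral.integral_ofReal, ← fej_tp hf]
    have h2 : ∀ x : ℝ, ∫ y in (0:ℝ)..(2 * Real.pi), tp (SN N) (cF f N) (x, y) = ∑ a ∈ SN N, (cF f N a * (if a.2 = 0 then ((2 * Real.pi : ℝ) : ℂ) else 0)) * chr a.1 x := by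
      intro x
      unfold tp
      rw [intervalIntegral.integral_finset_sum (f := fun (a:ℤ × ℤ) y => cF f N a * (chr a.1 x * chr a.2 y))]
      · refine Finset.sum_congr rfl fun a _ => ?_
        rw [intervalIntegral.integral_const_mul, intervalIntegral.integral_const_mul, ec]; ring
      · intro a _
        refine Continuous.intervalIntegrable ?_ _ _
        fun_prop
    simp only [h2]
    rw [intervalIntegral.integral_finset_sum (f := fun (a:ℤ × ℤ) x => (cF f N a * (if a.2 = 0 then ((2 * Real.pi : ℝ) : ℂ) else 0)) * chr a.1 x)]
    · simp only [intervalIntegral.integral_const_mul, ec]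
      rw [Finset.sum_eq_single (0, 0)]
      · simp only [cF, wF, fourierCoef2, if_true, ← integral_complex_ofReal]
        have : (Real.pi : ℂ) ≠ 0 := by exact_mod_cast hpi.ne'
        simp only [Int.cast_zero, abs_zero, zero_div, sub_zero, Complex.ofReal_one, one_mul, zero_mul, add_zero, mul_zero, Complex.exp_zero, mul_one]
        push_cast
        field_simp
        ring
      · intro b _ hb
        by_cases h2 : b.2 = 0
        · by_cases h1 : b.1 = 0
          · exact absurd (Prod.ext h1 h2) hb
          · simp [h1]
        · simp [h2]
      · intro h; exfalso; apply h; simp [SN]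
    · intro a _
      refine Continuous.intervalIntegrable ?_ _ _
      fun_prop
  exact_mod_cast h1

lemma coef_conj (f : ℝ × ℝ → ℝ) (m n : ℤ) : fourierCoef2 f (-m) (-n) = (starRingEnd ℂ) (fourierCoef2 f m n) := by
  unfold fourierCoef2
  simp only [exp_chr]
  rw [map_mul, ← integral_conj]
  simp only [map_mul, conj_chr, Complex.conj_ofReal, map_div₀, map_one, map_pow]
  congr 2
  exact (Complex.conj_ofNat 4).symm ▸ rfl

lemma cN_conj (f : ℝ × ℝ → ℝ) (N : ℕ) (a : ℤ × ℤ) : cF f N (-a) = (starRingEnd ℂ) (cF f N a) := by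
  unfold cF wF
  simp only [Prod.fst_neg, Prod.snd_neg, coef_conj, map_mul, Complex.conj_ofReal, Int.cast_neg, abs_neg]

lemma fej_core {f : ℝ × ℝ → ℝ} (hf : IntegrableOn f T2) (h0 : ∀ p, 0 ≤ f p) (hh : IntegrableOn (fun p => PhiY (f p)) T2)
    (P Q : ℝ) (hP : ∫ p in T2, f p ≤ P) (hQ : ∫ p in T2, PhiY (f p) ≤ Q) (N : ℕ) (lam : ℝ) (hl : 0 < lam) :
    ∃ E : Set (ℝ × ℝ), ENNReal.ofReal lam * volume E ≤ 1150 * ENNReal.ofReal (4 * P) + 84 * ENNReal.ofReal (4 * (3 * P + 2 * Q + 100)) ∧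
      ∀ z ∈ T2, z ∉ E → ∀ n : ℕ,
        ∑ k ∈ Finset.range (n + 1), Real.exp (|(pS (SN N) (cF f N) k z).re| / (16 * (5000000 * lam))) ≤ 2 * (n + 1) := by
  refine poly_core (SN N) ?_ (cF f N) (cN_conj f N) (Fej f N) (Fej (fun p => PhiY (f p)) N) (fej_tp hf N) (Fej_nonneg h0 N) (Fej_cont hh N) 
    (Fej_per hh N) (Fej_log hf h0 hh N) P Q ((A2_Fej hf N).trans_le hP) ((A2_Fej hh N).trans_le hQ) lam hl
  intro a ha
  simp only [SN, Finset.mem_product, Finset.mem_Icc, Prod.fst_neg, Prod.snd_neg] at ha ⊢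
  omega

lemma pS_tendsto (f : ℝ × ℝ → ℝ) (k : ℕ) (z : ℝ × ℝ) : Tendsto (fun N => (pS (SN N) (cF f N) k z).re) atTop (nhds (Snn f k z.1 z.2)) := by
  unfold Snn
  refine (Complex.continuous_re.tendsto _).comp ?_
  simp only [exp_chr2]
  rw [← Finset.sum_product' (f := fun m k => fourierCoef2 f m k * (chr m z.1 * chr k z.2))]
  have hw : ∀ m : ℤ, Tendsto (fun N : ℕ => (wF N m : ℂ)) atTop (nhds 1) := by
    intro m
    have : Tendsto (fun N : ℕ => wF N m) atTop (nhds (1 - 0)) := by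
      unfold wF
      refine tendsto_const_nhds.sub ?_
      exact (tendsto_const_nhds).div_atTop (tendsto_natCast_atTop_atTop.atTop_add tendsto_const_nhds)
    rw [sub_zero] at this
    exact_mod_cast (Complex.continuous_ofReal.tendsto _).comp this
  have h2 : Tendsto (fun N : ℕ => ∑ a ∈ SN k, cF f N a * (chr a.1 z.1 * chr a.2 z.2)) atTop
      (nhds (∑ a ∈ SN k, fourierCoef2 f a.1 a.2 * (chr a.1 z.1 * chr a.2 z.2))) := by
    refine tendsto_finset_sum _ fun a _ => ?_
    unfold cF
    refine Tendsto.mul_const _ ?_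
    have := ((hw a.1).mul (hw a.2)).mul_const (fourierCoef2 f a.1 a.2)
    simpa using this
  refine h2.congr' ?_
  filter_upwards [eventually_ge_atTop k] with N hN
  unfold pS tp
  have hsub : SN k ⊆ SN N := by
    intro a ha
    simp only [SN, Finset.mem_product, Finset.mem_Icc] at ha ⊢
    omega
  rw [← Finset.sum_subset hsub]
  · refine Finset.sum_congr rfl fun a ha => ?_
    simp only [SN, Finset.mem_product, Finset.mem_Icc, ← abs_le] at ha
    simp [iI, ha.1, ha.2]
  · intro a _ ha
    simp only [SN, Finset.mem_product, Finset.mem_Icc, ← abs_le, not_and_or] at ha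
    rcases ha with h | h <;> simp [iI, h]

lemma step_eval (ξ : ℕ → ℝ) (n k : ℕ) (hk : k < n + 1) (t : ℝ) (ht : t ∈ Ioo ((k:ℝ) / ((n:ℝ) + 1)) (((k:ℝ) + 1) / ((n:ℝ) + 1))) :
    stepFun ξ n t = ξ k := by
  unfold stepFun
  have hn : (0:ℝ) < (n:ℝ) + 1 := by positivity
  rw [Finset.sum_eq_single k]
  · exact indicator_of_mem (Ioo_subset_Icc_self ht) _
  · intro j _ hj
    refine indicator_of_notMem ?_ _
    rintro ⟨h1, h2⟩
    have a1 := h1.trans_lt ht.2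
    have a2 := ht.1.trans_le h2
    rw [div_lt_div_iff_of_pos_right hn] at a1 a2
    have b1 : j < k + 1 := by exact_mod_cast a1
    have b2 : k < j + 1 := by exact_mod_cast a2
    omega
  · intro h; exact absurd (Finset.mem_range.2 hk) h

lemma step_lux (ξ : ℕ → ℝ) (n : ℕ) (lam : ℝ) (hl : 0 < lam)
    (h : ∑ k ∈ Finset.range (n + 1), Real.exp (|ξ k| / lam) ≤ 2 * (n + 1)) :
    luxNorm (volume.restrict (Set.Icc (0 : ℝ) 1)) PsiY (stepFun ξ n) ≤ lam := by
  have hn : (0:ℝ) < (n:ℝ) + 1 := by positivity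
  refine csInf_le ⟨0, fun x hx => hx.1.le⟩ ⟨hl, ?_⟩
  set F : ℝ → ENNReal := fun x => ENNReal.ofReal (PsiY (|stepFun ξ n x| / lam)) with hF
  set Z : Set ℝ := range fun j : ℕ => (j:ℝ) / ((n:ℝ) + 1)
  set U : Fin (n + 1) → Set ℝ := fun k => Ioo ((k:ℝ) / ((n:ℝ) + 1)) (((k:ℝ) + 1) / ((n:ℝ) + 1))
  have hsub : Icc (0:ℝ) 1 ⊆ Z ∪ ⋃ k, U k := by
    intro t ht
    by_cases hZ : t ∈ Z
    · exact Or.inl hZ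
    · right
      have h0 : 0 ≤ t * (n + 1) := mul_nonneg ht.1 hn.le
      set k := ⌊t * (n + 1)⌋₊ with hk
      have hk1 := Nat.floor_le h0
      have hk2 := Nat.lt_floor_add_one (t * ((n:ℝ) + 1))
      have hne : ∀ j : ℕ, (j:ℝ) ≠ t * (n + 1) := by
        intro j hj
        apply hZ
        refine ⟨j, ?_⟩
        beta_reduce
        rw [hj]; field_simp
      have hk3 : (k:ℝ) < t * (n + 1) := lt_of_le_of_ne hk1 (hne k)
      have hk4 : t * (n + 1) < n + 1 := by
        refine lt_of_le_of_ne (by nlinarith [ht.2]) ?_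
        have := hne (n + 1)
        push_cast at this
        exact this.symm
      have hk5 : k < n + 1 := by
        have := hk3.trans hk4
        exact_mod_cast this
      refine mem_iUnion.2 ⟨⟨k, hk5⟩, ?_, ?_⟩
      · rw [div_lt_iff₀ hn]; exact hk3
      · rw [lt_div_iff₀ hn]; exact hk2
  have hZ0 : volume Z = 0 := (countable_range _).measure_zero _
  have hU : ∀ k : Fin (n + 1), ∫⁻ x in U k, F x = ENNReal.ofReal ((Real.exp (|ξ k| / lam) - 1) / (n + 1)) := by
    intro k
    have : ∫⁻ x in U k, F x = ∫⁻ x in U k, ENNReal.ofReal (Real.exp (|ξ k| / lam) - 1) := by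
      refine setLIntegral_congr_fun measurableSet_Ioo fun x hx => ?_
      simp only [hF, PsiY]
      rw [step_eval ξ n k k.2 x hx]
    rw [this, setLIntegral_const, Real.volume_Ioo, ← ENNReal.ofReal_mul]
    · congr 1; field_simp; ring
    · have := Real.one_le_exp (by positivity : 0 ≤ |ξ k| / lam); linarith
  calc ∫⁻ x in Icc (0:ℝ) 1, F x ≤ ∫⁻ x in Z ∪ ⋃ k, U k, F x := lintegral_mono_set hsub
    _ ≤ (∫⁻ x in Z, F x) + ∫⁻ x in ⋃ k, U k, F x := lintegral_union_le F Z (⋃ k, U k)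
    _ ≤ 0 + ∑' k, ∫⁻ x in U k, F x := by
        refine add_le_add (le_of_eq (setLIntegral_measure_zero _ _ hZ0)) (lintegral_iUnion_le U F)
    _ = ENNReal.ofReal (∑ k ∈ Finset.range (n + 1), (Real.exp (|ξ k| / lam) - 1) / (n + 1)) := by
        rw [zero_add, tsum_fintype]
        simp only [hU]
        rw [Fin.sum_univ_eq_sum_range (fun k => ENNReal.ofReal ((Real.exp (|ξ k| / lam) - 1) / (n + 1))), ENNReal.ofReal_sum_of_nonneg]
        intro k _
        have := Real.one_le_exp (by positivity : 0 ≤ |ξ k| / lam)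
        exact div_nonneg (by linarith) hn.le
    _ ≤ 1 := by
        rw [← ENNReal.ofReal_one]
        refine ENNReal.ofReal_le_ofReal ?_
        rw [← Finset.sum_div, div_le_one hn, Finset.sum_sub_distrib, Finset.sum_const, Finset.card_range, nsmul_eq_mul]
        push_cast
        linarith

lemma lim_core {f : ℝ × ℝ → ℝ} (hf : IntegrableOn f T2) (h0 : ∀ p, 0 ≤ f p) (hh : IntegrableOn (fun p => PhiY (f p)) T2)
    (P Q : ℝ) (hP : ∫ p in T2, f p ≤ P) (hQ : ∫ p in T2, PhiY (f p) ≤ Q) (lam : ℝ) (hl : 0 < lam) :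
    ENNReal.ofReal lam * volume {z | z ∈ T2 ∧ ∃ n : ℕ, 2 * ((n:ℝ) + 1) < ∑ k ∈ Finset.range (n + 1), Real.exp (|Snn f k z.1 z.2| / (16 * (5000000 * lam)))} ≤ 
      1150 * ENNReal.ofReal (4 * P) + 84 * ENNReal.ofReal (4 * (3 * P + 2 * Q + 100)) := by
  choose E hE hzE using fun N => fej_core hf h0 hh P Q hP hQ N lam hl
  have hsub : {z | z ∈ T2 ∧ ∃ n : ℕ, 2 * ((n:ℝ) + 1) < ∑ k ∈ Finset.range (n + 1), Real.exp (|Snn f k z.1 z.2| / (16 * (5000000 * lam)))} ⊆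
      ⋃ N : ℕ, ⋂ M ≥ N, E M := by
    rintro z ⟨hz, n, hn⟩
    have ht : Tendsto (fun N => ∑ k ∈ Finset.range (n + 1), Real.exp (|(pS (SN N) (cF f N) k z).re| / (16 * (5000000 * lam)))) atTop
       (nhds (∑ k ∈ Finset.range (n + 1), Real.exp (|Snn f k z.1 z.2| / (16 * (5000000 * lam))))) := by
      refine tendsto_finset_sum _ fun k _ => ?_
      exact (Real.continuous_exp.tendsto _).comp (((pS_tendsto f k z).abs).div_const _)
    obtain ⟨N, hN⟩ := eventually_atTop.1 (ht.eventually (lt_mem_nhds hn))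
    refine mem_iUnion.2 ⟨N, mem_iInter₂.2 fun M hM => ?_⟩
    by_contra hc
    exact absurd (hzE M z hz hc n) (not_le.2 (hN M hM))
  have hmono : Monotone fun N : ℕ => ⋂ M ≥ N, E M := by
    intro a b hab
    refine iInter₂_mono' fun M hM => ⟨M, le_trans hab hM, le_rfl⟩
  refine (mul_le_mul' le_rfl (measure_mono hsub)).trans ?_
  rw [hmono.measure_iUnion, ENNReal.mul_iSup]
  refine iSup_le fun N => ?_
  exact (mul_le_mul' le_rfl (measure_mono (iInter₂_subset N le_rfl))).trans (hE N)

lemma PhiY_nonneg {a : ℝ} (ha : 0 ≤ a) : 0 ≤ PhiY a := by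
  unfold PhiY logPlus
  split_ifs with h
  · exact mul_nonneg ha (Real.log_nonneg h.le)
  · simp

lemma PhiY_mono {a b : ℝ} (ha : 0 ≤ a) (hab : a ≤ b) : PhiY a ≤ PhiY b := by
  by_cases h : 1 < a
  · unfold PhiY logPlus
    rw [if_pos h, if_pos (h.trans_le hab)]
    exact mul_le_mul hab (Real.log_le_log (by linarith) hab) (Real.log_nonneg h.le) (ha.trans hab)
  · have : PhiY a = 0 := by simp [PhiY, logPlus, h]
    rw [this]; exact PhiY_nonneg (ha.trans hab)

lemma PhiY_meas : Measurable PhiY := by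
  unfold PhiY logPlus
  exact measurable_id.mul (Measurable.ite measurableSet_Ioi Real.measurable_log measurable_const)

lemma le_PhiY (a : ℝ) : a ≤ 3 + PhiY a := by
  by_cases h : a ≤ 3
  · rcases le_total 0 a with h0 | h0
    · linarith [PhiY_nonneg h0]
    · have : PhiY a = 0 := by
        have : ¬ 1 < a := by linarith
        simp [PhiY, logPlus, this]
      linarith
  · push Not at h
    have h1 : 1 < a := by linarith
    have h2 : 1 ≤ Real.log a := by
      rw [Real.le_log_iff_exp_le (by linarith)]
      linarith [Real.exp_one_lt_d9]
    unfold PhiY logPlus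
    rw [if_pos h1]
    nlinarith

lemma pos_core {f : ℝ × ℝ → ℝ} (hm : Measurable f) (hf : IntegrableOn f T2) (h0 : ∀ p, 0 ≤ f p) 
    (h1 : ∫⁻ p in T2, ENNReal.ofReal (PhiY (f p)) ≤ 1) (lam : ℝ) (hl : 0 < lam) :
    volume {z | z ∈ T2 ∧ ∃ n : ℕ, 2 * ((n:ℝ) + 1) < ∑ k ∈ Finset.range (n + 1), Real.exp (|Snn f k z.1 z.2| / (16 * (5000000 * lam)))} ≤ 
      ENNReal.ofReal (712840 / lam) := by
  have hn : ∀ p, 0 ≤ PhiY (f p) := fun p => PhiY_nonneg (h0 p)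
  have hh : IntegrableOn (fun p => PhiY (f p)) T2 := by
    refine ⟨(PhiY_meas.comp hm).aestronglyMeasurable, ?_⟩
    rw [hasFiniteIntegral_iff_ofReal (Eventually.of_forall hn)]
    exact h1.trans_lt ENNReal.one_lt_top
  have hQ : ∫ p in T2, PhiY (f p) ≤ 1 := by
    rw [integral_eq_lintegral_of_nonneg_ae (Eventually.of_forall hn) hh.1]
    exact ENNReal.toReal_le_of_le_ofReal zero_le_one (by simpa using h1)
  have hP : ∫ p in T2, f p ≤ 121 := by
    have i3 : IntegrableOn (fun _ : ℝ × ℝ => (3:ℝ)) T2 volume := integrableOn_const T2_fin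
    have : ∫ p in T2, f p ≤ ∫ p in T2, (3 + PhiY (f p)) :=
      integral_mono hf (i3.add hh) fun p => le_PhiY _
    rw [integral_add i3 hh, setIntegral_const, measureReal_def, T2_vol, ENNReal.toReal_ofReal (by positivity), smul_eq_mul] at this
    have := Real.pi_lt_d2
    have := Real.pi_pos
    nlinarith
  have h := lim_core hf h0 hh 121 1 hP hQ lam hl
  have e : (1150 : ENNReal) * ENNReal.ofReal (4 * 121) + 84 * ENNReal.ofReal (4 * (3 * 121 + 2 * 1 + 100)) = ENNReal.ofReal 712840 := by
    rw [show (1150:ENNReal) = ENNReal.ofReal 1150 by simp, show (84:ENNReal) = ENNReal.ofReal 84 by simp, ← ENNReal.ofReal_mul (by norm_num), 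
      ← ENNReal.ofReal_mul (by norm_num), ← ENNReal.ofReal_add (by norm_num) (by norm_num)]
    norm_num
  rw [e, mul_comm] at h
  rw [ENNReal.ofReal_div_of_pos hl, ENNReal.le_div_iff_mul_le (Or.inl (by simpa using hl)) (Or.inl ENNReal.ofReal_ne_top)]
  exact h

lemma Snn_lin {f f1 f2 : ℝ × ℝ → ℝ} (h1 : IntegrableOn f1 T2) (h2 : IntegrableOn f2 T2) (μ : ℝ) (h : ∀ p, f p = μ * (f1 p - f2 p)) (k : ℕ) (x y : ℝ) :
    Snn f k x y = μ * (Snn f1 k x y - Snn f2 k x y) := by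
  have hc : ∀ m n, fourierCoef2 f m n = μ * (fourierCoef2 f1 m n - fourierCoef2 f2 m n) := by
    intro m n
    unfold fourierCoef2
    simp only [exp_chr]
    have cc := chr_cont
    rw [← mul_sub, ← integral_sub (int_bdd_mul h1 _ (by fun_prop)) (int_bdd_mul h2 _ (by fun_prop)), mul_left_comm, ← integral_const_mul (μ : ℂ)]
    refine congrArg _ ?_
    refine integral_congr_ae (Eventually.of_forall fun p => ?_)
    beta_reduce; rw [h]; push_cast; ring
  unfold Snn
  rw [← Complex.sub_re, ← Complex.re_ofReal_mul, ← Finset.sum_sub_distrib, Finset.mul_sum]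
  congr 1
  refine Finset.sum_congr rfl fun m _ => ?_
  rw [← Finset.sum_sub_distrib, Finset.mul_sum]
  refine Finset.sum_congr rfl fun n _ => ?_
  rw [hc]; ring

lemma mu_core {f : ℝ × ℝ → ℝ} (hm : Measurable f) (hf : IntegrableOn f T2) (μ : ℝ) (hμ : 0 < μ)
    (hlux : ∫⁻ p in T2, ENNReal.ofReal (PhiY (|f p| / μ)) ≤ 1) (lam : ℝ) (hl : 0 < lam) :
    volume {z | z ∈ T2 ∧ lam < Bop f z} ≤ ENNReal.ofReal (2 * 712840 * 160000000 * μ / lam) := by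
  set f1 : ℝ × ℝ → ℝ := fun p => max (f p) 0 / μ
  set f2 : ℝ × ℝ → ℝ := fun p => max (-f p) 0 / μ
  have m1 : Measurable f1 := (hm.max measurable_const).div_const _
  have m2 : Measurable f2 := (hm.neg.max measurable_const).div_const _
  have i1 : IntegrableOn f1 T2 := hf.pos_part.div_const _
  have i2 : IntegrableOn f2 T2 := hf.neg_part.div_const _
  have n1 : ∀ p, 0 ≤ f1 p := fun p => div_nonneg (le_max_right _ _) hμ.le
  have n2 : ∀ p, 0 ≤ f2 p := fun p => div_nonneg (le_max_right _ _) hμ.le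
  have l1 : ∫⁻ p in T2, ENNReal.ofReal (PhiY (f1 p)) ≤ 1 := by
    refine (lintegral_mono fun p => ENNReal.ofReal_le_ofReal (PhiY_mono (n1 p) ?_)).trans hlux
    exact div_le_div_of_nonneg_right (max_le (le_abs_self _) (abs_nonneg _)) hμ.le
  have l2 : ∫⁻ p in T2, ENNReal.ofReal (PhiY (f2 p)) ≤ 1 := by
    refine (lintegral_mono fun p => ENNReal.ofReal_le_ofReal (PhiY_mono (n2 p) ?_)).trans hlux
    exact div_le_div_of_nonneg_right (max_le (neg_le_abs _) (abs_nonneg _)) hμ.le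
  have hS : ∀ k x y, Snn f k x y = μ * (Snn f1 k x y - Snn f2 k x y) := by
    refine Snn_lin i1 i2 μ fun p => ?_
    simp only [f1, f2]
    rcases le_total 0 (f p) with h | h
    · rw [max_eq_left h, max_eq_right (by linarith)]; field_simp; ring
    · rw [max_eq_right h, max_eq_left (by linarith)]; field_simp; ring
  set L : ℝ := lam / (160000000 * μ) with hL
  have hL0 : 0 < L := by positivity
  have hsub : {z | z ∈ T2 ∧ lam < Bop f z} ⊆ 
     {z | z ∈ T2 ∧ ∃ n : ℕ, 2 * ((n:ℝ) + 1) < ∑ k ∈ Finset.range (n + 1), Real.exp (|Snn f1 k z.1 z.2| / (16 * (5000000 * L)))} ∪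
     {z | z ∈ T2 ∧ ∃ n : ℕ, 2 * ((n:ℝ) + 1) < ∑ k ∈ Finset.range (n + 1), Real.exp (|Snn f2 k z.1 z.2| / (16 * (5000000 * L)))} := by
    rintro z ⟨hz, hB⟩
    unfold Bop at hB
    obtain ⟨n, hn⟩ := exists_lt_of_lt_ciSup hB
    have h3 : 2 * ((n:ℝ) + 1) < ∑ k ∈ Finset.range (n + 1), Real.exp (|Snn f k z.1 z.2| / lam) := by
      by_contra hc
      push Not at hc
      exact absurd (step_lux (fun k => Snn f k z.1 z.2) n lam hl hc) (not_le.2 hn)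
    have h4 : ∀ k, Real.exp (|Snn f k z.1 z.2| / lam) ≤ 
       (Real.exp (|Snn f1 k z.1 z.2| / (16 * (5000000 * L))) + Real.exp (|Snn f2 k z.1 z.2| / (16 * (5000000 * L)))) / 2 := by
      intro k
      set a := |Snn f1 k z.1 z.2|
      set b := |Snn f2 k z.1 z.2|
      have e1 : |Snn f k z.1 z.2| / lam ≤ (a / (16 * (5000000 * L))) / 2 + (b / (16 * (5000000 * L))) / 2 := by
        rw [hS, abs_mul, abs_of_pos hμ]
        have : μ * |Snn f1 k z.1 z.2 - Snn f2 k z.1 z.2| / lam ≤ μ * (a + b) / lam :=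
          div_le_div_of_nonneg_right (mul_le_mul_of_nonneg_left (abs_sub _ _) hμ.le) hl.le
        refine this.trans (le_of_eq ?_)
        rw [hL]; field_simp; ring
      refine (Real.exp_le_exp.2 e1).trans ?_
      rw [Real.exp_add]
      have ea : Real.exp (a / (16 * (5000000 * L))) = Real.exp (a / (16 * (5000000 * L)) / 2) ^ 2 := by
        rw [← Real.exp_nat_mul]; congr 1; push_cast; ring
      have eb : Real.exp (b / (16 * (5000000 * L))) = Real.exp (b / (16 * (5000000 * L)) / 2) ^ 2 := by
        rw [← Real.exp_nat_mul]; congr 1; push_cast; ring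
      rw [ea, eb]
      nlinarith [sq_nonneg (Real.exp (a / (16 * (5000000 * L)) / 2) - Real.exp (b / (16 * (5000000 * L)) / 2))]
    have h5 := h3.trans_le (Finset.sum_le_sum fun k (_ : k ∈ Finset.range (n + 1)) => h4 k)
    rw [← Finset.sum_div, Finset.sum_add_distrib] at h5
    by_contra hc
    simp only [mem_union, not_or] at hc
    have c1 := hc.1
    have c2 := hc.2
    have d1 : ∑ k ∈ Finset.range (n + 1), Real.exp (|Snn f1 k z.1 z.2| / (16 * (5000000 * L))) ≤ 2 * ((n:ℝ) + 1) := by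
      by_contra h; exact c1 ⟨hz, n, not_le.1 h⟩
    have d2 : ∑ k ∈ Finset.range (n + 1), Real.exp (|Snn f2 k z.1 z.2| / (16 * (5000000 * L))) ≤ 2 * ((n:ℝ) + 1) := by
      by_contra h; exact c2 ⟨hz, n, not_le.1 h⟩
    linarith
  refine (measure_mono hsub).trans ((measure_union_le _ _).trans ((add_le_add (pos_core m1 i1 n1 l1 L hL0) (pos_core m2 i2 n2 l2 L hL0)).trans ?_))
  rw [← ENNReal.ofReal_add (by positivity) (by positivity)]
  refine ENNReal.ofReal_le_ofReal (le_of_eq ?_)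
  rw [hL]; field_simp; norm_num

theorem Bop_weak_type :
    ∃ c : ℝ, 0 < c ∧ ∀ f : ℝ × ℝ → ℝ, Measurable f → Biperiodic f →
      IntegrableOn f T2 →
      {lam : ℝ | 0 < lam ∧
          ∫⁻ p, ENNReal.ofReal (PhiY (|f p| / lam)) ∂(volume.restrict T2) ≤ 1}.Nonempty →
      ∀ lam : ℝ, 0 < lam →
        volume {p : ℝ × ℝ | p ∈ T2 ∧ lam < Bop f p} ≤
          ENNReal.ofReal (c * luxNorm (volume.restrict T2) PhiY f / lam) := by
  refine ⟨2 * 712840 * 160000000, by norm_num, fun f hm _ hf hne lam hl => ?_⟩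
  have hfin : volume {p : ℝ × ℝ | p ∈ T2 ∧ lam < Bop f p} ≠ ⊤ := measure_ne_top_of_subset (fun p hp => hp.1) T2_fin
  rw [← ENNReal.ofReal_toReal hfin]
  set V := (volume {p : ℝ × ℝ | p ∈ T2 ∧ lam < Bop f p}).toReal with hV
  refine ENNReal.ofReal_le_ofReal ?_
  have key : V * lam / (2 * 712840 * 160000000) ≤ luxNorm (volume.restrict T2) PhiY f := by
    refine le_csInf hne fun μ hμ => ?_
    have h := mu_core hm hf μ hμ.1 hμ.2 lam hl
    have hμ0 : 0 < μ := hμ.1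
    have h2 : V ≤ 2 * 712840 * 160000000 * μ / lam := ENNReal.toReal_le_of_le_ofReal (by positivity) h
    rw [le_div_iff₀ hl] at h2
    rw [div_le_iff₀ (by norm_num)]
    linarith
  rw [div_le_iff₀ (by norm_num)] at key
  rw [le_div_iff₀ hl]
  linarith
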